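/- arXiv:0711.0979 — 6 statements merged into one kernel-verified Lean document; each statement's English description precedes it below -/
import Mathlib

section
/- Let 1 ≤ n ≤ 4 and let φ be a minimal homeomorphism of the torus T^n with linear part L ∈ GL(n,ℤ). Then L is quasi-unipotent and 1 is an eigenvalue of L. -/
/-- The `n`-torus `ℝ^n/ℤ^n`, realized as a product of unit circles. -/
abbrev Torus (n : ℕ) := Fin n → AddCircle (1 : ℝ)

/-- The canonical projection `ℝ^n → T^n`. -/
noncomputable def torusProj (n : ℕ) (x : Fin n → ℝ) : Torus n :=
  fun i => (x i : AddCircle (1 : ℝ))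

/-- A homeomorphism is minimal if every (two-sided) orbit is dense. -/
def IsMinimal {X : Type*} [TopologicalSpace X] (φ : X ≃ₜ X) : Prop :=
  ∀ x : X, Dense (Set.range fun k : ℤ => (φ.toEquiv ^ k) x)

section
open MeasureTheory Set

/-- Invariance of a function on `ℝ^n` under integer translations. -/
def IsIntPeriodic {n : ℕ} {α : Type*} (g : (Fin n → ℝ) → α) : Prop :=
  ∀ (x : Fin n → ℝ) (ℓ : Fin n → ℤ), g (x + fun i => (ℓ i : ℝ)) = g x

lemma IsIntPeriodic.exists_mem_Icc {n : ℕ} {α : Type*} {g : (Fin n → ℝ) → α}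
    (hg : IsIntPeriodic g) (x : Fin n → ℝ) :
    ∃ y ∈ Icc (0 : Fin n → ℝ) 1, g y = g x := by
  refine ⟨fun i => Int.fract (x i), ⟨fun i => Int.fract_nonneg _, fun i => (Int.fract_lt_one _).le⟩,
    ?_⟩
  rw [← hg _ (fun i => ⌊x i⌋)]
  congr 1
  ext i
  simp

lemma IsIntPeriodic.exists_forall_le {n : ℕ} {g : (Fin n → ℝ) → ℝ}
    (hg : IsIntPeriodic g) (hc : Continuous g) : ∃ x₀, ∀ x, g x₀ ≤ g x := by
  obtain ⟨x₀, -, h⟩ := (isCompact_Icc (a := (0 : Fin n → ℝ)) (b := 1)).exists_isMinOn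
    ⟨0, by simp⟩ hc.continuousOn
  refine ⟨x₀, fun x => ?_⟩
  obtain ⟨y, hy, hxy⟩ := hg.exists_mem_Icc x
  exact hxy ▸ h hy

lemma IsIntPeriodic.fderiv {n : ℕ} {E : Type*} [NormedAddCommGroup E] [NormedSpace ℝ E]
    {g : (Fin n → ℝ) → E} (hg : IsIntPeriodic g) : IsIntPeriodic (fderiv ℝ g) := by
  intro x ℓ
  rw [← fderiv_comp_add_right]
  congr 1
  exact funext fun y => hg y ℓ

lemma IsIntPeriodic.exists_norm_le {n : ℕ} {E : Type*} [NormedAddCommGroup E]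
    {g : (Fin n → ℝ) → E} (hg : IsIntPeriodic g) (hc : Continuous g) :
    ∃ C, 0 ≤ C ∧ ∀ x, ‖g x‖ ≤ C := by
  obtain ⟨x₀, h⟩ := IsIntPeriodic.exists_forall_le (g := fun x => -‖g x‖)
    (fun x ℓ => by simp only [hg x ℓ]) (by fun_prop)
  exact ⟨‖g x₀‖, norm_nonneg _, fun x => by simpa using h x⟩

/-- The unit cube, as a fundamental domain of the integer lattice. -/
abbrev unitCube (n : ℕ) : Set (Fin n → ℝ) := ZSpan.fundamentalDomain (Pi.basisFun ℝ (Fin n))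

lemma volume_unitCube (n : ℕ) : volume (unitCube n) = 1 := by
  rw [unitCube, ZSpan.fundamentalDomain_pi_basisFun, Real.volume_pi_Ico]
  simp

lemma exists_int_of_mem_span {n : ℕ} {v : Fin n → ℝ}
    (hv : v ∈ Submodule.span ℤ (range (Pi.basisFun ℝ (Fin n)))) :
    ∃ ℓ : Fin n → ℤ, v = fun i => (ℓ i : ℝ) := by
  rw [Module.Basis.mem_span_iff_repr_mem] at hv
  choose ℓ hℓ using hv
  exact ⟨ℓ, funext fun i => by simpa using (hℓ i).symm⟩

/-- The image of the unit cube under an equivariant bijection has unit volume. -/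
lemma volume_image_unitCube {n : ℕ} {f : (Fin n → ℝ) → (Fin n → ℝ)} (hc : Continuous f)
    (hb : Function.Bijective f)
    (hf : ∀ x (ℓ : Fin n → ℤ), f (x + fun i => (ℓ i : ℝ)) = f x + fun i => (ℓ i : ℝ)) :
    volume (f '' unitCube n) = 1 := by
  have hD := ZSpan.isAddFundamentalDomain (Pi.basisFun ℝ (Fin n)) volume
  have : Countable (Submodule.span ℤ (range (Pi.basisFun ℝ (Fin n)))).toAddSubgroup :=
    inferInstanceAs (Countable (Submodule.span ℤ (range (Pi.basisFun ℝ (Fin n)))))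
  rw [← volume_unitCube n]
  refine (IsAddFundamentalDomain.measure_eq
    (G := (Submodule.span ℤ (range (Pi.basisFun ℝ (Fin n)))).toAddSubgroup) ?_ hD)
  have hm : MeasurableSet (f '' unitCube n) :=
    (ZSpan.fundamentalDomain_measurableSet _).image_of_continuousOn_injOn hc.continuousOn
      hb.1.injOn
  refine IsAddFundamentalDomain.mk' hm.nullMeasurableSet fun y => ?_
  obtain ⟨x, rfl⟩ := hb.2 y
  have key : ∀ v : Submodule.span ℤ (range (Pi.basisFun ℝ (Fin n))),
      v +ᵥ f x ∈ f '' unitCube n ↔ v +ᵥ x ∈ unitCube n := by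
    rintro ⟨v, hv⟩
    obtain ⟨ℓ, rfl⟩ := exists_int_of_mem_span hv
    have : (fun i => (ℓ i : ℝ)) + f x = f ((fun i => (ℓ i : ℝ)) + x) := by
      rw [add_comm, ← hf, add_comm]
    change (fun i => (ℓ i : ℝ)) + f x ∈ _ ↔ (fun i => (ℓ i : ℝ)) + x ∈ _
    rw [this]
    exact hb.1.mem_set_image
  obtain ⟨v, hv, hu⟩ := ZSpan.exist_unique_vadd_mem_fundamentalDomain (Pi.basisFun ℝ (Fin n)) x
  exact ⟨v, (key v).2 hv, fun w hw => hu w ((key w).1 hw)⟩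

lemma bijective_id_add {E : Type*} [NormedAddCommGroup E] [NormedSpace ℝ E] [CompleteSpace E]
    {g : E → E} {c : NNReal} (hg : LipschitzWith c g) (hc : c < 1) :
    Function.Bijective fun x => x + g x := by
  have happ : ApproximatesLinearOn (fun x => x + g x)
      ((ContinuousLinearEquiv.refl ℝ E : E ≃L[ℝ] E) : E →L[ℝ] E) univ c := by
    intro x _ y _
    simpa [dist_eq_norm, add_sub_add_comm] using hg.dist_le_mul x y
  rcases subsingleton_or_nontrivial E with h | h
  · exact ⟨Function.injective_of_subsingleton _, fun y => ⟨y, Subsingleton.elim _ _⟩⟩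
  · have hc' : Subsingleton E ∨
        c < ‖((ContinuousLinearEquiv.refl ℝ E).symm : E →L[ℝ] E)‖₊⁻¹ := by
      right
      have : ‖((ContinuousLinearEquiv.refl ℝ E).symm : E →L[ℝ] E)‖₊ = 1 := by
        ext; exact ContinuousLinearMap.norm_id
      rw [this]; simpa using hc
    exact ⟨injOn_univ.1 (happ.injOn hc'), happ.surjective hc'⟩

lemma integral_det_of_small {n : ℕ} {G : (Fin n → ℝ) → (Fin n → ℝ)} (hG : ContDiff ℝ 1 G)
    (hper : IsIntPeriodic G) : ∃ ε > 0, ∀ t : ℝ, 0 ≤ t → t < ε →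
      ∫ x in unitCube n, (ContinuousLinearMap.id ℝ (Fin n → ℝ) + t • fderiv ℝ G x).det = 1 := by
  have hdc : Continuous (fderiv ℝ G) := hG.continuous_fderiv one_ne_zero
  obtain ⟨C, hC0, hC⟩ := hper.fderiv.exists_norm_le hdc
  have hdet : Continuous fun A : (Fin n → ℝ) →L[ℝ] (Fin n → ℝ) =>
      (ContinuousLinearMap.id ℝ (Fin n → ℝ) + A).det :=
    ContinuousLinearMap.continuous_det.comp (by fun_prop)
  obtain ⟨δ, hδ, hpos⟩ := Metric.eventually_nhds_iff.1
    (hdet.continuousAt.eventually (lt_mem_nhds (a := 0) (b := _) (by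
      change 0 < (ContinuousLinearMap.id ℝ (Fin n → ℝ) + 0).det
      simp [ContinuousLinearMap.det])))
  refine ⟨min δ 1 / (C + 1), by positivity, fun t ht0 ht => ?_⟩
  rw [lt_div_iff₀ (by positivity)] at ht
  have htC : t * C < min δ 1 := by nlinarith
  have hlip : LipschitzWith (Real.toNNReal (t * C)) (fun x => t • G x) := by
    refine lipschitzWith_of_nnnorm_fderiv_le (𝕜 := ℝ) (by
      exact ((hG.differentiable one_ne_zero).const_smul t)) fun x => ?_
    rw [← NNReal.coe_le_coe, Real.coe_toNNReal _ (by positivity), coe_nnnorm,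
      fderiv_fun_const_smul (hG.differentiable one_ne_zero x), norm_smul, Real.norm_of_nonneg ht0]
    exact mul_le_mul_of_nonneg_left (hC x) ht0
  have hb : Function.Bijective fun x => x + t • G x := bijective_id_add hlip (by
    rw [← NNReal.coe_lt_coe, Real.coe_toNNReal _ (by positivity)]
    exact htC.trans_le (min_le_right _ _))
  have hderiv : ∀ x, HasFDerivAt (fun x => x + t • G x)
      (ContinuousLinearMap.id ℝ (Fin n → ℝ) + t • fderiv ℝ G x) x := fun x =>
    (hasFDerivAt_id x).add ((hG.differentiable one_ne_zero x).hasFDerivAt.const_smul t)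
  have hvol := volume_image_unitCube (f := fun x => x + t • G x)
    (by have := hG.continuous; fun_prop) hb (fun x ℓ => by simp only [hper x ℓ]; abel)
  rw [← lintegral_abs_det_fderiv_eq_addHaar_image volume
    (ZSpan.fundamentalDomain_measurableSet _) (fun x _ => (hderiv x).hasFDerivWithinAt)
    hb.1.injOn] at hvol
  have hp : ∀ x, 0 < (ContinuousLinearMap.id ℝ (Fin n → ℝ) + t • fderiv ℝ G x).det := by
    intro x
    refine hpos ?_
    rw [dist_zero_right, norm_smul, Real.norm_of_nonneg ht0]
    exact (mul_le_mul_of_nonneg_left (hC x) ht0).trans_lt (htC.trans_le (min_le_left _ _))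
  rw [integral_eq_lintegral_of_nonneg_ae (Filter.Eventually.of_forall fun x => (hp x).le)
    (Continuous.aestronglyMeasurable (ContinuousLinearMap.continuous_det.comp (by fun_prop)))]
  simp_rw [abs_of_pos (hp _)] at hvol
  rw [hvol]
  simp

lemma exists_eval_eq_det_add_smul {n : ℕ} (B : Matrix (Fin n) (Fin n) ℝ) :
    ∃ p : Polynomial ℝ, p.natDegree ≤ n ∧ ∀ t, p.eval t = (1 + t • B).det := by
  refine ⟨_, (Polynomial.natDegree_det_X_add_C_le B 1).trans_eq (Fintype.card_fin n), fun t => ?_⟩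
  rw [← Polynomial.coe_evalRingHom, RingHom.map_det, add_comm]
  congr 1
  ext i j
  rw [RingHom.mapMatrix_apply, Matrix.map_apply, Matrix.add_apply, Matrix.add_apply,
    Matrix.smul_apply, Matrix.smul_apply, Matrix.map_apply, Matrix.map_apply]
  rcases eq_or_ne i j with rfl | h
  · simpa using mul_comm _ _
  · simpa [Matrix.one_apply_ne h] using mul_comm _ _

lemma continuousLinearMap_det_eq {n : ℕ} (A : (Fin n → ℝ) →L[ℝ] (Fin n → ℝ)) :
    A.det = (LinearMap.toMatrix' (A : (Fin n → ℝ) →ₗ[ℝ] (Fin n → ℝ))).det :=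
  (LinearMap.det_toMatrix' _).symm

/-- The degree formula: an equivariant `C¹` perturbation of the identity has average Jacobian
determinant one. -/
lemma integral_det_id_add_fderiv {n : ℕ} {G : (Fin n → ℝ) → (Fin n → ℝ)} (hG : ContDiff ℝ 1 G)
    (hper : IsIntPeriodic G) :
    ∫ x in unitCube n, (ContinuousLinearMap.id ℝ (Fin n → ℝ) + fderiv ℝ G x).det = 1 := by
  obtain ⟨ε, hε, hint⟩ := integral_det_of_small hG hper
  have hdc : Continuous (fderiv ℝ G) := hG.continuous_fderiv one_ne_zero
  set v : ℕ → ℝ := fun j => ε / (j + 2) with hv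
  have hv0 : ∀ j, 0 ≤ v j := fun j => by positivity
  have hvε : ∀ j, v j < ε := fun j => by
    rw [hv, div_lt_iff₀ (by positivity)]
    nlinarith [(Nat.cast_nonneg j : (0 : ℝ) ≤ j)]
  have hinj : Function.Injective v := fun i j hij => by
    simp only [hv] at hij
    rw [div_eq_div_iff (by positivity) (by positivity)] at hij
    have := mul_left_cancel₀ hε.ne' hij
    exact_mod_cast (by linarith : (i : ℝ) = j)
  set s := Finset.range (n + 1)
  set w : ℕ → ℝ := fun j => (Lagrange.basis s v j).eval 1
  have hw : ∑ j ∈ s, w j = 1 := by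
    have := congrArg (Polynomial.eval 1) (Lagrange.sum_basis (hinj.injOn (s := s)) ⟨0, by simp [s]⟩)
    simpa [Polynomial.eval_finsetSum] using this
  have hd : ∀ x, (ContinuousLinearMap.id ℝ (Fin n → ℝ) + fderiv ℝ G x).det =
      ∑ j ∈ s, (ContinuousLinearMap.id ℝ (Fin n → ℝ) + v j • fderiv ℝ G x).det * w j := by
    intro x
    obtain ⟨p, hp, hpe⟩ := exists_eval_eq_det_add_smul
      (LinearMap.toMatrix' (fderiv ℝ G x : (Fin n → ℝ) →ₗ[ℝ] (Fin n → ℝ)))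
    have hpe' : ∀ t : ℝ, (ContinuousLinearMap.id ℝ (Fin n → ℝ) + t • fderiv ℝ G x).det =
        p.eval t := by
      intro t
      rw [hpe, continuousLinearMap_det_eq]
      congr 1
      simp [LinearMap.toMatrix'_id]
    have h1 := hpe' 1
    rw [one_smul] at h1
    rw [h1, Lagrange.eq_interpolate (f := p) (s := s) hinj.injOn (by
      refine lt_of_le_of_lt Polynomial.degree_le_natDegree ?_
      simp only [s, Finset.card_range]
      exact_mod_cast Nat.lt_succ_of_le hp), Lagrange.interpolate_apply, Polynomial.eval_finsetSum]
    exact Finset.sum_congr rfl fun j _ => by simp [hpe', w]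
  simp_rw [hd]
  have hfin : volume (unitCube n) ≠ ⊤ := by rw [volume_unitCube]; simp
  rw [integral_finsetSum]
  · simp_rw [integral_mul_const, hint _ (hv0 _) (hvε _), one_mul]
    exact hw
  · intro j _
    refine Integrable.mul_const ?_ _
    have hcont : Continuous fun x =>
        (ContinuousLinearMap.id ℝ (Fin n → ℝ) + v j • fderiv ℝ G x).det :=
      ContinuousLinearMap.continuous_det.comp (by fun_prop)
    refine (hcont.continuousOn.integrableOn_compact
      (isCompact_Icc (a := (0 : Fin n → ℝ)) (b := 1))).mono_set ?_
    rw [unitCube, ZSpan.fundamentalDomain_pi_basisFun, ← pi_univ_Icc]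
    exact pi_mono fun i _ => Ico_subset_Icc_self

/-- A degree-one `C¹` lift of a circle map which is locally constant where
`cos (2πs) ≤ η`. -/
lemma exists_collapse (η : ℝ) (hη : η < 1) : ∃ q q' : ℝ → ℝ, Continuous q' ∧
    (∀ s, HasDerivAt q (q' s) s) ∧ (∀ s, Real.cos (2 * Real.pi * s) ≤ η → q' s = 0) ∧
    ∀ (s : ℝ) (m : ℤ), q (s + m) = q s + m := by
  set ψ : ℝ → ℝ := fun s => max 0 (Real.cos (2 * Real.pi * s) - η) with hψ
  have hψc : Continuous ψ := by fun_prop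
  have hψp : Function.Periodic ψ 1 := fun s => by
    simp only [hψ, mul_add, mul_one, Real.cos_add_two_pi]
  have hpos : 0 < ∫ s in (0 : ℝ)..1, ψ s :=
    intervalIntegral.integral_pos one_pos hψc.continuousOn (fun s _ => le_max_left _ _)
      ⟨0, by simp, by simp [hψ, hη]⟩
  set c := ∫ s in (0 : ℝ)..1, ψ s
  refine ⟨fun s => c⁻¹ * ∫ u in (0 : ℝ)..s, ψ u, fun s => c⁻¹ * ψ s, by fun_prop, fun s => ?_,
    fun s hs => ?_, fun s m => ?_⟩
  · exact (hψc.integral_hasStrictDerivAt 0 s).hasDerivAt.const_mul _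
  · simp [hψ, hs]
  · have h1 : Function.Periodic (fun s => c⁻¹ * (∫ u in (0 : ℝ)..s, ψ u) - s) 1 := fun s => by
      have h0 : (∫ u in (0 : ℝ)..(s + 1), ψ u) = (∫ u in (0 : ℝ)..s, ψ u) + c := by
        rw [← intervalIntegral.integral_add_adjacent_intervals (hψc.intervalIntegrable 0 s)
          (hψc.intervalIntegrable s (s + 1)), hψp.intervalIntegral_add_eq s 0, zero_add]
      simp only [h0, mul_add, inv_mul_cancel₀ hpos.ne']
      ring
    have h2 := (h1.int_mul m) s
    simp only [mul_one] at h2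
    linarith

lemma exists_forall_lt_cos {n : ℕ} {G : (Fin n → ℝ) → (Fin n → ℝ)} (hG : ContDiff ℝ 1 G)
    (hper : IsIntPeriodic G) (η : ℝ) (hη : η < 1) :
    ∃ x, ∀ i, η < Real.cos (2 * Real.pi * (x i + G x i)) := by
  by_contra! hcon
  obtain ⟨q, q', hq'c, hq, hq0, hqm⟩ := exists_collapse η hη
  have hqd : ContDiff ℝ 1 q := contDiff_one_iff_deriv.2
    ⟨fun s => (hq s).differentiableAt, by rwa [funext fun s => (hq s).deriv]⟩
  have hGi : ∀ i, ContDiff ℝ 1 fun x => G x i := fun i => contDiff_pi.1 hG i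
  set K : (Fin n → ℝ) → (Fin n → ℝ) := fun x i => q (x i + G x i) - x i with hK
  have hKd : ContDiff ℝ 1 K := contDiff_pi.2 fun i =>
    (hqd.comp ((contDiff_apply ℝ ℝ i).add (hGi i))).sub (contDiff_apply ℝ ℝ i)
  have hKp : IsIntPeriodic K := fun x ℓ => by
    ext i
    simp only [hK, hper x ℓ, Pi.add_apply]
    rw [add_right_comm, hqm]
    ring
  have hint := integral_det_id_add_fderiv hKd hKp
  have hzero : ∀ x, (ContinuousLinearMap.id ℝ (Fin n → ℝ) + fderiv ℝ K x).det = 0 := by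
    intro x
    obtain ⟨i, hi⟩ := hcon x
    have hcomp : HasFDerivAt (fun y => y i + K y i)
        ((ContinuousLinearMap.proj i).comp
          (ContinuousLinearMap.id ℝ (Fin n → ℝ) + fderiv ℝ K x)) x :=
      (ContinuousLinearMap.proj (R := ℝ) (φ := fun _ : Fin n => ℝ) i).hasFDerivAt.comp x
        ((hasFDerivAt_id x).add (hKd.differentiable one_ne_zero x).hasFDerivAt)
    have hcomp' : HasFDerivAt (fun y => y i + K y i) (0 : (Fin n → ℝ) →L[ℝ] ℝ) x := by
      have h1 : HasFDerivAt (fun y : Fin n → ℝ => y i + G y i)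
          (fderiv ℝ (fun y : Fin n → ℝ => y i + G y i) x) x :=
        (((contDiff_apply ℝ ℝ i).add (hGi i)).differentiable one_ne_zero x).hasFDerivAt
      have h2 := (hq (x i + G x i)).comp_hasFDerivAt x h1
      rw [hq0 _ hi, zero_smul] at h2
      refine h2.congr_of_eventuallyEq (Filter.Eventually.of_forall fun y => ?_)
      simp [hK]
    have hrow := hcomp.unique hcomp'
    rw [continuousLinearMap_det_eq]
    refine Matrix.det_eq_zero_of_row_eq_zero i fun j => ?_
    have := DFunLike.congr_fun hrow (Pi.single j 1)
    simpa [LinearMap.toMatrix'_apply] using this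
  simp [hzero] at hint

lemma IsIntPeriodic.exists_contDiff_dist_le {n : ℕ} {g : (Fin n → ℝ) → (Fin n → ℝ)}
    (hg : IsIntPeriodic g) (hc : Continuous g) {δ : ℝ} (hδ : 0 < δ) :
    ∃ G : (Fin n → ℝ) → (Fin n → ℝ), ContDiff ℝ 1 G ∧ IsIntPeriodic G ∧
      ∀ x, dist (G x) (g x) ≤ δ := by
  obtain ⟨r, hr, hr1, hunif⟩ : ∃ r > 0, r ≤ 1 ∧ ∀ x y, dist y x < r → dist (g y) (g x) ≤ δ := by
    have huc := (isCompact_Icc (a := (-1 : Fin n → ℝ)) (b := 2)).uniformContinuousOn_of_continuous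
      hc.continuousOn
    rw [Metric.uniformContinuousOn_iff] at huc
    obtain ⟨r, hr, h⟩ := huc δ hδ
    refine ⟨min r 1, by positivity, min_le_right _ _, fun x y hxy => ?_⟩
    set ℓ : Fin n → ℤ := fun i => -⌊x i⌋
    rw [← hg x ℓ, ← hg y ℓ]
    have hx : ∀ i, (x + fun i => (ℓ i : ℝ)) i = Int.fract (x i) := fun i => by
      simp [ℓ, Int.fract, sub_eq_add_neg]
    have hd : dist (y + fun i => (ℓ i : ℝ)) (x + fun i => (ℓ i : ℝ)) < min r 1 := by
      rwa [dist_add_right]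
    have hyi : ∀ i, |(y + fun i => (ℓ i : ℝ)) i - Int.fract (x i)| ≤ 1 := fun i => by
      rw [← hx i, ← Real.dist_eq]
      exact (dist_le_pi_dist _ _ i).trans (hd.le.trans (min_le_right _ _))
    refine (h _ ⟨fun i => ?_, fun i => ?_⟩ _ ⟨fun i => ?_, fun i => ?_⟩
      (hd.trans_le (min_le_left _ _))).le
    · have h1 := (abs_le.1 (hyi i)).1
      have h2 := Int.fract_nonneg (x i)
      simp only [Pi.neg_apply, Pi.one_apply]
      linarith
    · have h1 := (abs_le.1 (hyi i)).2
      have h2 := Int.fract_lt_one (x i)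
      simp only [Pi.ofNat_apply]
      linarith
    · rw [hx]
      have h2 := Int.fract_nonneg (x i)
      simp only [Pi.neg_apply, Pi.one_apply]
      linarith
    · rw [hx]
      have h2 := Int.fract_lt_one (x i)
      simp only [Pi.ofNat_apply]
      linarith
  let φ : ContDiffBump (0 : Fin n → ℝ) := ⟨r / 2, r, by positivity, by linarith⟩
  refine ⟨convolution (φ.normed volume) g (ContinuousLinearMap.lsmul ℝ ℝ) volume, ?_,
    fun x ℓ => ?_, fun x => ?_⟩
  · exact φ.hasCompactSupport_normed.contDiff_convolution_left _ φ.contDiff_normed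
      hc.locallyIntegrable
  · simp only [convolution_def]
    congr 1
    ext1 t
    rw [add_sub_right_comm, hg]
  · exact φ.dist_normed_convolution_le hc.aestronglyMeasurable fun y hy => hunif x y hy

/-- A continuous periodic perturbation of the identity of `ℝ^n` has a zero. -/
theorem IsIntPeriodic.exists_add_eq_zero {n : ℕ} {g : (Fin n → ℝ) → (Fin n → ℝ)}
    (hg : IsIntPeriodic g) (hc : Continuous g) : ∃ x, x + g x = 0 := by
  have hci : ∀ i, Continuous fun x => g x i := fun i => (continuous_apply i).comp hc
  set Ψ : (Fin n → ℝ) → ℝ := fun x => ∑ i, (1 - Real.cos (2 * Real.pi * (x i + g x i))) with hΨ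
  have hΨp : IsIntPeriodic Ψ := fun x ℓ => by
    simp only [hΨ, hg x ℓ, Pi.add_apply]
    refine Finset.sum_congr rfl fun i _ => ?_
    rw [show 2 * Real.pi * (x i + (ℓ i : ℝ) + g x i) =
      2 * Real.pi * (x i + g x i) + ℓ i * (2 * Real.pi) by ring, Real.cos_add_int_mul_two_pi]
  obtain ⟨x₀, hx₀⟩ := hΨp.exists_forall_le (by fun_prop)
  have hnn : ∀ i, 0 ≤ 1 - Real.cos (2 * Real.pi * (x₀ i + g x₀ i)) := fun i => by
    linarith [Real.cos_le_one (2 * Real.pi * (x₀ i + g x₀ i))]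
  rcases (Finset.sum_nonneg fun i _ => hnn i : 0 ≤ Ψ x₀).eq_or_lt with h0 | h0
  · have h1 : ∀ i, ∃ m : ℤ, (m : ℝ) = x₀ i + g x₀ i := fun i => by
      have h2 := (Finset.sum_eq_zero_iff_of_nonneg fun i _ => hnn i).1 h0.symm i (Finset.mem_univ i)
      obtain ⟨m, hm⟩ := (Real.cos_eq_one_iff (2 * Real.pi * (x₀ i + g x₀ i))).1 (by linarith)
      exact ⟨m, mul_left_cancel₀ Real.two_pi_pos.ne' (by rw [← hm]; ring)⟩
    choose m hm using h1
    refine ⟨x₀ + fun i => ((-m i : ℤ) : ℝ), ?_⟩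
    rw [hg x₀ fun i => -m i]
    ext i
    simp only [Pi.add_apply, Pi.zero_apply, Int.cast_neg, hm]
    ring
  · exfalso
    set μ := Ψ x₀
    have hN : (0 : ℝ) < n + 1 := by positivity
    obtain ⟨G, hGd, hGp, hGg⟩ := hg.exists_contDiff_dist_le hc
      (δ := μ / (4 * Real.pi * (n + 1))) (by positivity)
    obtain ⟨x, hx⟩ := exists_forall_lt_cos hGd hGp (1 - μ / (2 * (n + 1)))
      (by have : 0 < μ / (2 * (n + 1)) := by positivity
          linarith)
    have hterm : ∀ i, 1 - Real.cos (2 * Real.pi * (x i + g x i)) ≤ μ / (n + 1) := fun i => by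
      have h1 : |Real.cos (2 * Real.pi * (x i + G x i)) - Real.cos (2 * Real.pi * (x i + g x i))|
          ≤ μ / (2 * (n + 1)) := by
        have h2 := Real.abs_cos_sub_cos_le (2 * Real.pi * (x i + G x i))
          (2 * Real.pi * (x i + g x i))
        have h3 : |G x i - g x i| ≤ μ / (4 * Real.pi * (n + 1)) :=
          (dist_le_pi_dist (G x) (g x) i).trans (hGg x)
        rw [show 2 * Real.pi * (x i + G x i) - 2 * Real.pi * (x i + g x i) =
          2 * Real.pi * (G x i - g x i) by ring, abs_mul, abs_of_pos Real.two_pi_pos] at h2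
        refine h2.trans ((mul_le_mul_of_nonneg_left h3 Real.two_pi_pos.le).trans_eq ?_)
        have := Real.pi_pos
        field_simp
        ring
      have h4 : μ / (n + 1) = μ / (2 * (n + 1)) + μ / (2 * (n + 1)) := by field_simp; ring
      linarith [(abs_le.1 h1).2, hx i]
    have hsum : Ψ x ≤ ∑ _i : Fin n, μ / (n + 1) := Finset.sum_le_sum fun i _ => hterm i
    rw [Finset.sum_const, Finset.card_univ, Fintype.card_fin, nsmul_eq_mul] at hsum
    have : (n : ℝ) * (μ / (n + 1)) < μ := by
      rw [mul_div_assoc', div_lt_iff₀ hN]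
      nlinarith
    linarith [hx₀ x]

lemma norm_eq_one_of_root {p : Polynomial ℤ} (hm : p.Monic)
    (hirr : Irreducible (p.map (Int.castRingHom ℚ))) (hdeg : p.natDegree ≤ 3)
    (h0 : IsUnit (p.coeff 0)) {w u : ℂ} (hw : Polynomial.aeval w p = 0) (hw1 : ‖w‖ = 1)
    (hu : Polynomial.aeval u p = 0) : ‖u‖ = 1 := by
  classical
  set P := p.map (Int.castRingHom ℂ) with hP
  have hPm : P.Monic := hm.map _
  have hsplit : P.Splits := IsAlgClosed.splits P
  have hmem : ∀ a : ℂ, a ∈ P.roots ↔ Polynomial.aeval a p = 0 := fun a => by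
    rw [Polynomial.mem_roots hPm.ne_zero, Polynomial.IsRoot, hP, Polynomial.eval_map]
    rfl
  have hcard : P.roots.card = p.natDegree := by
    rw [← hsplit.natDegree_eq_card_roots, hP, hm.natDegree_map]
  have hprod : (P.roots.map norm).prod = 1 := by
    have h1 := hsplit.coeff_zero_eq_prod_roots_of_monic hPm
    have h2 : ‖P.coeff 0‖ = 1 := by
      rw [hP, Polynomial.coeff_map]
      rcases Int.isUnit_iff.1 h0 with h | h <;> simp [h]
    rw [h1, norm_mul, norm_pow, norm_neg, norm_one, one_pow, one_mul] at h2
    rw [← h2]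
    exact (map_multiset_prod (normHom : ℂ →*₀ ℝ) P.roots).symm
  by_cases hconj : (starRingEnd ℂ) w = w
  · obtain ⟨r, rfl⟩ := Complex.conj_eq_iff_real.1 hconj
    obtain ⟨m, hm'⟩ : ∃ m : ℚ, (r : ℂ) = m := by
      rw [Complex.norm_real, Real.norm_eq_abs] at hw1
      rcases (abs_eq zero_le_one).1 hw1 with h | h
      · exact ⟨1, by simp [h]⟩
      · exact ⟨-1, by simp [h]⟩
    have hroot : (p.map (Int.castRingHom ℚ)).IsRoot m := by
      rw [Polynomial.IsRoot, Polynomial.eval_map]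
      apply (algebraMap ℚ ℂ).injective
      rw [map_zero, Polynomial.hom_eval₂]
      rw [hm'] at hw
      exact hw
    have hd := Polynomial.degree_eq_one_of_irreducible_of_root hirr hroot
    have hd' : (p.map (Int.castRingHom ℚ)).natDegree = 1 :=
      Polynomial.natDegree_eq_of_degree_eq_some hd
    rw [hm.natDegree_map] at hd'
    rw [hd'] at hcard
    obtain ⟨a, ha⟩ := Multiset.card_eq_one.1 hcard
    have h1 := (hmem _).2 hw
    have h2 := (hmem _).2 hu
    rw [ha, Multiset.mem_singleton] at h1 h2
    rw [h2, ← h1, hw1]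
  · have hcw : (starRingEnd ℂ) w ∈ P.roots := by
      rw [hmem, Polynomial.aeval_def, show algebraMap ℤ ℂ = (starRingEnd ℂ).comp (algebraMap ℤ ℂ)
        from RingHom.ext_int _ _, ← Polynomial.hom_eval₂]
      rw [Polynomial.aeval_def] at hw
      rw [hw, map_zero]
    obtain ⟨s, hs⟩ := Multiset.exists_cons_of_mem ((hmem w).2 hw)
    rw [hs, Multiset.mem_cons, or_iff_right hconj] at hcw
    obtain ⟨t, ht⟩ := Multiset.exists_cons_of_mem hcw
    rw [ht] at hs
    have h2 := (hmem _).2 hu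
    rw [hs, Multiset.card_cons, Multiset.card_cons] at hcard
    rw [hs] at hprod h2
    have htc : t.card ≤ 1 := by omega
    simp only [Multiset.map_cons, Multiset.prod_cons, hw1, Complex.norm_conj, one_mul] at hprod
    rw [Multiset.mem_cons, Multiset.mem_cons] at h2
    rcases h2 with rfl | rfl | h2
    · exact hw1
    · rwa [Complex.norm_conj]
    · obtain ⟨a, rfl⟩ := Multiset.card_eq_one.1
        (le_antisymm htc (Multiset.card_pos_iff_exists_mem.2 ⟨u, h2⟩))
      rw [Multiset.mem_singleton] at h2
      simpa [h2] using hprod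

lemma exists_pow_eq_one_of_forall_root {p : Polynomial ℤ} (hm : p.Monic)
    (h : ∀ u : ℂ, Polynomial.aeval u p = 0 → ‖u‖ = 1) {z : ℂ} (hz : Polynomial.aeval z p = 0) :
    ∃ m : ℕ, 0 < m ∧ z ^ m = 1 := by
  have hPm : (p.map (Int.castRingHom ℂ)).Monic := hm.map _
  have hmem : ∀ a : ℂ, a ∈ (p.map (Int.castRingHom ℂ)).roots ↔ Polynomial.aeval a p = 0 :=
    fun a => by
      rw [Polynomial.mem_roots hPm.ne_zero, Polynomial.IsRoot, Polynomial.eval_map]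
      rfl
  refine Polynomial.pow_eq_one_of_mahlerMeasure_eq_one (p := p) ?_ ?_
    (by rw [Polynomial.mem_aroots]; exact ⟨hm.ne_zero, hz⟩)
  · rw [Polynomial.mahlerMeasure_eq_leadingCoeff_mul_prod_roots, hPm.leadingCoeff, norm_one,
      one_mul]
    refine Multiset.prod_eq_one fun x hx => ?_
    obtain ⟨a, ha, rfl⟩ := Multiset.mem_map.1 hx
    rw [h a ((hmem a).1 ha), max_self]
  · intro h0
    have := h z hz
    simp [h0] at this

/-- The non-cyclotomic irreducible factors of a monic integer polynomial of degree at most four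
with unit constant term that vanishes at `1` are hyperbolic. -/
lemma exists_hyperbolic_factor {p : Polynomial ℤ} (hm : p.Monic) (hdeg : p.natDegree ≤ 4)
    (h0 : IsUnit (p.coeff 0)) (h1 : p.IsRoot 1) {z : ℂ} (hz : Polynomial.aeval z p = 0)
    (hzu : ¬ ∃ m : ℕ, 0 < m ∧ z ^ m = 1) :
    ∃ q : Polynomial ℤ, q.Monic ∧ IsUnit (q.coeff 0) ∧ Irreducible (q.map (Int.castRingHom ℚ)) ∧
      Polynomial.aeval z q = 0 ∧ ∀ w : ℂ, Polynomial.aeval w q = 0 → ‖w‖ ≠ 1 := by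
  have hint : IsIntegral ℤ z := ⟨p, hm, hz⟩
  set q := minpoly ℤ z
  have hqm : q.Monic := minpoly.monic hint
  have hqz : Polynomial.aeval z q = 0 := minpoly.aeval ℤ z
  have hqirr : Irreducible (q.map (Int.castRingHom ℚ)) := by
    have := minpoly.isIntegrallyClosed_eq_field_fractions' ℚ hint
    rw [← show minpoly ℚ z = q.map (Int.castRingHom ℚ) from this]
    exact minpoly.irreducible hint.tower_top
  obtain ⟨s, hs⟩ := minpoly.isIntegrallyClosed_dvd hint hz
  have hsm : s.Monic := hqm.of_mul_monic_left (hs ▸ hm)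
  have hq0 : IsUnit (q.coeff 0) := by
    rw [hs, Polynomial.mul_coeff_zero] at h0
    exact isUnit_of_mul_isUnit_left h0
  have hq1 : q.eval 1 ≠ 0 := by
    intro h
    obtain ⟨r, hr⟩ := Polynomial.dvd_iff_isRoot.2 h
    have hr' := congrArg (Polynomial.map (Int.castRingHom ℚ)) hr
    rw [Polynomial.map_mul] at hr'
    have hroot : (q.map (Int.castRingHom ℚ)).IsRoot 1 := by
      rw [hr']; simp
    have hd := Polynomial.degree_eq_one_of_irreducible_of_root hqirr hroot
    have hd' : (q.map (Int.castRingHom ℚ)).natDegree = 1 :=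
      Polynomial.natDegree_eq_of_degree_eq_some hd
    rw [hqm.natDegree_map] at hd'
    have hrm : r.Monic := (Polynomial.monic_X_sub_C (1 : ℤ)).of_mul_monic_left (hr ▸ hqm)
    have hrd : r.natDegree = 0 := by
      rw [hr, (Polynomial.monic_X_sub_C (1 : ℤ)).natDegree_mul hrm,
        Polynomial.natDegree_X_sub_C] at hd'
      omega
    rw [Polynomial.eq_one_of_monic_natDegree_zero hrm hrd, mul_one] at hr
    rw [hr] at hqz
    refine hzu ⟨1, one_pos, ?_⟩
    simpa [sub_eq_zero] using hqz
  have hs1 : s.eval 1 = 0 := by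
    rw [Polynomial.IsRoot, hs, Polynomial.eval_mul] at h1
    exact (mul_eq_zero.1 h1).resolve_left hq1
  have hsd : s.natDegree ≠ 0 := fun h => by
    rw [Polynomial.eq_one_of_monic_natDegree_zero hsm h] at hs1
    simp at hs1
  have hqd : q.natDegree ≤ 3 := by
    rw [hs, hqm.natDegree_mul hsm] at hdeg
    change q.natDegree + _ ≤ 4 at hdeg
    omega
  refine ⟨q, hqm, hq0, hqirr, hqz, fun w hw hw1 => hzu ?_⟩
  exact exists_pow_eq_one_of_forall_root hqm
    (fun u hu => norm_eq_one_of_root hqm hqirr hqd hq0 hw hw1 hu) hqz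

open Matrix in
/-- An irreducible factor of the characteristic polynomial is realized by a cyclic integer block. -/
lemma exists_cyclic_vector {n : ℕ} (L : Matrix (Fin n) (Fin n) ℤ) {q : Polynomial ℤ}
    (hqm : q.Monic) (hirr : Irreducible (q.map (Int.castRingHom ℚ))) {z : ℂ}
    (hz : (L.map (Int.cast : ℤ → ℂ)).charpoly.IsRoot z) (hqz : Polynomial.aeval z q = 0) :
    ∃ v : Fin n → ℤ, v ≠ 0 ∧ v ᵥ* Polynomial.aeval L q = 0 ∧
      (Matrix.of (fun j : Fin q.natDegree => v ᵥ* L ^ (j : ℕ)) *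
        (Matrix.of (fun j : Fin q.natDegree => v ᵥ* L ^ (j : ℕ)))ᵀ).det ≠ 0 := by
  have hdet : (Polynomial.aeval L q).det = 0 := by
    have hspec := Matrix.mem_spectrum_of_isRoot_charpoly hz
    have h1 := spectrum.subset_polynomial_aeval (L.map (Int.cast : ℤ → ℂ))
      (q.map (Int.castRingHom ℂ)) ⟨z, hspec, rfl⟩
    have h2 : Polynomial.eval z (q.map (Int.castRingHom ℂ)) = 0 := by
      rw [Polynomial.eval_map]; exact hqz
    simp only [h2] at h1
    rw [spectrum.zero_mem_iff, Matrix.isUnit_iff_isUnit_det, isUnit_iff_ne_zero, not_not] at h1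
    have h3 : Polynomial.aeval (L.map (Int.cast : ℤ → ℂ)) (q.map (Int.castRingHom ℂ)) =
        (Int.castRingHom ℂ).mapMatrix (Polynomial.aeval L q) := by
      rw [Polynomial.aeval_def, Polynomial.aeval_def, Polynomial.eval₂_map, Polynomial.hom_eval₂]
      congr 1
      exact RingHom.ext_int _ _
    rw [h3, ← RingHom.map_det] at h1
    exact (Int.castRingHom ℂ).injective_int (by rw [h1, map_zero])
  obtain ⟨v, hv0, hv⟩ := Matrix.exists_vecMul_eq_zero_iff.2 hdet
  refine ⟨v, hv0, hv, fun hP => ?_⟩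
  obtain ⟨c, hc0, hc⟩ := Matrix.exists_vecMul_eq_zero_iff.2 hP
  set P := Matrix.of (fun j : Fin q.natDegree => v ᵥ* L ^ (j : ℕ)) with hPdef
  have hcP : c ᵥ* P = 0 := by
    rw [← dotProduct_self_eq_zero]
    have h1 : (c ᵥ* P) ⬝ᵥ (c ᵥ* P) = (c ᵥ* (P * Pᵀ)) ⬝ᵥ c := by
      rw [← dotProduct_mulVec, ← vecMul_vecMul, vecMul_transpose, dotProduct_comm]
    rw [h1, hc, zero_dotProduct]
  set C : Polynomial ℤ := ∑ j : Fin q.natDegree, Polynomial.monomial (j : ℕ) (c j) with hC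
  have hCcoeff : ∀ j : Fin q.natDegree, C.coeff j = c j := fun j => by
    rw [hC, Polynomial.finsetSum_coeff, Finset.sum_eq_single j]
    · simp
    · intro i _ hij
      rw [Polynomial.coeff_monomial, if_neg fun h => hij (Fin.ext h)]
    · simp
  have hC0 : C ≠ 0 := fun h => hc0 (funext fun j => by rw [← hCcoeff, h]; rfl)
  have hCdeg : C.natDegree < q.natDegree := by
    have hpos : 0 < q.natDegree := by
      by_contra h
      exact hc0 (funext fun j => absurd j.pos h)
    refine lt_of_le_of_lt (Polynomial.natDegree_sum_le_of_forall_le (n := q.natDegree - 1) _ _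
      fun j _ => (Polynomial.natDegree_monomial_le _).trans (by omega)) (by omega)
  have hvC : v ᵥ* Polynomial.aeval L C = 0 := by
    rw [← hcP, hC, map_sum, vecMul_sum, vecMul_eq_sum]
    refine Finset.sum_congr rfl fun j _ => ?_
    rw [Polynomial.aeval_monomial, ← Algebra.smul_def, vecMul_smul]
    rfl
  have hcop : IsCoprime (q.map (Int.castRingHom ℚ)) (C.map (Int.castRingHom ℚ)) := by
    rw [hirr.coprime_iff_not_dvd]
    intro hd
    have hCm : C.map (Int.castRingHom ℚ) ≠ 0 :=
      (Polynomial.map_ne_zero_iff (Int.castRingHom ℚ).injective_int).2 hC0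
    have := Polynomial.natDegree_le_of_dvd hd hCm
    rw [hqm.natDegree_map, Polynomial.natDegree_map_eq_of_injective
      (Int.castRingHom ℚ).injective_int] at this
    omega
  obtain ⟨a, b, hab⟩ := hcop
  have hmap : ∀ r : Polynomial ℤ, v ᵥ* Polynomial.aeval L r = 0 →
      (fun i => (v i : ℚ)) ᵥ* Polynomial.aeval (L.map (Int.cast : ℤ → ℚ))
        (r.map (Int.castRingHom ℚ)) = 0 := by
    intro r hr
    have h3 : Polynomial.aeval (L.map (Int.cast : ℤ → ℚ)) (r.map (Int.castRingHom ℚ)) =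
        (Int.castRingHom ℚ).mapMatrix (Polynomial.aeval L r) := by
      rw [Polynomial.aeval_def, Polynomial.aeval_def, Polynomial.eval₂_map, Polynomial.hom_eval₂]
      congr 1
      exact RingHom.ext_int _ _
    rw [h3]
    ext i
    have := RingHom.map_vecMul (Int.castRingHom ℚ) (Polynomial.aeval L r) v i
    rw [hr] at this
    simpa [Function.comp_def] using this.symm
  have hone := congrArg (fun r => (fun i => (v i : ℚ)) ᵥ*
    Polynomial.aeval (L.map (Int.cast : ℤ → ℚ)) r) hab
  simp only [mul_comm a, mul_comm b, map_add, map_mul, map_one, vecMul_add, ← vecMul_vecMul,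
    hmap q hv, hmap C hvC, zero_vecMul, add_zero, vecMul_one] at hone
  exact hv0 (funext fun i => by have := congrFun hone i; simpa using this.symm)

lemma norm_le_one_of_mem_spectrum {E : Type*} [NormedAddCommGroup E] [NormedSpace ℂ E]
    [CompleteSpace E] {T : E →L[ℂ] E} (hT : ‖T‖ ≤ 1) {k : ℂ} (hk : k ∈ spectrum ℂ T) :
    ‖k‖ ≤ 1 := by
  have h1 : ‖k‖ ≤ ‖T‖ * ‖(1 : E →L[ℂ] E)‖ := spectrum.norm_le_norm_mul_of_mem hk
  have h2 : ‖(1 : E →L[ℂ] E)‖ ≤ 1 := ContinuousLinearMap.norm_id_le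
  nlinarith [norm_nonneg T]

/-- The composition (Koopman) operator on complex continuous functions. -/
noncomputable def koopman {X : Type*} [TopologicalSpace X] [CompactSpace X] (f : C(X, X)) :
    C(X, ℂ) →L[ℂ] C(X, ℂ) :=
  LinearMap.mkContinuous (ContinuousMap.compRightAlgHom ℂ ℂ f).toLinearMap 1 fun g => by
    rw [one_mul]
    exact (ContinuousMap.norm_le _ (norm_nonneg _)).2 fun x => g.norm_coe_le_norm (f x)

lemma koopman_apply {X : Type*} [TopologicalSpace X] [CompactSpace X] (f : C(X, X)) (g : C(X, ℂ))
    (x : X) : koopman f g x = g (f x) := rfl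

lemma norm_koopman_le {X : Type*} [TopologicalSpace X] [CompactSpace X] (f : C(X, X)) :
    ‖koopman f‖ ≤ 1 :=
  LinearMap.mkContinuous_norm_le _ zero_le_one _

lemma koopman_pow_apply {X : Type*} [TopologicalSpace X] [CompactSpace X] (f : C(X, X))
    (j : ℕ) (g : C(X, ℂ)) (x : X) : (koopman f ^ j) g x = g (f^[j] x) := by
  induction j generalizing x with
  | zero => rfl
  | succ j ih =>
    rw [pow_succ', mul_apply_eq_comp, koopman_apply, ih, Function.iterate_succ_apply]

lemma norm_eq_one_of_mem_spectrum_koopman {X : Type*} [TopologicalSpace X] [CompactSpace X]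
    (φ : X ≃ₜ X) {k : ℂ} (hk : k ∈ spectrum ℂ (koopman (φ : C(X, X)))) : ‖k‖ = 1 := by
  have hle : ∀ (f : C(X, X)) (k : ℂ), k ∈ spectrum ℂ (koopman f) → ‖k‖ ≤ 1 :=
    fun f k hk => norm_le_one_of_mem_spectrum (norm_koopman_le f) hk
  let u : (C(X, ℂ) →L[ℂ] C(X, ℂ))ˣ :=
    ⟨koopman (φ : C(X, X)), koopman (φ.symm : C(X, X)),
      by ext g x; simp [koopman_apply], by ext g x; simp [koopman_apply]⟩
  have hk0 : k ≠ 0 := fun h => (spectrum.zero_notMem ℂ u.isUnit) (h ▸ hk)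
  have hinv : k⁻¹ ∈ spectrum ℂ (koopman (φ.symm : C(X, X))) :=
    (spectrum.inv_mem_iff (r := Units.mk0 k hk0) (a := u)).1 hk
  refine le_antisymm (hle _ _ hk) ?_
  have h2 := hle _ _ hinv
  rw [norm_inv] at h2
  exact (inv_le_one₀ (norm_pos_iff.2 hk0)).1 h2

/-- A hyperbolic cohomological equation over a homeomorphism is solvable in continuous functions. -/
lemma exists_solution_of_hyperbolic {X : Type*} [TopologicalSpace X] [CompactSpace X]
    (φ : X ≃ₜ X) {q : Polynomial ℤ} (hqm : q.Monic)
    (hq : ∀ w : ℂ, Polynomial.aeval w q = 0 → ‖w‖ ≠ 1) (e : C(X, ℝ)) :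
    ∃ γ : C(X, ℝ), ∀ x, ∑ j ∈ Finset.range (q.natDegree + 1), (q.coeff j : ℝ) * γ (φ^[j] x) =
      e x := by
  set P := q.map (Int.castRingHom ℂ) with hP
  have hPm : P.Monic := hqm.map _
  have hunit : IsUnit (Polynomial.aeval (koopman (φ : C(X, X))) P) := by
    by_contra hcon
    have hprod : (P.roots.map fun x => Polynomial.X - Polynomial.C x).prod = P :=
      ((IsAlgClosed.splits P).eq_prod_roots_of_monic hPm).symm
    obtain ⟨k, hk, hk0⟩ := spectrum.exists_mem_of_not_isUnit_aeval_prod (p := P)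
      (a := koopman (φ : C(X, X))) (by rwa [hprod])
    refine hq k ?_ (norm_eq_one_of_mem_spectrum_koopman φ hk)
    rwa [hP, Polynomial.eval_map] at hk0
  set E : C(X, ℂ) := ⟨fun x => (e x : ℂ), by fun_prop⟩
  obtain ⟨g, hg⟩ : ∃ g : C(X, ℂ), Polynomial.aeval (koopman (φ : C(X, X))) P g = E := by
    obtain ⟨u, hu⟩ := hunit
    refine ⟨(↑u⁻¹ : C(X, ℂ) →L[ℂ] C(X, ℂ)) E, ?_⟩
    rw [← hu, ← mul_apply_eq_comp, u.mul_inv]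
    rfl
  refine ⟨⟨fun x => (g x).re, by fun_prop⟩, fun x => ?_⟩
  have h1 := congrArg Complex.re (DFunLike.congr_fun hg x)
  rw [Polynomial.aeval_eq_sum_range, hP, hqm.natDegree_map, sum_apply,
    ContinuousMap.sum_apply, Complex.re_sum] at h1
  refine Eq.trans (Finset.sum_congr rfl fun j _ => ?_) h1
  rw [smul_apply, ContinuousMap.smul_apply, koopman_pow_apply]
  simp

/-- A two-sided sequence satisfying an invertible integral linear recurrence vanishes as soon as
one window of it does. -/
lemma eq_zero_of_linearRecurrence {A : Type*} [AddCommGroup A] {q : Polynomial ℤ} (hqm : q.Monic)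
    (hq0 : IsUnit (q.coeff 0)) (s : ℤ → A)
    (hrec : ∀ k : ℤ, ∑ j ∈ Finset.range (q.natDegree + 1), q.coeff j • s (k + j) = 0)
    (hs : ∀ j < q.natDegree, s j = 0) (k : ℤ) : s k = 0 := by
  have hnext : ∀ k : ℤ, (∀ j : ℕ, j < q.natDegree → s (k + j) = 0) → s (k + q.natDegree) = 0 := by
    intro k hk
    have := hrec k
    rw [Finset.sum_range_succ, Finset.sum_eq_zero fun j hj => by
      rw [hk j (Finset.mem_range.1 hj), smul_zero]] at this
    simpa [hqm.coeff_natDegree] using this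
  have hW : ∀ k : ℤ, ∀ j : ℕ, j < q.natDegree → s (k + j) = 0 := by
    intro k
    induction k using Int.induction_on with
    | zero => simpa using hs
    | succ k ih =>
      intro j hj
      rcases (Nat.succ_le_of_lt hj).lt_or_eq with h | h
      · have := ih (j + 1) h
        rw [← this]; push_cast; congr 1; ring
      · have := hnext _ ih
        rw [← this, ← h]; push_cast; congr 1; ring
    | pred k ih =>
      intro j hj
      rcases j with _ | j
      · have := hrec (-k - 1)
        rw [Finset.sum_range_succ', Finset.sum_eq_zero fun j hj => by
          have h2 := ih j (Finset.mem_range.1 hj)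
          rw [show (-(k : ℤ) - 1 + ((j + 1 : ℕ) : ℤ)) = -k + j by push_cast; ring, h2, smul_zero],
          zero_add] at this
        rcases Int.isUnit_iff.1 hq0 with h | h <;> simpa [h] using this
      · have := ih j (by omega)
        rw [← this]; push_cast; congr 1; ring
  have := hnext (k - q.natDegree) (hW _)
  simpa using this

lemma isOpenQuotientMap_torusProj (n : ℕ) : IsOpenQuotientMap (torusProj n) :=
  IsOpenQuotientMap.piMap fun _ => QuotientAddGroup.isOpenQuotientMap_mk

lemma torusProj_add_intCast {n : ℕ} (x : Fin n → ℝ) (ℓ : Fin n → ℤ) :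
    torusProj n (x + fun i => (ℓ i : ℝ)) = torusProj n x := by
  ext i
  simp [torusProj]

lemma exists_intCast_of_torusProj_eq {n : ℕ} {x y : Fin n → ℝ}
    (h : torusProj n x = torusProj n y) : ∃ ℓ : Fin n → ℤ, x = y + fun i => (ℓ i : ℝ) := by
  have h1 : ∀ i, ∃ m : ℤ, m • (1 : ℝ) = x i - y i := fun i => by
    rw [← AddCircle.coe_eq_zero_iff, AddCircle.coe_sub, sub_eq_zero]
    exact congrFun h i
  choose ℓ hℓ using h1
  refine ⟨ℓ, funext fun i => ?_⟩
  have := hℓ i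
  simp only [zsmul_eq_mul, mul_one] at this
  simp [this]

/-- A continuous periodic function on `ℝ^n` descends to the torus. -/
lemma IsIntPeriodic.exists_continuousMap {n : ℕ} {f : (Fin n → ℝ) → ℝ} (hf : IsIntPeriodic f)
    (hc : Continuous f) : ∃ f' : C(Torus n, ℝ), ∀ x, f' (torusProj n x) = f x := by
  have hq := (isOpenQuotientMap_torusProj n).isQuotientMap
  let π : C(Fin n → ℝ, Torus n) := ⟨torusProj n, hq.continuous⟩
  have hfac : Function.FactorsThrough (⟨f, hc⟩ : C(Fin n → ℝ, ℝ)) π := fun x y h => by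
    obtain ⟨ℓ, rfl⟩ := exists_intCast_of_torusProj_eq h
    exact hf y ℓ
  have hπ : Topology.IsQuotientMap π := hq
  exact ⟨hπ.lift _ hfac, fun x => DFunLike.congr_fun (hπ.lift_comp _ hfac) x⟩

lemma not_isFixedPt_of_isMinimal {X : Type*} [TopologicalSpace X] [T1Space X] [Nontrivial X]
    {φ : X ≃ₜ X} (hφ : IsMinimal φ) (p : X) : φ p ≠ p := by
  intro hp
  obtain ⟨y, hy⟩ := exists_ne p
  have hfix : ∀ k : ℤ, (φ.toEquiv ^ k) p = p := fun k =>
    Function.IsFixedPt.perm_zpow (e := φ.toEquiv) hp k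
  have h := (hφ p).closure_eq
  simp only [hfix, Set.range_const, closure_singleton] at h
  exact hy (h.symm ▸ Set.mem_univ y : y ∈ ({p} : Set X))

instance nontrivial_addCircle_one : Nontrivial (AddCircle (1 : ℝ)) := by
  refine ⟨⟨((1 / 2 : ℝ) : AddCircle (1 : ℝ)), 0, fun h => ?_⟩⟩
  obtain ⟨m, hm⟩ := (AddCircle.coe_eq_zero_iff _).1 h
  have h2 : (2 * m : ℤ) = 1 := by
    have : (2 * m : ℝ) = 1 := by
      rw [zsmul_eq_mul, mul_one] at hm
      linarith
    exact_mod_cast this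
  omega

open Matrix in
lemma isRoot_one_charpoly_of_isMinimal {n : ℕ} (hn : 1 ≤ n) (L : Matrix (Fin n) (Fin n) ℤ)
    {φ : Torus n ≃ₜ Torus n} (hmin : IsMinimal φ) {F : (Fin n → ℝ) → (Fin n → ℝ)}
    (hFc : Continuous F) (hFp : IsIntPeriodic F)
    (hlift : ∀ x, torusProj n (L.map (Int.cast : ℤ → ℝ) *ᵥ x + F x) = φ (torusProj n x)) :
    L.charpoly.IsRoot 1 := by
  have : Nonempty (Fin n) := ⟨⟨0, hn⟩⟩
  by_contra h
  rw [Polynomial.IsRoot, Matrix.eval_charpoly, map_one] at h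
  set A := L.map (Int.cast : ℤ → ℝ) with hA
  have hdet : IsUnit (1 - A).det := by
    have h1 : ((1 - L).det : ℝ) = (1 - A).det := by
      rw [Int.cast_det, hA]
      congr 1
      ext i j
      simp [Matrix.map_apply, Matrix.one_apply, apply_ite (Int.cast : ℤ → ℝ)]
    rw [isUnit_iff_ne_zero, ← h1]
    exact_mod_cast h
  obtain ⟨x, hx⟩ := IsIntPeriodic.exists_add_eq_zero (g := fun x => -((1 - A)⁻¹ *ᵥ F x))
    (fun x ℓ => by simp only [hFp x ℓ]) (by fun_prop)
  refine not_isFixedPt_of_isMinimal hmin (torusProj n x) ?_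
  rw [← hlift]
  congr 1
  have h2 : x = (1 - A)⁻¹ *ᵥ F x := by rwa [← sub_eq_add_neg, sub_eq_zero] at hx
  have h3 : (1 - A) *ᵥ x = F x := by
    conv_lhs => rw [h2]
    rw [Matrix.mulVec_mulVec, Matrix.mul_nonsing_inv _ hdet, Matrix.one_mulVec]
  rw [← h3, Matrix.sub_mulVec, Matrix.one_mulVec]
  abel

open Matrix in
/-- The displacement of an integral functional along the orbits of a lift descends to the torus. -/
lemma exists_displacement {n : ℕ} {L : Matrix (Fin n) (Fin n) ℤ} {φ : Torus n ≃ₜ Torus n}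
    {F : (Fin n → ℝ) → (Fin n → ℝ)} (hFc : Continuous F) (hFp : IsIntPeriodic F)
    (hlift : ∀ x, torusProj n (L.map (Int.cast : ℤ → ℝ) *ᵥ x + F x) = φ (torusProj n x))
    (v : Fin n → ℤ) (j : ℕ) :
    ∃ a : C(Torus n, ℝ), ∀ x,
      (fun i => (v i : ℝ)) ⬝ᵥ ((fun x => L.map (Int.cast : ℤ → ℝ) *ᵥ x + F x)^[j] x) =
        (fun i => ((v ᵥ* L ^ j) i : ℝ)) ⬝ᵥ x + a (torusProj n x) := by
  induction j with
  | zero => exact ⟨0, fun x => by simp⟩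
  | succ j ih =>
    obtain ⟨a, ha⟩ := ih
    obtain ⟨b, hb⟩ := IsIntPeriodic.exists_continuousMap
      (f := fun x => (fun i => ((v ᵥ* L ^ j) i : ℝ)) ⬝ᵥ F x)
      (fun x ℓ => by simp only [hFp x ℓ]) (by fun_prop)
    refine ⟨a.comp (φ : C(Torus n, Torus n)) + b, fun x => ?_⟩
    have hu : (fun i => ((v ᵥ* L ^ (j + 1)) i : ℝ)) =
        (fun i => ((v ᵥ* L ^ j) i : ℝ)) ᵥ* L.map (Int.cast : ℤ → ℝ) := by
      ext i
      rw [pow_succ, ← Matrix.vecMul_vecMul]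
      exact RingHom.map_vecMul (Int.castRingHom ℝ) L (v ᵥ* L ^ j) i
    rw [Function.iterate_succ_apply, ha, hlift, hu, ← Matrix.dotProduct_mulVec, dotProduct_add]
    simp only [ContinuousMap.add_apply, ContinuousMap.comp_apply, hb]
    simp only [ContinuousMap.coe_coe]
    ring

lemma torusProj_iterate {n : ℕ} {φ : Torus n ≃ₜ Torus n} {Φ : (Fin n → ℝ) → (Fin n → ℝ)}
    (h : ∀ x, torusProj n (Φ x) = φ (torusProj n x)) (j : ℕ) (x : Fin n → ℝ) :
    torusProj n (Φ^[j] x) = φ^[j] (torusProj n x) :=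
  (Function.Semiconj.iterate_right (f := torusProj n) (ga := Φ) (gb := φ) h j) x

lemma continuous_eq_const_of_forall_int {E : Type*} [TopologicalSpace E] [PreconnectedSpace E]
    {h : E → ℝ} (hc : Continuous h) (hint : ∀ x, ((h x : ℝ) : AddCircle (1 : ℝ)) = 0) (x y : E) :
    h x = h y := by
  have h1 : ∀ x, ∃ m : ℤ, (m : ℝ) = h x := fun x => by
    obtain ⟨m, hm⟩ := (AddCircle.coe_eq_zero_iff _).1 (hint x)
    exact ⟨m, by simpa using hm⟩
  choose m hm using h1
  have hmc : Continuous m := by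
    rw [Int.isClosedEmbedding_coe_real.isInducing.continuous_iff]
    exact hc.congr fun x => (hm x).symm
  rw [← hm, ← hm, PreconnectedSpace.constant ‹_› hmc]

/-- The circle-valued function on the torus induced by an integral functional plus `γ`. -/
noncomputable def circleFunctional {n : ℕ} (v : Fin n → ℤ) (γ : C(Torus n, ℝ)) (p : Torus n) :
    AddCircle (1 : ℝ) :=
  ∑ i, v i • p i + (γ p : AddCircle (1 : ℝ))

lemma continuous_circleFunctional {n : ℕ} (v : Fin n → ℤ) (γ : C(Torus n, ℝ)) :
    Continuous (circleFunctional v γ) :=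
  (continuous_finsetSum _ fun i _ => (continuous_apply i).zsmul (v i)).add
    ((AddCircle.continuous_mk' (1 : ℝ)).comp γ.continuous)

open Matrix in
lemma circleFunctional_torusProj {n : ℕ} (v : Fin n → ℤ) (γ : C(Torus n, ℝ)) (x : Fin n → ℝ) :
    circleFunctional v γ (torusProj n x) =
      (((fun i => (v i : ℝ)) ⬝ᵥ x + γ (torusProj n x) : ℝ) : AddCircle (1 : ℝ)) := by
  have h : ((∑ i, v i • x i : ℝ) : AddCircle (1 : ℝ)) = ∑ i, v i • (x i : AddCircle (1 : ℝ)) :=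
    map_sum (QuotientAddGroup.mk' (AddSubgroup.zmultiples (1 : ℝ))) (fun i => v i • x i) _
  rw [AddCircle.coe_add, circleFunctional]
  congr 1
  refine h.symm.trans ?_
  simp only [dotProduct, zsmul_eq_mul]

open Matrix in
/-- A circle-valued continuous function in the class of a nonzero integral functional does not
vanish identically. -/
lemma eq_zero_of_circleFunctional_eq_zero {n : ℕ} {v : Fin n → ℤ} {γ : C(Torus n, ℝ)}
    (h : ∀ p, circleFunctional v γ p = 0) : v = 0 := by
  have hc : Continuous fun x : Fin n → ℝ =>
      (fun i => (v i : ℝ)) ⬝ᵥ x + γ (torusProj n x) := by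
    have := (isOpenQuotientMap_torusProj n).continuous
    fun_prop
  ext i
  have h1 := continuous_eq_const_of_forall_int hc
    (fun x => by rw [← circleFunctional_torusProj]; exact h _)
    (0 + fun j => ((Pi.single i (1 : ℤ) : Fin n → ℤ) j : ℝ)) 0
  rw [torusProj_add_intCast] at h1
  simpa [dotProduct, Pi.single_apply] using h1

open Matrix in
lemma eq_zero_of_hyperbolic_of_isMinimal {n : ℕ} {L : Matrix (Fin n) (Fin n) ℤ}
    {φ : Torus n ≃ₜ Torus n} (hmin : IsMinimal φ) {F : (Fin n → ℝ) → (Fin n → ℝ)}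
    (hFc : Continuous F) (hFp : IsIntPeriodic F)
    (hlift : ∀ x, torusProj n (L.map (Int.cast : ℤ → ℝ) *ᵥ x + F x) = φ (torusProj n x))
    {q : Polynomial ℤ} (hqm : q.Monic) (hq0 : IsUnit (q.coeff 0))
    (hq : ∀ w : ℂ, Polynomial.aeval w q = 0 → ‖w‖ ≠ 1) {v : Fin n → ℤ}
    (hv : v ᵥ* Polynomial.aeval L q = 0)
    (hdet : (Matrix.of (fun j : Fin q.natDegree => v ᵥ* L ^ (j : ℕ)) *
        (Matrix.of (fun j : Fin q.natDegree => v ᵥ* L ^ (j : ℕ)))ᵀ).det ≠ 0) : v = 0 := by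
  set Φ : (Fin n → ℝ) → (Fin n → ℝ) := fun x => L.map (Int.cast : ℤ → ℝ) *ᵥ x + F x with hΦ
  have hπ := torusProj_iterate (Φ := Φ) hlift
  have hπc := (isOpenQuotientMap_torusProj n).continuous
  choose a ha using exists_displacement hFc hFp hlift v
  obtain ⟨γ, hγ⟩ := exists_solution_of_hyperbolic φ hqm hq
    (-∑ j ∈ Finset.range (q.natDegree + 1), (q.coeff j : ℝ) • a j)
  have hθ : ∀ (j : ℕ) (x : Fin n → ℝ), circleFunctional v γ (φ^[j] (torusProj n x)) =
      (((fun i => ((v ᵥ* L ^ j) i : ℝ)) ⬝ᵥ x + (a j (torusProj n x) +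
        γ (φ^[j] (torusProj n x))) : ℝ) : AddCircle (1 : ℝ)) := fun j x => by
    rw [← hπ, circleFunctional_torusProj, ha, add_assoc]
  have hu : ∀ x : Fin n → ℝ, ∑ j ∈ Finset.range (q.natDegree + 1),
      (q.coeff j : ℝ) * ((fun i => ((v ᵥ* L ^ j) i : ℝ)) ⬝ᵥ x) = 0 := fun x => by
    have h1 : ∀ i, ∑ j ∈ Finset.range (q.natDegree + 1), q.coeff j * (v ᵥ* L ^ j) i = 0 :=
      fun i => by
        have := congrFun hv i
        rw [Polynomial.aeval_eq_sum_range, Matrix.vecMul_sum, Finset.sum_apply] at this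
        simpa only [Matrix.vecMul_smul, Pi.smul_apply, smul_eq_mul, Pi.zero_apply] using this
    simp only [dotProduct, Finset.mul_sum]
    rw [Finset.sum_comm]
    refine Finset.sum_eq_zero fun i _ => ?_
    have h2 : ∑ j ∈ Finset.range (q.natDegree + 1), (q.coeff j : ℝ) * ((v ᵥ* L ^ j) i : ℝ) = 0 :=
      mod_cast h1 i
    simp only [← mul_assoc]
    rw [← Finset.sum_mul, h2, zero_mul]
  have hrec : ∀ p : Torus n, ∑ j ∈ Finset.range (q.natDegree + 1),
      q.coeff j • circleFunctional v γ (φ^[j] p) = 0 := fun p => by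
    obtain ⟨x, rfl⟩ := (isOpenQuotientMap_torusProj n).surjective p
    simp only [hθ, ← AddCircle.coe_zsmul]
    rw [← QuotientAddGroup.mk_sum]
    refine congrArg _ ?_
    have h1 := hγ (torusProj n x)
    simp only [ContinuousMap.neg_apply, ContinuousMap.sum_apply, ContinuousMap.smul_apply,
      smul_eq_mul] at h1
    simp only [zsmul_eq_mul, mul_add, Finset.sum_add_distrib, hu, h1]
    ring
  obtain ⟨p₀, hp₀⟩ : ∃ p₀, ∀ j < q.natDegree, circleFunctional v γ (φ^[j] p₀) = 0 := by
    set P := Matrix.of (fun j : Fin q.natDegree => v ᵥ* L ^ (j : ℕ)) with hP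
    set B := (P * Pᵀ).map (Int.cast : ℤ → ℝ) with hB
    have hBdet : IsUnit B.det := by
      rw [isUnit_iff_ne_zero, hB, ← Int.cast_det]
      exact_mod_cast hdet
    set R := Pᵀ.map (Int.cast : ℤ → ℝ) with hR
    set c : (Fin n → ℝ) → Fin q.natDegree → ℝ := fun x j =>
      a j (torusProj n x) + γ (φ^[j] (torusProj n x)) with hc
    have hcc : Continuous c := by
      refine continuous_pi fun j => ?_
      have := φ.continuous.iterate j
      fun_prop
    obtain ⟨y, hy⟩ := IsIntPeriodic.exists_add_eq_zero (g := fun y => B⁻¹ *ᵥ c (R *ᵥ y))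
      (fun y ℓ => by
        have : R *ᵥ (y + fun i => (ℓ i : ℝ)) = R *ᵥ y + fun i => ((Pᵀ *ᵥ ℓ) i : ℝ) := by
          rw [Matrix.mulVec_add]
          congr 1
          ext i
          exact (RingHom.map_mulVec (Int.castRingHom ℝ) Pᵀ ℓ i).symm
        simp only [hc, this, torusProj_add_intCast]) (by fun_prop)
    have h1 : B *ᵥ y + c (R *ᵥ y) = 0 := by
      have := congrArg (B *ᵥ ·) hy
      simpa [Matrix.mulVec_add, Matrix.mulVec_mulVec, Matrix.mul_nonsing_inv _ hBdet] using this
    refine ⟨torusProj n (R *ᵥ y), fun j hj => ?_⟩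
    rw [hθ]
    have h2 := congrFun h1 ⟨j, hj⟩
    have h3 : B = P.map (Int.cast : ℤ → ℝ) * R := by
      rw [hB, hR]
      exact Matrix.map_mul (f := Int.castRingHom ℝ)
    rw [h3, ← Matrix.mulVec_mulVec] at h2
    refine (congrArg _ (show _ = (0 : ℝ) from h2)).trans (AddCircle.coe_zero _)
  have horb : ∀ k : ℤ, circleFunctional v γ ((φ.toEquiv ^ k) p₀) = 0 := by
    have hit : ∀ (k : ℤ) (j : ℕ), (φ.toEquiv ^ (k + j)) p₀ = φ^[j] ((φ.toEquiv ^ k) p₀) :=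
      fun k j => by
        rw [add_comm, _root_.zpow_add, zpow_natCast, Equiv.Perm.mul_apply,
          ← Equiv.Perm.iterate_eq_pow]
        rfl
    refine eq_zero_of_linearRecurrence hqm hq0 _ (fun k => ?_) fun j hj => ?_
    · simp only [hit]
      exact hrec _
    · have := hit 0 j
      rw [zero_add] at this
      rw [this]
      exact hp₀ j hj
  refine eq_zero_of_circleFunctional_eq_zero (γ := γ) fun p => ?_
  exact congrFun ((continuous_circleFunctional v γ).ext_on (hmin p₀) continuous_const
    (by rintro _ ⟨k, rfl⟩; exact horb k)) p

end

/-- If `1 ≤ n ≤ 4` and `φ` is a minimal homeomorphism of `T^n` with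
linear part `L ∈ GL(n,ℤ)`, then every complex eigenvalue of `L` is a root of unity
(`L` is quasi-unipotent) and `1` is an eigenvalue of `L`. -/
theorem stmt1 (n : ℕ) (hn1 : 1 ≤ n) (hn4 : n ≤ 4)
    (L : Matrix (Fin n) (Fin n) ℤ) (hL : IsUnit L.det)
    (φ : Torus n ≃ₜ Torus n) (hmin : IsMinimal φ)
    (F : (Fin n → ℝ) → (Fin n → ℝ)) (hFcont : Continuous F)
    (hFper : ∀ (x : Fin n → ℝ) (ℓ : Fin n → ℤ), F (x + fun i => (ℓ i : ℝ)) = F x)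
    (hlift : ∀ x : Fin n → ℝ,
      torusProj n ((L.map (Int.cast : ℤ → ℝ)).mulVec x + F x) = φ (torusProj n x)) :
    (∀ z : ℂ, (L.map (Int.cast : ℤ → ℂ)).charpoly.IsRoot z → ∃ m : ℕ, 0 < m ∧ z ^ m = 1)
      ∧ (L.map (Int.cast : ℤ → ℂ)).charpoly.IsRoot 1 := by
  have hroot := isRoot_one_charpoly_of_isMinimal hn1 L hmin hFcont hFper hlift
  have hmap : (L.map (Int.cast : ℤ → ℂ)).charpoly = L.charpoly.map (Int.castRingHom ℂ) :=
    Matrix.charpoly_map L (Int.castRingHom ℂ)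
  refine ⟨fun z hz => ?_, ?_⟩
  · by_contra hzu
    have hz' : Polynomial.aeval z L.charpoly = 0 := by
      rw [Polynomial.IsRoot, hmap, Polynomial.eval_map] at hz
      exact hz
    have h0 : IsUnit (L.charpoly.coeff 0) := by
      rw [Matrix.det_eq_sign_charpoly_coeff] at hL
      exact isUnit_of_mul_isUnit_right hL
    obtain ⟨q, hqm, hq0, hirr, hqz, hq⟩ := exists_hyperbolic_factor L.charpoly_monic
      (by simpa using hn4) h0 hroot hz' hzu
    obtain ⟨v, hv0, hv, hdet⟩ := exists_cyclic_vector L hqm hirr hz hqz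
    exact hv0 (eq_zero_of_hyperbolic_of_isMinimal hmin hFcont hFper hlift hqm hq0 hq hv hdet)
  · rw [hmap]
    simpa using hroot.map (f := Int.castRingHom ℂ)
end

section
/- Let n ≥ 1 and let φ be a minimal homeomorphism of the torus T^n with linear part L ∈ GL(n,ℤ). Then 1 is an eigenvalue of L. -/
open Set Metric MeasureTheory Polynomial Topology
open scoped NNReal

section Determinant

variable {E : Type*} [NormedAddCommGroup E] [NormedSpace ℝ E] [FiniteDimensional ℝ E]

/-- Since `t ↦ det (1 + t A)` is a polynomial of degree at most `dim E`, its value at `1` is given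
by Lagrange interpolation. -/
theorem det_one_add_eq_sum_lagrange (A : E →L[ℝ] E) (v : ℕ → ℝ) (hv : Function.Injective v) :
    (1 + A).det = ∑ i ∈ Finset.range (Module.finrank ℝ E + 1), (1 + v i • A).det *
      (Lagrange.basis (Finset.range (Module.finrank ℝ E + 1)) v i).eval 1 := by
  set N := Module.finrank ℝ E
  let b := Module.finBasis ℝ E
  let M := LinearMap.toMatrix b b (A : E →ₗ[ℝ] E)
  let p : ℝ[X] := ((X : ℝ[X]) • M.map C + (1 : Matrix (Fin N) (Fin N) ℝ).map C).det
  have hp : ∀ t : ℝ, p.eval t = (1 + t • A).det := by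
    intro t
    rw [ContinuousLinearMap.det, ← LinearMap.det_toMatrix b]
    simp only [p, eval_det]
    congr 1
    ext i j
    simp [M, Matrix.one_apply, LinearMap.toMatrix_apply, Finsupp.single_apply, add_comm, eq_comm,
      mul_comm]
  have hdeg : p.degree < (Finset.range (N + 1)).card := by
    refine lt_of_le_of_lt degree_le_natDegree ?_
    have := natDegree_det_X_add_C_le M 1
    rw [Fintype.card_fin] at this
    rw [Finset.card_range]
    exact_mod_cast Nat.lt_succ_of_le this
  have h := congrArg (eval 1) (Lagrange.eq_interpolate (v := v) hv.injOn hdeg)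
  rw [hp, one_smul] at h
  rw [h, Lagrange.interpolate_apply, eval_finsetSum]
  simp [hp]

theorem det_one_add_pos_of_norm_lt_one (A : E →L[ℝ] E) (hA : ‖A‖ < 1) : 0 < (1 + A).det := by
  have hne : ∀ s ∈ Icc (0 : ℝ) 1, (1 + s • A).det ≠ 0 := by
    intro s hs
    have : ‖-(s • A)‖ < 1 := by
      rw [norm_neg, norm_smul, Real.norm_of_nonneg hs.1]
      nlinarith [hs.2, norm_nonneg A]
    have hu := isUnit_one_sub_of_norm_lt_one this
    rw [sub_neg_eq_add] at hu
    exact ((hu.map ContinuousLinearMap.toLinearMapRingHom).map LinearMap.det).ne_zero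
  have hcont : ContinuousOn (fun s : ℝ => (1 + s • A).det) (Icc 0 1) :=
    (ContinuousLinearMap.continuous_det.comp (by fun_prop)).continuousOn
  by_contra! h
  have h0 : (0 : ℝ) ∈ Icc ((1 + (1 : ℝ) • A).det) ((1 + (0 : ℝ) • A).det) := by
    constructor
    · simpa using h
    · simp [ContinuousLinearMap.det]
  obtain ⟨s, hs, hs0⟩ := intermediate_value_Icc' zero_le_one hcont h0
  exact hne s hs hs0

end Determinant

section Extension

variable {E F : Type*} [NormedAddCommGroup E] [NormedSpace ℝ E] [NormedAddCommGroup F]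

theorem LipschitzOnWith.indicator_closedBall {K : ℝ≥0} {g : E → F} {R : ℝ}
    (hg : LipschitzOnWith K g (closedBall 0 R)) (h0 : ∀ x, ‖x‖ = R → g x = 0) :
    LipschitzWith K ((closedBall 0 R).indicator g) := by
  have key : ∀ x y : E, x ∈ closedBall (0 : E) R → y ∉ closedBall (0 : E) R →
      ‖g x‖ ≤ K * dist x y := by
    intro x y hx hy
    rw [mem_closedBall_zero_iff] at hx hy
    have hc : ContinuousOn (fun s : ℝ => ‖AffineMap.lineMap x y s‖) (Icc 0 1) :=
      (AffineMap.lineMap_continuous.norm).continuousOn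
    obtain ⟨s, hs, hsR⟩ := intermediate_value_Icc zero_le_one hc
      (show R ∈ Icc _ _ by simpa using ⟨hx, (not_le.1 hy).le⟩)
    have h1 := hg.dist_le_mul x (by simpa using hx) (AffineMap.lineMap x y s)
      (by simpa using hsR.le)
    rw [h0 _ hsR, dist_zero_right, dist_left_lineMap, Real.norm_of_nonneg hs.1] at h1
    refine h1.trans (mul_le_mul_of_nonneg_left ?_ K.2)
    exact mul_le_of_le_one_left dist_nonneg hs.2
  refine LipschitzWith.of_dist_le_mul fun x y => ?_
  by_cases hx : x ∈ closedBall (0 : E) R <;> by_cases hy : y ∈ closedBall (0 : E) R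
  · simpa only [indicator_of_mem, hx, hy] using hg.dist_le_mul x hx y hy
  · simpa [indicator_of_mem, indicator_of_notMem, hx, hy] using key x y hx hy
  · simpa [indicator_of_mem, indicator_of_notMem, hx, hy, dist_comm] using key y x hy hx
  · simp only [indicator_of_notMem, hx, hy, not_false_eq_true, dist_self]
    positivity

end Extension

section Retraction

variable {E : Type*} [NormedAddCommGroup E] [InnerProductSpace ℝ E] [FiniteDimensional ℝ E]

theorem image_closedBall_id_add_smul {R t : ℝ} {K : ℝ≥0} {g : E → E} (ht : 0 ≤ t) (ht1 : t ≤ 1)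
    (htK : t * K < 1) (hg : LipschitzOnWith K g (closedBall 0 R))
    (h0 : ∀ x, ‖x‖ = R → g x = 0) (hb : ∀ x, ‖x‖ ≤ R → ‖x + g x‖ ≤ R) :
    Set.image (fun x => x + t • g x) (closedBall 0 R) = closedBall 0 R := by
  apply Subset.antisymm
  · rintro _ ⟨x, hx, rfl⟩
    have hx' : x ∈ closedBall (0 : E) R := hx
    have hxg : x + g x ∈ closedBall (0 : E) R := by
      rw [mem_closedBall_zero_iff] at hx' ⊢
      exact hb x hx'
    have := convex_closedBall (0 : E) R hx' hxg (sub_nonneg.2 ht1) ht (by ring)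
    convert this using 1
    module
  · intro y hy
    have hL := hg.indicator_closedBall h0
    have hc : ContractingWith (t.toNNReal * K)
        (fun x => y - t • (closedBall (0 : E) R).indicator g x) := by
      refine ⟨?_, LipschitzWith.of_dist_le_mul fun a b => ?_⟩
      · rw [← NNReal.coe_lt_coe]
        simpa [Real.coe_toNNReal t ht] using htK
      · rw [dist_sub_left, dist_smul₀, Real.norm_of_nonneg ht, NNReal.coe_mul,
          Real.coe_toNNReal t ht, mul_assoc]
        exact mul_le_mul_of_nonneg_left (hL.dist_le_mul a b) ht
    have hfix := hc.fixedPoint_isFixedPt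
    set x := hc.fixedPoint
    have hfix : y - t • (closedBall (0 : E) R).indicator g x = x := hfix
    have hx : x ∈ closedBall (0 : E) R := by
      by_contra hx
      rw [indicator_of_notMem hx, smul_zero, sub_zero] at hfix
      exact hx (hfix ▸ hy)
    rw [indicator_of_mem hx] at hfix
    exact ⟨x, hx, (sub_eq_iff_eq_add.1 hfix).symm⟩

theorem det_fderiv_eq_zero_of_norm_eq {R : ℝ} (hR : 0 < R) {r : E → E} (hr : Differentiable ℝ r)
    (hn : ∀ x, ‖r x‖ = R) (x : E) : (fderiv ℝ r x).det = 0 := by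
  by_contra hdet
  have hperp : ∀ v, inner ℝ (r x) (fderiv ℝ r x v) = 0 := by
    intro v
    have h1 := ((hr x).hasFDerivAt.norm_sq)
    have h2 : HasFDerivAt (fun y => ‖r y‖ ^ 2) (0 : E →L[ℝ] ℝ) x := by
      simp only [hn]
      exact hasFDerivAt_const _ _
    have h3 := congrArg (fun T : E →L[ℝ] ℝ => T v) (h1.unique h2)
    simpa using h3
  obtain ⟨v, hv⟩ := (LinearMap.equivOfDetNeZero _ hdet).surjective (r x)
  have hv : fderiv ℝ r x v = r x := hv
  have h4 := hperp v
  rw [hv, real_inner_self_eq_norm_sq, hn] at h4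
  exact hR.ne' (pow_eq_zero_iff two_ne_zero |>.1 h4)

variable [MeasurableSpace E] [BorelSpace E]

theorem setIntegral_det_one_add_smul_fderiv {R t : ℝ} {K : ℝ≥0} {g : E → E} (ht : 0 ≤ t)
    (ht1 : t ≤ 1) (htK : t * K < 1) (hg : Differentiable ℝ g)
    (hK : ∀ x ∈ closedBall (0 : E) R, ‖fderiv ℝ g x‖₊ ≤ K)
    (h0 : ∀ x, ‖x‖ = R → g x = 0) (hb : ∀ x, ‖x‖ ≤ R → ‖x + g x‖ ≤ R) :
    ∫ x in closedBall (0 : E) R, (1 + t • fderiv ℝ g x).det =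
      (volume : Measure E).real (closedBall 0 R) := by
  have hL : LipschitzOnWith K g (closedBall 0 R) :=
    (convex_closedBall 0 R).lipschitzOnWith_of_nnnorm_fderiv_le (fun x _ => hg x) hK
  have hinj : InjOn (fun x => x + t • g x) (closedBall 0 R) := by
    intro x hx y hy hxy
    have hxy : x + t • g x = y + t • g y := hxy
    have h1 : x - y = t • (g y - g x) := by
      rw [smul_sub, sub_eq_sub_iff_add_eq_add, hxy, add_comm]
    have h2 : dist x y ≤ t * K * dist x y := by
      calc dist x y = t * dist x y * 0 + ‖x - y‖ := by rw [dist_eq_norm]; ring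
        _ = t * dist (g x) (g y) := by
          rw [h1, norm_smul, Real.norm_of_nonneg ht, dist_comm (g x), dist_eq_norm (g y)]; ring
        _ ≤ t * (K * dist x y) := mul_le_mul_of_nonneg_left (hL.dist_le_mul x hx y hy) ht
        _ = t * K * dist x y := by ring
    have h3 : dist x y = 0 := by nlinarith [dist_nonneg (x := x) (y := y)]
    exact dist_eq_zero.1 h3
  have hd : ∀ x ∈ closedBall (0 : E) R, HasFDerivWithinAt (fun x => x + t • g x)
      (1 + t • fderiv ℝ g x) (closedBall 0 R) x := fun x _ =>
    ((hasFDerivAt_id x).add ((hg x).hasFDerivAt.const_smul t)).hasFDerivWithinAt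
  have h := integral_image_eq_integral_abs_det_fderiv_smul volume
    measurableSet_closedBall hd hinj (fun _ => (1 : ℝ))
  rw [image_closedBall_id_add_smul ht ht1 htK hL h0 hb] at h
  rw [setIntegral_const, smul_eq_mul, mul_one] at h
  rw [h]
  refine setIntegral_congr_fun measurableSet_closedBall fun x hx => ?_
  have hpos : 0 < (1 + t • fderiv ℝ g x).det := by
    apply det_one_add_pos_of_norm_lt_one
    rw [norm_smul, Real.norm_of_nonneg ht]
    exact (mul_le_mul_of_nonneg_left (show ‖fderiv ℝ g x‖ ≤ K from hK x hx) ht).trans_lt htK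
  simp only [smul_eq_mul, mul_one, abs_of_pos hpos]

/-- There is no `C¹` retraction of a ball onto its boundary sphere. -/
theorem no_contDiff_retraction {R : ℝ} (hR : 0 < R) {r : E → E} (hr : ContDiff ℝ 1 r)
    (hn : ∀ x, ‖r x‖ = R) (hid : ∀ x, ‖x‖ = R → r x = x) : False := by
  set g : E → E := fun x => r x - x with hgdef
  have hgc : ContDiff ℝ 1 g := hr.sub contDiff_id
  have hgd : Differentiable ℝ g := hgc.differentiable one_ne_zero
  have hg' : Continuous (fderiv ℝ g) := hgc.continuous_fderiv one_ne_zero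
  obtain ⟨C, hC⟩ := (isCompact_closedBall (0 : E) R).exists_bound_of_continuousOn hg'.continuousOn
  let K : ℝ≥0 := C.toNNReal
  have hK : ∀ x ∈ closedBall (0 : E) R, ‖fderiv ℝ g x‖₊ ≤ K := fun x hx => by
    rw [← NNReal.coe_le_coe]
    exact (hC x hx).trans (Real.le_coe_toNNReal C)
  have hK0 : (0 : ℝ) ≤ K := K.2
  let v : ℕ → ℝ := fun i => 1 / ((K : ℝ) + 1 + i)
  have hvpos : ∀ i : ℕ, 0 < (K : ℝ) + 1 + i := fun (i : ℕ) => by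
    have hi : (0 : ℝ) ≤ (i : ℕ) := Nat.cast_nonneg i
    linarith
  have hv : Function.Injective v := by
    intro i j hij
    have h1 : (K : ℝ) + 1 + i = K + 1 + j := by
      simpa [v] using hij
    exact_mod_cast add_left_cancel h1
  set N := Module.finrank ℝ E
  set s := Finset.range (N + 1)
  have hint : ∀ i, ∫ x in closedBall (0 : E) R, (1 + v i • fderiv ℝ g x).det =
      (volume : Measure E).real (closedBall 0 R) := by
    intro i
    have hi : (0 : ℝ) ≤ i := Nat.cast_nonneg i
    refine setIntegral_det_one_add_smul_fderiv (K := K) ?_ ?_ ?_ hgd hK ?_ ?_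
    · exact (one_div_pos.2 (hvpos i)).le
    · exact (div_le_one (hvpos i)).2 (by linarith)
    · rw [div_mul_eq_mul_div, one_mul, div_lt_one (hvpos i)]
      linarith
    · intro x hx
      simp [g, hid x hx]
    · intro x _
      simp [g, hn]
  have hcont : ∀ t : ℝ, Continuous fun x => (1 + t • fderiv ℝ g x).det := fun t =>
    ContinuousLinearMap.continuous_det.comp (continuous_const.add (hg'.const_smul t))
  have hzero : ∀ x, (1 + fderiv ℝ g x).det = 0 := by
    intro x
    have hrd := hr.differentiable one_ne_zero
    have : fderiv ℝ g x = fderiv ℝ r x - 1 :=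
      ((hrd x).hasFDerivAt.sub (hasFDerivAt_id x)).fderiv
    rw [this, add_sub_cancel]
    exact det_fderiv_eq_zero_of_norm_eq hR hrd hn x
  have hsum : ∑ i ∈ s, (Lagrange.basis s v i).eval 1 = 1 := by
    rw [← eval_finsetSum, Lagrange.sum_basis hv.injOn (by simp [s]), eval_one]
  have htotal : ∫ x in closedBall (0 : E) R, (1 + fderiv ℝ g x).det =
      (volume : Measure E).real (closedBall 0 R) := by
    simp_rw [fun x => det_one_add_eq_sum_lagrange (fderiv ℝ g x) v hv]
    rw [integral_finsetSum]
    · simp_rw [integral_mul_const, hint]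
      rw [← Finset.mul_sum, hsum, mul_one]
    · intro i _
      exact (((hcont (v i)).mul continuous_const).continuousOn.integrableOn_compact
        (isCompact_closedBall 0 R))
  simp only [hzero, integral_zero] at htotal
  have hpos : 0 < (volume : Measure E).real (closedBall 0 R) :=
    ENNReal.toReal_pos (measure_closedBall_pos _ _ hR).ne' measure_closedBall_lt_top.ne
  exact hpos.ne htotal

end Retraction

/-- A bounded form of **Brouwer's fixed point theorem**: a continuous self-map with bounded range
of a finite-dimensional inner product space has a fixed point. -/
theorem exists_isFixedPt_of_continuous_of_bounded {E : Type*} [NormedAddCommGroup E]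
    [InnerProductSpace ℝ E] [FiniteDimensional ℝ E] {h : E → E} (hh : Continuous h) {B : ℝ}
    (hB : ∀ x, ‖h x‖ ≤ B) : ∃ x, h x = x := by
  by_contra! hne
  let : MeasurableSpace E := borel E
  have : BorelSpace E := ⟨rfl⟩
  have hB0 : 0 ≤ B := (norm_nonneg _).trans (hB 0)
  obtain ⟨k, hk, hkε, -⟩ := hh.exists_contDiff_approx 1 (ε := fun x => min 1 ‖h x - x‖)
    (by fun_prop) (fun x => lt_min one_pos (norm_pos_iff.2 (sub_ne_zero.2 (hne x))))
  have hkne : ∀ x, k x ≠ x := by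
    intro x hx
    have := (hkε x).trans_le (min_le_right _ _)
    rw [hx, dist_comm, dist_eq_norm] at this
    exact lt_irrefl _ this
  have hkB : ∀ x, ‖k x‖ < B + 1 := by
    intro x
    have h1 := (hkε x).trans_le (min_le_left _ _)
    rw [dist_eq_norm] at h1
    have h2 := norm_le_norm_add_norm_sub' (k x) (h x)
    linarith [hB x]
  let χ : ContDiffBump (0 : E) := ⟨B + 1, B + 2, by linarith, by linarith⟩
  let f : E → E := fun x => x - χ x • k x
  have hfc : ContDiff ℝ 1 f := contDiff_id.sub (χ.contDiff.smul (by exact_mod_cast hk))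
  have hf0 : ∀ x, f x ≠ 0 := by
    intro x hx
    have hx : x = χ x • k x := sub_eq_zero.1 hx
    by_cases hxB : x ∈ closedBall (0 : E) (B + 1)
    · rw [χ.one_of_mem_closedBall hxB, one_smul] at hx
      exact hkne x hx.symm
    · rw [mem_closedBall_zero_iff, not_le] at hxB
      have h1 : ‖x‖ ≤ ‖k x‖ := by
        conv_lhs => rw [hx]
        rw [norm_smul, Real.norm_of_nonneg χ.nonneg]
        exact mul_le_of_le_one_left (norm_nonneg _) χ.le_one
      linarith [hkB x]
  have hR : 0 < B + 2 := by linarith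
  refine no_contDiff_retraction hR (r := fun x => ((B + 2) * ‖f x‖⁻¹) • f x) ?_ ?_ ?_
  · exact (contDiff_const.mul ((hfc.norm ℝ hf0).inv fun x => norm_ne_zero_iff.2 (hf0 x))).smul hfc
  · intro x
    have := norm_ne_zero_iff.2 (hf0 x)
    rw [norm_smul, norm_mul, norm_inv, norm_norm, Real.norm_of_nonneg hR.le]
    field_simp
  · intro x hx
    have hχ : χ x = 0 := χ.zero_of_le_dist (by simp [χ, hx])
    have hfx : f x = x := by simp [f, hχ]
    simp only [hfx, hx]
    rw [mul_inv_cancel₀ hR.ne', one_smul]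

/-- A continuous `ℤⁿ`-periodic map on `ℝⁿ` is bounded. -/
theorem exists_norm_le_of_continuous_of_periodic {ι F : Type*} [Fintype ι]
    [SeminormedAddCommGroup F] {f : (ι → ℝ) → F} (hf : Continuous f)
    (hper : ∀ (x : ι → ℝ) (ℓ : ι → ℤ), f (x + fun i => (ℓ i : ℝ)) = f x) :
    ∃ B, ∀ x, ‖f x‖ ≤ B := by
  obtain ⟨B, hB⟩ := (isCompact_Icc (a := (0 : ι → ℝ)) (b := 1)).exists_bound_of_continuousOn
    hf.continuousOn
  refine ⟨B, fun x => ?_⟩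
  have hx : x = (fun i => Int.fract (x i)) + fun i => (⌊x i⌋ : ℝ) := by
    ext i
    simp
  rw [hx, hper]
  exact hB _ ⟨fun i => Int.fract_nonneg _, fun i => (Int.fract_lt_one _).le⟩

/-- A homeomorphism of a nontrivial Hausdorff space with a fixed point is not minimal. -/
theorem IsMinimal.apply_ne {X : Type*} [TopologicalSpace X] [T1Space X] [Nontrivial X]
    {φ : X ≃ₜ X} (hφ : IsMinimal φ) (x : X) : φ x ≠ x := by
  intro hx
  have horb : (range fun k : ℤ => (φ.toEquiv ^ k) x) ⊆ {x} := by
    rintro _ ⟨k, rfl⟩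
    exact Equiv.Perm.zpow_apply_eq_self_of_apply_eq_self hx k
  have huniv := ((hφ x).mono horb).closure_eq
  rw [closure_singleton] at huniv
  obtain ⟨y, hy⟩ := exists_ne x
  exact hy (huniv.symm ▸ mem_univ y : y ∈ ({x} : Set X))

theorem nontrivial_torus {n : ℕ} (hn : 1 ≤ n) : Nontrivial (Torus n) := by
  have : Nonempty (Fin n) := ⟨⟨0, hn⟩⟩
  have : Nontrivial (AddCircle (1 : ℝ)) := by
    refine ⟨((1 / 2 : ℝ) : AddCircle (1 : ℝ)), 0, fun h => ?_⟩
    obtain ⟨k, hk⟩ := (AddCircle.coe_eq_zero_iff (1 : ℝ)).1 h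
    have h2 : (2 * k : ℝ) = 1 := by
      rw [zsmul_one] at hk
      linarith
    have h3 : 2 * k = 1 := by exact_mod_cast h2
    omega
  infer_instance

/-- If `φ` is a minimal homeomorphism of `T^n` (`n ≥ 1`) with linear
part `L ∈ GL(n,ℤ)`, then `1` is an eigenvalue of `L`. -/
theorem stmt2 (n : ℕ) (hn : 1 ≤ n)
    (L : Matrix (Fin n) (Fin n) ℤ) (hL : IsUnit L.det)
    (φ : Torus n ≃ₜ Torus n) (hmin : IsMinimal φ)
    (F : (Fin n → ℝ) → (Fin n → ℝ)) (hFcont : Continuous F)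
    (hFper : ∀ (x : Fin n → ℝ) (ℓ : Fin n → ℤ), F (x + fun i => (ℓ i : ℝ)) = F x)
    (hlift : ∀ x : Fin n → ℝ,
      torusProj n ((L.map (Int.cast : ℤ → ℝ)).mulVec x + F x) = φ (torusProj n x)) :
    (L.map (Int.cast : ℤ → ℂ)).charpoly.IsRoot 1 := by
  by_contra hroot
  have hdet : (1 - L).det ≠ 0 := by
    intro h0
    apply hroot
    have h1 : (Matrix.scalar (Fin n) (1 : ℂ)) - L.map (Int.cast : ℤ → ℂ) =
        (Int.castRingHom ℂ).mapMatrix (1 - L) := by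
      rw [map_sub, map_one, map_one]
      rfl
    rw [Polynomial.IsRoot, Matrix.eval_charpoly, h1, ← RingHom.map_det, h0, map_zero]
  let A : Matrix (Fin n) (Fin n) ℝ := 1 - L.map (Int.cast : ℤ → ℝ)
  have hA : IsUnit A.det := by
    have h1 : A = (Int.castRingHom ℝ).mapMatrix (1 - L) := by
      rw [map_sub, map_one]
      rfl
    rw [h1, ← RingHom.map_det, isUnit_iff_ne_zero]
    exact Int.cast_ne_zero.2 hdet
  let H : (Fin n → ℝ) → EuclideanSpace ℝ (Fin n) := fun x => WithLp.toLp 2 (A⁻¹.mulVec (F x))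
  have hH : Continuous H := (PiLp.continuous_toLp 2 _).comp (by fun_prop)
  obtain ⟨B, hB⟩ := exists_norm_le_of_continuous_of_periodic hH
    (fun x ℓ => by simp only [H, hFper])
  obtain ⟨y, hy⟩ := exists_isFixedPt_of_continuous_of_bounded
    (h := fun y : EuclideanSpace ℝ (Fin n) => H y.ofLp)
    (hH.comp (PiLp.continuous_ofLp 2 _)) (fun y => hB _)
  set x : Fin n → ℝ := y.ofLp
  have hx : A⁻¹.mulVec (F x) = x := congrArg WithLp.ofLp hy
  have hAx : A.mulVec x = F x := by
    conv_lhs => rw [← hx]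
    rw [Matrix.mulVec_mulVec, Matrix.mul_nonsing_inv A hA, Matrix.one_mulVec]
  have hfix : (L.map (Int.cast : ℤ → ℝ)).mulVec x + F x = x := by
    rw [← hAx, Matrix.sub_mulVec, Matrix.one_mulVec, add_sub_cancel]
  have := nontrivial_torus hn
  exact hmin.apply_ne (torusProj n x) (by rw [← hlift, hfix])
end

section
/- Let 1 ≤ n ≤ 4 and let L ∈ GL(n,ℤ) be quasi-unipotent with 1 as an eigenvalue. Then there exists a C^∞ diffeomorphism φ of the torus T^n which is minimal and whose linear part is L. -/
open Filter Topology Matrix UnitAddTorus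

/-- The average of the first `N` terms of a complex sequence. -/
noncomputable def cesaro (u : ℕ → ℂ) (N : ℕ) : ℂ := (N : ℂ)⁻¹ * ∑ k ∈ Finset.range N, u k

lemma cesaro_const_mul (c : ℂ) (u : ℕ → ℂ) (N : ℕ) :
    cesaro (fun k => c * u k) N = c * cesaro u N := by
  simp only [cesaro, ← Finset.mul_sum]; ring

lemma cesaro_sub (u u' : ℕ → ℂ) (N : ℕ) :
    cesaro (fun k => u k - u' k) N = cesaro u N - cesaro u' N := by
  simp only [cesaro, Finset.sum_sub_distrib]; ring

lemma cesaro_sum {ι : Type*} (s : Finset ι) (u : ι → ℕ → ℂ) (N : ℕ) :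
    cesaro (fun k => ∑ i ∈ s, u i k) N = ∑ i ∈ s, cesaro (u i) N := by
  simp only [cesaro, ← Finset.mul_sum]
  rw [Finset.sum_comm]

lemma norm_cesaro_le {u : ℕ → ℂ} {C : ℝ} (hC : 0 ≤ C) (hu : ∀ k, ‖u k‖ ≤ C) (N : ℕ) :
    ‖cesaro u N‖ ≤ C := by
  rcases Nat.eq_zero_or_pos N with rfl | hN
  · simpa [cesaro] using hC
  · have hN' : (0 : ℝ) < N := by exact_mod_cast hN
    rw [cesaro, norm_mul, norm_inv, Complex.norm_natCast, inv_mul_le_iff₀ hN']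
    calc _ ≤ ∑ k ∈ Finset.range N, ‖u k‖ := norm_sum_le _ _
      _ ≤ ∑ _k ∈ Finset.range N, C := Finset.sum_le_sum fun k _ => hu k
      _ = N * C := by simp

lemma tendsto_cesaro_zero_of_sum_bounded {u : ℕ → ℂ} {C : ℝ}
    (h : ∀ N, ‖∑ k ∈ Finset.range N, u k‖ ≤ C) : Tendsto (cesaro u) atTop (𝓝 0) := by
  have h0 : Tendsto (fun N : ℕ => (N : ℝ)⁻¹ * C) atTop (𝓝 0) := by
    simpa using tendsto_natCast_atTop_atTop.inv_tendsto_atTop.mul_const C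
  refine squeeze_zero_norm (fun N => ?_) h0
  rw [cesaro, norm_mul, norm_inv, Complex.norm_natCast]
  exact mul_le_mul_of_nonneg_left (h N) (by positivity)

lemma tendsto_cesaro_shift_sub {u : ℕ → ℂ} (hu : ∀ k, ‖u k‖ ≤ 1) (h : ℕ) :
    Tendsto (fun N => cesaro (fun k => u (k + h)) N - cesaro u N) atTop (𝓝 0) := by
  simp_rw [← cesaro_sub]
  refine tendsto_cesaro_zero_of_sum_bounded (C := 2 * h) fun N => ?_
  have h1 := Finset.sum_range_add u N h
  have h2 := Finset.sum_range_add u h N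
  have e : ∑ k ∈ Finset.range N, (u (k + h) - u k)
      = ∑ k ∈ Finset.range h, u (N + k) - ∑ k ∈ Finset.range h, u k := by
    rw [Finset.sum_sub_distrib]
    rw [add_comm h N] at h2
    simp only [add_comm _ h]
    linear_combination h1 - h2
  rw [e]
  have hb : ∀ v : ℕ → ℂ, (∀ k, ‖v k‖ ≤ 1) → ‖∑ k ∈ Finset.range h, v k‖ ≤ h := fun v hv =>
    (norm_sum_le _ _).trans ((Finset.sum_le_sum fun k _ => hv k).trans (by simp))
  have := norm_sub_le (∑ k ∈ Finset.range h, u (N + k)) (∑ k ∈ Finset.range h, u k)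
  linarith [hb (fun k => u (N + k)) (fun k => hu _), hb u hu]

lemma tendsto_cesaro_pow {ω : ℂ} (h1 : ‖ω‖ = 1) (hne : ω ≠ 1) :
    Tendsto (cesaro fun k => ω ^ k) atTop (𝓝 0) := by
  refine tendsto_cesaro_zero_of_sum_bounded (C := 2 / ‖ω - 1‖) fun N => ?_
  rw [geom_sum_eq hne, norm_div]
  gcongr
  refine (norm_sub_le _ _).trans ?_
  simp [h1]; norm_num

lemma norm_cesaro_sq_le (u : ℕ → ℂ) (N : ℕ) :
    ‖cesaro u N‖ ^ 2 ≤ ‖cesaro (fun k => u k * (starRingEnd ℂ) (u k)) N‖ := by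
  rcases Nat.eq_zero_or_pos N with rfl | hN
  · simp [cesaro]
  · have hN' : (0 : ℝ) < N := by exact_mod_cast hN
    have e : ‖∑ k ∈ Finset.range N, u k * (starRingEnd ℂ) (u k)‖
        = ∑ k ∈ Finset.range N, ‖u k‖ ^ 2 := by
      simp only [Complex.mul_conj']
      norm_cast
      rw [Real.norm_of_nonneg (by positivity)]
    rw [cesaro, cesaro, norm_mul, norm_mul, norm_inv, Complex.norm_natCast, e, mul_pow]
    have h1 : ‖∑ k ∈ Finset.range N, u k‖ ^ 2 ≤ N * ∑ k ∈ Finset.range N, ‖u k‖ ^ 2 := by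
      refine (pow_le_pow_left₀ (norm_nonneg _) (norm_sum_le _ _) 2).trans ?_
      simpa using sq_sum_le_card_mul_sum_sq (s := Finset.range N) (f := fun k => ‖u k‖)
    calc _ ≤ ((N : ℝ)⁻¹) ^ 2 * (N * ∑ k ∈ Finset.range N, ‖u k‖ ^ 2) := by gcongr
      _ = _ := by field_simp

/-- Van der Corput's lemma. -/
lemma tendsto_cesaro_of_correlations {u : ℕ → ℂ} (hu : ∀ k, ‖u k‖ = 1)
    (hcorr : ∀ h : ℕ, 1 ≤ h →
      Tendsto (cesaro fun k => u (k + h) * (starRingEnd ℂ) (u k)) atTop (𝓝 0)) :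
    Tendsto (cesaro u) atTop (𝓝 0) := by
  have hlt : ∀ h h' : ℕ, h' < h →
      Tendsto (cesaro fun k => u (k + h) * (starRingEnd ℂ) (u (k + h'))) atTop (𝓝 0) := by
    intro h h' hh
    have h2 := (tendsto_cesaro_shift_sub
      (u := fun k => u (k + (h - h')) * (starRingEnd ℂ) (u k)) (by simp [hu]) h').add
      (hcorr (h - h') (by omega))
    simp only [sub_add_cancel, add_zero] at h2
    refine h2.congr fun N => ?_
    congr 1; ext k
    rw [show k + h' + (h - h') = k + h by omega]
  have hgt : ∀ h h' : ℕ, h < h' →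
      Tendsto (cesaro fun k => u (k + h) * (starRingEnd ℂ) (u (k + h'))) atTop (𝓝 0) := by
    intro h h' hh
    have := (Complex.continuous_conj.tendsto 0).comp (hlt h' h hh)
    rw [map_zero] at this
    refine this.congr fun N => ?_
    simp [cesaro, mul_comm]
  have key : ∀ j : ℕ, 1 ≤ j → ∀ᶠ N in atTop, ‖cesaro u N‖ ≤ 3 / j := by
    intro j hj
    set V : ℕ → ℂ := fun k => ∑ h ∈ Finset.range (j ^ 2), u (k + h) with hV
    have hVV : Tendsto (cesaro fun k => V k * (starRingEnd ℂ) (V k)) atTop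
        (𝓝 (∑ h ∈ Finset.range (j ^ 2), ∑ h' ∈ Finset.range (j ^ 2),
          if h = h' then (1 : ℂ) else 0)) := by
      have : ∀ N, cesaro (fun k => V k * (starRingEnd ℂ) (V k)) N
          = ∑ h ∈ Finset.range (j ^ 2), ∑ h' ∈ Finset.range (j ^ 2),
            cesaro (fun k => u (k + h) * (starRingEnd ℂ) (u (k + h'))) N := by
        intro N
        simp only [hV, map_sum, Finset.sum_mul_sum, cesaro_sum]
      refine Tendsto.congr (fun N => (this N).symm) ?_
      refine tendsto_finsetSum _ fun h _ => tendsto_finsetSum _ fun h' _ => ?_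
      rcases lt_trichotomy h h' with hh | rfl | hh
      · simpa [hh.ne] using hgt h h' hh
      · simp only [Complex.mul_conj', hu, if_true]
        refine tendsto_const_nhds.congr' ?_
        filter_upwards [eventually_gt_atTop 0] with N hN
        simp [cesaro, hN.ne']
      · simpa [hh.ne'] using hlt h h' hh
    have hsum : (∑ h ∈ Finset.range (j ^ 2), ∑ h' ∈ Finset.range (j ^ 2),
        if h = h' then (1 : ℂ) else 0) = ((j ^ 2 : ℕ) : ℂ) := by
      rw [Finset.sum_congr rfl (g := fun _ => (1 : ℂ))]
      · simp
      · intro h hh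
        simp only [Finset.sum_ite_eq, if_pos hh]
    rw [hsum] at hVV
    have hn := hVV.norm
    rw [Complex.norm_natCast] at hn
    have e1 : ∀ᶠ N in atTop, ‖cesaro (fun k => V k * (starRingEnd ℂ) (V k)) N‖
        < ((j ^ 2 : ℕ) : ℝ) + 1 := hn.eventually_lt_const (by linarith)
    have hd : Tendsto (fun N => cesaro V N - (j ^ 2 : ℕ) * cesaro u N) atTop (𝓝 0) := by
      have := tendsto_finsetSum (Finset.range (j ^ 2))
        fun h _ => tendsto_cesaro_shift_sub (fun k => (hu k).le) h
      simp only [Finset.sum_const_zero] at this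
      refine this.congr fun N => ?_
      rw [hV, cesaro_sum, Finset.sum_sub_distrib]
      simp
    have e2 : ∀ᶠ N in atTop, ‖cesaro V N - (j ^ 2 : ℕ) * cesaro u N‖ < 1 := by
      have := hd.norm
      rw [norm_zero] at this
      exact this.eventually_lt_const one_pos
    filter_upwards [e1, e2] with N h1 h2
    have hj' : (1 : ℝ) ≤ j := by exact_mod_cast hj
    have h3 : ‖cesaro V N‖ ≤ j + 1 := by
      have := norm_cesaro_sq_le V N
      push_cast at h1
      nlinarith [norm_nonneg (cesaro V N)]
    have h4 : (j : ℝ) ^ 2 * ‖cesaro u N‖ ≤ j + 2 := by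
      have := norm_sub_norm_le ((j ^ 2 : ℕ) * cesaro u N) (cesaro V N)
      rw [norm_sub_rev, norm_mul, Complex.norm_natCast] at this
      push_cast at this h2
      linarith
    rw [le_div_iff₀ (by linarith)]
    nlinarith [norm_nonneg (cesaro u N)]
  refine Metric.tendsto_atTop.2 fun ε hε => ?_
  obtain ⟨j, hj⟩ := exists_nat_gt (3 / ε)
  have hj0 : 0 < j := by
    have : (0 : ℝ) < j := lt_trans (by positivity) hj
    exact_mod_cast this
  obtain ⟨N0, hN0⟩ := eventually_atTop.1 (key j hj0)
  refine ⟨N0, fun N hN => ?_⟩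
  rw [dist_zero_right]
  refine (hN0 N hN).trans_lt ?_
  rw [div_lt_iff₀ (by exact_mod_cast hj0)]
  rw [div_lt_iff₀ hε] at hj
  linarith

/-- The endomorphism of the torus induced by an integer matrix. -/
noncomputable def torusAct {n : ℕ} (A : Matrix (Fin n) (Fin n) ℤ) (z : Torus n) : Torus n :=
  fun i => ∑ j, A i j • z j

/-- The character of the torus with frequency vector `b`, valued in `ℝ/ℤ`. -/
noncomputable def torusPair {n : ℕ} (b : Fin n → ℤ) (z : Torus n) : AddCircle (1 : ℝ) :=
  ∑ i, b i • z i

section TorusAlgebra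

variable {n : ℕ}

lemma continuous_torusAct (A : Matrix (Fin n) (Fin n) ℤ) : Continuous (torusAct A) := by
  unfold torusAct; fun_prop

lemma continuous_torusPair (b : Fin n → ℤ) : Continuous (torusPair b) := by
  unfold torusPair; fun_prop

lemma continuous_torusProj : Continuous (torusProj n) :=
  continuous_pi fun i => (AddCircle.continuous_mk' 1).comp (continuous_apply i)

lemma torusPair_add (b : Fin n → ℤ) (z z' : Torus n) :
    torusPair b (z + z') = torusPair b z + torusPair b z' := by
  simp [torusPair, Finset.sum_add_distrib]

lemma torusPair_sub (b : Fin n → ℤ) (z z' : Torus n) :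
    torusPair b (z - z') = torusPair b z - torusPair b z' := by
  simp [torusPair, smul_sub, Finset.sum_sub_distrib]

lemma torusPair_sub_left (b b' : Fin n → ℤ) (z : Torus n) :
    torusPair (b - b') z = torusPair b z - torusPair b' z := by
  simp [torusPair, sub_smul, Finset.sum_sub_distrib]

lemma torusPair_smul_left (m : ℤ) (b : Fin n → ℤ) (z : Torus n) :
    torusPair (m • b) z = m • torusPair b z := by
  simp [torusPair, mul_smul, Finset.smul_sum]

lemma torusPair_torusAct (b : Fin n → ℤ) (A : Matrix (Fin n) (Fin n) ℤ) (z : Torus n) :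
    torusPair b (torusAct A z) = torusPair (b ᵥ* A) z := by
  simp only [torusPair, torusAct, vecMul, dotProduct, Finset.smul_sum, Finset.sum_smul, mul_smul]
  rw [Finset.sum_comm]

lemma torusAct_add (A : Matrix (Fin n) (Fin n) ℤ) (z z' : Torus n) :
    torusAct A (z + z') = torusAct A z + torusAct A z' := by
  ext i; simp [torusAct, Finset.sum_add_distrib]

lemma torusAct_mul (A B : Matrix (Fin n) (Fin n) ℤ) (z : Torus n) :
    torusAct (A * B) z = torusAct A (torusAct B z) := by
  ext i; exact (torusPair_torusAct (A i) B z).symm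

lemma torusAct_one (z : Torus n) : torusAct 1 z = z := by
  ext i; simp [torusAct, Matrix.one_apply, ite_smul]

lemma torusProj_add (x y : Fin n → ℝ) : torusProj n (x + y) = torusProj n x + torusProj n y := by
  ext i; simp [torusProj]

lemma torusProj_neg (x : Fin n → ℝ) : torusProj n (-x) = -torusProj n x := by
  ext i; simp [torusProj]

lemma torusPair_torusProj (b : Fin n → ℤ) (x : Fin n → ℝ) :
    torusPair b (torusProj n x) = ((((fun i => (b i : ℝ)) ⬝ᵥ x : ℝ)) : AddCircle (1 : ℝ)) := by
  simp only [torusPair, torusProj, dotProduct]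
  rw [← QuotientAddGroup.mk'_apply, map_sum]
  refine Finset.sum_congr rfl fun i _ => ?_
  rw [← zsmul_eq_mul, map_zsmul]; rfl

lemma torusAct_torusProj (A : Matrix (Fin n) (Fin n) ℤ) (x : Fin n → ℝ) :
    torusAct A (torusProj n x) = torusProj n (A.map (Int.cast : ℤ → ℝ) *ᵥ x) := by
  ext i; exact torusPair_torusProj (A i) x

lemma torusProj_surjective : Function.Surjective (torusProj n) := fun z => by
  choose x hx using fun i => QuotientAddGroup.mk_surjective (z i)
  exact ⟨x, funext hx⟩

lemma mFourier_eq_toCircle (b : Fin n → ℤ) (z : Torus n) :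
    mFourier b z = (AddCircle.toCircle (torusPair b z) : ℂ) := by
  have : ∀ s : Finset (Fin n), ∏ i ∈ s, fourier (b i) (z i)
      = (AddCircle.toCircle (∑ i ∈ s, b i • z i) : ℂ) := by
    intro s
    induction s using Finset.induction_on with
    | empty => simp
    | insert a s ha ih =>
      rw [Finset.prod_insert ha, Finset.sum_insert ha, ih, AddCircle.toCircle_add, fourier_apply]
      simp
  exact this Finset.univ

lemma norm_mFourier_apply (b : Fin n → ℤ) (z : Torus n) : ‖mFourier b z‖ = 1 := by
  rw [mFourier_eq_toCircle, Circle.norm_coe]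

lemma mFourier_add_apply (b : Fin n → ℤ) (z z' : Torus n) :
    mFourier b (z + z') = mFourier b z * mFourier b z' := by
  simp [mFourier_eq_toCircle, torusPair_add, AddCircle.toCircle_add]

lemma mFourier_mul_conj (b : Fin n → ℤ) (z z' : Torus n) :
    mFourier b z * (starRingEnd ℂ) (mFourier b z') = mFourier b (z - z') := by
  rw [← mFourier_neg, mFourier_eq_toCircle, mFourier_eq_toCircle, mFourier_eq_toCircle,
    ← Circle.coe_mul, ← AddCircle.toCircle_add, torusPair_sub]
  congr 3
  simp [torusPair, sub_eq_add_neg]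

end TorusAlgebra

section FiberOrbits

variable {n : ℕ} {U : Matrix (Fin n) (Fin n) ℤ} {v : Fin n → ℤ} {β : Torus n} {x : ℕ → Torus n}

lemma vecMul_mem_span_of_fixed (hv : v ᵥ* U = v) {b : Fin n → ℤ} (hb : b ∈ ℤ ∙ v) :
    b ᵥ* U ∈ ℤ ∙ v := by
  obtain ⟨j, rfl⟩ := Submodule.mem_span_singleton.1 hb
  rw [Matrix.smul_vecMul, hv]
  exact Submodule.smul_mem _ _ (Submodule.mem_span_singleton_self v)

lemma vecMul_pow_of_fixed {b : Fin n → ℤ} (hb : b ᵥ* U = b) (k : ℕ) : b ᵥ* U ^ k = b := by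
  induction k with
  | zero => simp
  | succ k ih => rw [pow_succ, ← vecMul_vecMul, ih, hb]

lemma vecMul_pow_sub_mem (hv : v ᵥ* U = v) {b : Fin n → ℤ} (hb : b ᵥ* (U - 1) ∈ ℤ ∙ v) (k : ℕ) :
    b ᵥ* U ^ k - b ∈ ℤ ∙ v := by
  induction k with
  | zero => simp
  | succ k ih =>
    have h1 := vecMul_mem_span_of_fixed hv ih
    rw [vecMul_sub, vecMul_one] at hb
    rw [sub_vecMul, vecMul_vecMul, ← pow_succ] at h1
    have := Submodule.add_mem _ h1 hb
    rwa [sub_add_sub_cancel] at this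

lemma mem_span_of_smul_mem {e : Fin n → ℤ} (he : v ⬝ᵥ e = 1) {b : Fin n → ℤ} {m : ℤ} (hm : m ≠ 0)
    (hb : m • b ∈ ℤ ∙ v) : b ∈ ℤ ∙ v := by
  obtain ⟨j, hj⟩ := Submodule.mem_span_singleton.1 hb
  have h1 : j = m * (b ⬝ᵥ e) := by
    have := congrArg (· ⬝ᵥ e) hj
    simp only [smul_dotProduct, he, smul_eq_mul, mul_one] at this
    exact this
  refine Submodule.mem_span_singleton.2 ⟨b ⬝ᵥ e, ?_⟩
  rw [h1, mul_smul] at hj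
  exact smul_right_injective _ hm hj

lemma vecMul_geom_sum_notMem (hv : v ᵥ* U = v) {e : Fin n → ℤ} (he : v ⬝ᵥ e = 1)
    {b : Fin n → ℤ} (hb : b ∉ ℤ ∙ v) (hb1 : b ᵥ* (U - 1) ∈ ℤ ∙ v) {h : ℕ} (hh : 1 ≤ h) :
    b ᵥ* (∑ i ∈ Finset.range h, U ^ i) ∉ ℤ ∙ v := by
  intro hc
  have h1 : b ᵥ* (∑ i ∈ Finset.range h, U ^ i) - (h : ℤ) • b ∈ ℤ ∙ v := by
    have : b ᵥ* (∑ i ∈ Finset.range h, U ^ i) - (h : ℤ) • b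
        = ∑ i ∈ Finset.range h, (b ᵥ* U ^ i - b) := by
      rw [Matrix.vecMul_sum, Finset.sum_sub_distrib]; simp
    rw [this]
    exact Submodule.sum_mem _ fun i _ => vecMul_pow_sub_mem hv hb1 i
  have h2 := Submodule.sub_mem _ hc h1
  rw [sub_sub_cancel] at h2
  exact hb (mem_span_of_smul_mem he (by omega) h2)

lemma exists_affine_iterate (hx : ∀ k, x (k + 1) = torusAct U (x k) + β) (h : ℕ) :
    ∃ γ : Torus n, ∀ k, x (k + h) = torusAct (U ^ h) (x k) + γ := by
  induction h with
  | zero => exact ⟨0, fun k => by simp [torusAct_one]⟩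
  | succ h ih =>
    obtain ⟨γ, hγ⟩ := ih
    refine ⟨torusAct U γ + β, fun k => ?_⟩
    rw [← add_assoc, hx, hγ, torusAct_add, pow_succ', torusAct_mul, add_assoc]

/-- Orbits of a unipotent affine map of the torus equidistribute in the fibre of an invariant
character, provided the translation part is generic. -/
lemma tendsto_cesaro_mFourier (hv : v ᵥ* U = v) {e : Fin n → ℤ} (he : v ⬝ᵥ e = 1)
    (hU : IsNilpotent (U - 1)) (hβ : ∀ b : Fin n → ℤ, b ∉ ℤ ∙ v → torusPair b β ≠ 0)
    (hx : ∀ k, x (k + 1) = torusAct U (x k) + β) (hxv : ∀ k, torusPair v (x k) = 0)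
    {b : Fin n → ℤ} (hb : b ∉ ℤ ∙ v) :
    Tendsto (cesaro fun k => mFourier b (x k)) atTop (𝓝 0) := by
  have hpair : ∀ b ∈ ℤ ∙ v, ∀ k, torusPair b (x k) = 0 := by
    intro b hb k
    obtain ⟨j, rfl⟩ := Submodule.mem_span_singleton.1 hb
    rw [torusPair_smul_left, hxv, smul_zero]
  have hspan : ∀ A : Matrix (Fin n) (Fin n) ℤ, v ᵥ* A ∈ ℤ ∙ v → ∀ b ∈ ℤ ∙ v, b ᵥ* A ∈ ℤ ∙ v := by
    intro A hA b hb
    obtain ⟨j, rfl⟩ := Submodule.mem_span_singleton.1 hb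
    rw [Matrix.smul_vecMul]
    exact Submodule.smul_mem _ _ hA
  have main : ∀ d : ℕ, ∀ b : Fin n → ℤ, b ᵥ* (U - 1) ^ d ∉ ℤ ∙ v →
      b ᵥ* (U - 1) ^ (d + 1) ∈ ℤ ∙ v →
      Tendsto (cesaro fun k => mFourier b (x k)) atTop (𝓝 0) := by
    intro d
    induction d with
    | zero =>
      intro b hb0 hb1
      simp only [pow_zero, vecMul_one, zero_add, pow_one] at hb0 hb1
      have hstep : ∀ k, mFourier b (x (k + 1)) = mFourier b β * mFourier b (x k) := by
        intro k
        have h1 : torusPair (b ᵥ* U) (x k) = torusPair b (x k) := by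
          rw [← sub_eq_zero, ← torusPair_sub_left]
          rw [vecMul_sub, vecMul_one] at hb1
          exact hpair _ hb1 k
        rw [hx, mFourier_add_apply, mul_comm, mFourier_eq_toCircle b (torusAct U (x k)),
          torusPair_torusAct, h1, ← mFourier_eq_toCircle]
      have hform : ∀ k, mFourier b (x k) = mFourier b (x 0) * mFourier b β ^ k := by
        intro k
        induction k with
        | zero => simp
        | succ k ih => rw [hstep, ih, pow_succ]; ring
      have hne : mFourier b β ≠ 1 := by
        intro h
        rw [mFourier_eq_toCircle] at h
        refine hβ b hb0 (AddCircle.injective_toCircle one_ne_zero ?_)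
        rw [AddCircle.toCircle_zero]
        exact Circle.ext h
      have := (tendsto_cesaro_pow (norm_mFourier_apply b β) hne).const_mul (mFourier b (x 0))
      rw [mul_zero] at this
      refine this.congr fun N => ?_
      rw [← cesaro_const_mul]
      exact congrArg (fun u => cesaro u N) (funext fun k => (hform k).symm)
    | succ d ih =>
      intro b hb0 hb1
      refine tendsto_cesaro_of_correlations (fun k => norm_mFourier_apply b _) fun h hh => ?_
      obtain ⟨γ, hγ⟩ := exists_affine_iterate hx h
      set G := ∑ i ∈ Finset.range h, U ^ i with hG
      have hGN : Commute (U - 1) G :=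
        Commute.sum_right _ _ _ fun i _ => ((Commute.refl U).pow_right i).sub_left
            (Commute.one_left _)
      have hvG : v ᵥ* G ∈ ℤ ∙ v := by
        rw [hG, Matrix.vecMul_sum]
        refine Submodule.sum_mem _ fun i _ => ?_
        rw [vecMul_pow_of_fixed hv]
        exact Submodule.mem_span_singleton_self v
      have hcorr : ∀ k, mFourier b (x (k + h)) * (starRingEnd ℂ) (mFourier b (x k))
          = mFourier b γ * mFourier (b ᵥ* ((U - 1) * G)) (x k) := by
        intro k
        rw [mFourier_mul_conj, hγ, hG, mul_geom_sum, mFourier_eq_toCircle, mFourier_eq_toCircle,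
          mFourier_eq_toCircle, ← Circle.coe_mul, ← AddCircle.toCircle_add]
        congr 2
        rw [vecMul_sub, torusPair_sub_left, torusPair_sub, torusPair_add, torusPair_torusAct,
          vecMul_one]
        abel
      have e1 : ∀ m : ℕ, b ᵥ* ((U - 1) * G) ᵥ* (U - 1) ^ m = b ᵥ* (U - 1) ^ (m + 1) ᵥ* G := by
        intro m
        rw [vecMul_vecMul, vecMul_vecMul, pow_succ', mul_assoc, mul_assoc,
          (hGN.pow_left m).eq]
      have := (ih (b ᵥ* ((U - 1) * G)) (by
        rw [e1]
        refine vecMul_geom_sum_notMem hv he hb0 ?_ hh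
        rw [vecMul_vecMul, ← pow_succ]; exact hb1) (by
        rw [e1]; exact hspan G hvG _ hb1)).const_mul (mFourier b γ)
      rw [mul_zero] at this
      refine this.congr fun N => ?_
      rw [← cesaro_const_mul]
      exact congrArg (fun u => cesaro u N) (funext fun k => (hcorr k).symm)
  obtain ⟨r, hr⟩ := hU
  have hex : ∃ d, b ᵥ* (U - 1) ^ d ∈ ℤ ∙ v := ⟨r, by rw [hr, vecMul_zero]; exact zero_mem _⟩
  classical
  have hpos : Nat.find hex ≠ 0 := by
    intro h0
    have := Nat.find_spec hex
    rw [h0, pow_zero, vecMul_one] at this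
    exact hb this
  obtain ⟨d, hd⟩ := Nat.exists_eq_succ_of_ne_zero hpos
  refine main d b (Nat.find_min hex (by omega)) ?_
  have := Nat.find_spec hex
  rwa [hd] at this

end FiberOrbits

section FiberDensity

variable {n : ℕ} {U : Matrix (Fin n) (Fin n) ℤ} {v : Fin n → ℤ} {β : Torus n} {x : ℕ → Torus n}

/-- If all characters that are nontrivial on the closed subgroup `torusPair v = 0` average to zero
along a sequence, then the averages of continuous functions are asymptotically invariant under
translations by this subgroup. -/
lemma tendsto_cesaro_sub_translate
    (hx : ∀ b : Fin n → ℤ, b ∉ ℤ ∙ v → Tendsto (cesaro fun k => mFourier b (x k)) atTop (𝓝 0))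
    {h : Torus n} (hh : torusPair v h = 0) (f : C(Torus n, ℂ)) :
    Tendsto (cesaro fun k => f (x k) - f (x k - h)) atTop (𝓝 0) := by
  have hspan : ∀ g ∈ Submodule.span ℂ (Set.range (mFourier (d := Fin n))),
      Tendsto (cesaro fun k => g (x k) - g (x k - h)) atTop (𝓝 0) := by
    intro g hg
    induction hg using Submodule.span_induction with
    | mem g hg =>
      obtain ⟨b, rfl⟩ := hg
      have e : ∀ k, mFourier b (x k) - mFourier b (x k - h)
          = (1 - mFourier b (-h)) * mFourier b (x k) := by
        intro k
        rw [sub_eq_add_neg (x k), mFourier_add_apply]; ring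
      simp_rw [e]
      by_cases hb : b ∈ ℤ ∙ v
      · have h1 : mFourier b (-h) = 1 := by
          obtain ⟨j, rfl⟩ := Submodule.mem_span_singleton.1 hb
          rw [mFourier_eq_toCircle, torusPair_smul_left, ← zero_sub h, torusPair_sub, hh]
          simp [torusPair]
        exact tendsto_cesaro_zero_of_sum_bounded (C := 0) (by simp [h1])
      · have := (hx b hb).const_mul (1 - mFourier b (-h))
        rw [mul_zero] at this
        exact this.congr fun N => (cesaro_const_mul _ _ _).symm
    | zero => exact tendsto_cesaro_zero_of_sum_bounded (C := 0) (by simp)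
    | add g g' _ _ hg hg' =>
      have := hg.add hg'
      rw [add_zero] at this
      refine this.congr fun N => ?_
      simp only [cesaro, ContinuousMap.add_apply, ← mul_add, ← Finset.sum_add_distrib]
      congr 1
      exact Finset.sum_congr rfl fun k _ => by ring
    | smul c g _ hg =>
      have := hg.const_mul c
      rw [mul_zero] at this
      refine this.congr fun N => ?_
      simp only [cesaro, ContinuousMap.smul_apply, smul_eq_mul, ← mul_sub, ← Finset.mul_sum]
      ring
  have hf : f ∈ (Submodule.span ℂ (Set.range (mFourier (d := Fin n)))).topologicalClosure := by
    rw [span_mFourier_closure_eq_top]; trivial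
  rw [← SetLike.mem_coe, Submodule.topologicalClosure_coe, Metric.mem_closure_iff] at hf
  refine Metric.tendsto_atTop.2 fun ε hε => ?_
  obtain ⟨g, hg, hfg⟩ := hf (ε / 4) (by linarith)
  obtain ⟨N0, hN0⟩ := Metric.tendsto_atTop.1 (hspan g hg) (ε / 2) (by linarith)
  refine ⟨N0, fun N hN => ?_⟩
  have h1 := hN0 N hN
  rw [dist_zero_right] at h1 ⊢
  have h2 : ‖cesaro (fun k => (f (x k) - f (x k - h)) - (g (x k) - g (x k - h))) N‖ ≤ ε / 2 := by
    refine norm_cesaro_le (by linarith) (fun k => ?_) N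
    have hb : ∀ y, ‖f y - g y‖ ≤ ε / 4 := fun y => by
      rw [← dist_eq_norm]; exact (ContinuousMap.dist_apply_le_dist y).trans hfg.le
    rw [sub_sub_sub_comm]
    refine (norm_sub_le _ _).trans ?_
    linarith [hb (x k), hb (x k - h)]
  rw [cesaro_sub] at h2
  have h3 := norm_le_norm_add_norm_sub' (cesaro (fun k => f (x k) - f (x k - h)) N)
    (cesaro (fun k => g (x k) - g (x k - h)) N)
  linarith

lemma exists_mem_of_tendsto_cesaro
    (hx : ∀ b : Fin n → ℤ, b ∉ ℤ ∙ v → Tendsto (cesaro fun k => mFourier b (x k)) atTop (𝓝 0))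
    (hxv : ∀ k, torusPair v (x k) = 0) {a : Torus n} (ha : torusPair v a = 0)
    {W : Set (Torus n)} (hW : IsOpen W) (haW : a ∈ W) : ∃ k, x k ∈ W := by
  by_contra! hc
  have hne : Wᶜ.Nonempty := ⟨x 0, hc 0⟩
  set f : Torus n → ℝ := fun y => Metric.infDist y Wᶜ with hf
  have hfc : Continuous f := Metric.continuous_infDist_pt _
  have hfx : ∀ k, f (x k) = 0 := fun k => Metric.infDist_zero_of_mem (hc k)
  have hfa : 0 < f a := by
    refine (hW.isClosed_compl.notMem_iff_infDist_pos hne).1 ?_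
    simpa using haW
  have hH : IsCompact {y : Torus n | torusPair v y = 0} :=
    (isClosed_eq (continuous_torusPair v) continuous_const).isCompact
  obtain ⟨t, ht, htc⟩ := hH.elim_finite_subcover_image
    (b := {y : Torus n | torusPair v y = 0}) (c := fun h => {y | f a / 2 < f (y - h)})
    (fun h _ => isOpen_lt continuous_const (hfc.comp (continuous_id.sub continuous_const)))
    (fun y hy => by
      refine Set.mem_iUnion₂.2 ⟨y - a, ?_, ?_⟩
      · simp only [Set.mem_ofPred_eq] at hy ⊢
        rw [torusPair_sub, hy, ha, sub_zero]
      · simp only [Set.mem_ofPred_eq, sub_sub_cancel]; linarith)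
  obtain ⟨htf, hcov⟩ := htc
  have hlim : Tendsto (cesaro fun k => ∑ h ∈ htf.toFinset, ((f (x k - h) : ℝ) : ℂ)) atTop (𝓝 0) := by
    have : ∀ h ∈ htf.toFinset, Tendsto (cesaro fun k => ((f (x k - h) : ℝ) : ℂ)) atTop (𝓝 0) := by
      intro h hh
      have h1 := (tendsto_cesaro_sub_translate hx (ht (htf.mem_toFinset.1 hh))
        ⟨fun y => (f y : ℂ), Complex.continuous_ofReal.comp hfc⟩).neg
      rw [neg_zero] at h1
      refine h1.congr fun N => ?_
      simp [hfx, cesaro]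
    have := tendsto_finsetSum _ this
    rw [Finset.sum_const_zero] at this
    exact this.congr fun N => (cesaro_sum _ _ _).symm
  have hlow : ∀ k, f a / 2 ≤ ∑ h ∈ htf.toFinset, f (x k - h) := by
    intro k
    obtain ⟨h, hh, hk⟩ := Set.mem_iUnion₂.1 (hcov (hxv k))
    exact hk.le.trans (Finset.single_le_sum (f := fun h => f (x k - h))
      (fun _ _ => Metric.infDist_nonneg) (htf.mem_toFinset.2 hh))
  obtain ⟨N0, hN0⟩ := Metric.tendsto_atTop.1 hlim (f a / 2) (by linarith)
  have h1 := hN0 (N0 + 1) (by omega)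
  have hN' : (0 : ℝ) < ((N0 + 1 : ℕ) : ℝ) := by positivity
  rw [dist_zero_right, cesaro, norm_mul, norm_inv, Complex.norm_natCast,
    inv_mul_lt_iff₀ hN'] at h1
  have h2 : ∑ k ∈ Finset.range (N0 + 1), ∑ h ∈ htf.toFinset, ((f (x k - h) : ℝ) : ℂ)
      = ((∑ k ∈ Finset.range (N0 + 1), ∑ h ∈ htf.toFinset, f (x k - h) : ℝ) : ℂ) := by
    push_cast; rfl
  rw [h2, Complex.norm_real] at h1
  have h3 := (le_abs_self _).trans_lt h1
  have h4 := Finset.card_nsmul_le_sum (Finset.range (N0 + 1))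
    (fun k => ∑ h ∈ htf.toFinset, f (x k - h)) (f a / 2) fun k _ => hlow k
  rw [Finset.card_range, nsmul_eq_mul] at h4
  linarith

end FiberDensity

section SmoothSeries

/-- The Dirichlet-type kernel `∑_{i < h} cos (2π i x)` on the circle. -/
noncomputable def cosKernel (h : ℕ) (x : AddCircle (1 : ℝ)) : ℝ :=
  ∑ i ∈ Finset.range h, (fourier (i : ℤ) x).re

lemma continuous_cosKernel (h : ℕ) : Continuous (cosKernel h) :=
  continuous_finsetSum _ fun i _ => Complex.continuous_re.comp (fourier (i : ℤ)).continuous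

lemma abs_cosKernel_le (h : ℕ) (x : AddCircle (1 : ℝ)) : |cosKernel h x| ≤ h := by
  refine (Finset.abs_sum_le_sum_abs _ _).trans ?_
  refine (Finset.sum_le_sum (g := fun _ => (1 : ℝ)) fun i _ =>
    (Complex.abs_re_le_norm _).trans ?_).trans (by simp)
  rw [fourier_apply, Circle.norm_coe]

lemma cosKernel_zero (h : ℕ) : cosKernel h 0 = h := by
  simp [cosKernel]

lemma cosKernel_eq_zero {h : ℕ} {x : AddCircle (1 : ℝ)} (hx : x ≠ 0) (hhx : h • x = 0) :
    cosKernel h x = 0 := by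
  have e : ∀ i : ℕ, fourier (i : ℤ) x = (AddCircle.toCircle x : ℂ) ^ i := fun i => by
    rw [fourier_apply, natCast_zsmul, AddCircle.toCircle_nsmul, Circle.coe_pow]
  have hne : (AddCircle.toCircle x : ℂ) ≠ 1 := by
    intro h1
    refine hx (AddCircle.injective_toCircle one_ne_zero ?_)
    rw [AddCircle.toCircle_zero]
    exact Circle.ext h1
  have h1 : (AddCircle.toCircle x : ℂ) ^ h = 1 := by
    rw [← Circle.coe_pow, ← AddCircle.toCircle_nsmul, hhx, AddCircle.toCircle_zero, Circle.coe_one]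
  rw [cosKernel, ← Complex.re_sum]
  simp_rw [e]
  rw [geom_sum_eq hne, h1]
  simp

lemma cosKernel_coe (h : ℕ) (x : ℝ) :
    cosKernel h (x : AddCircle (1 : ℝ))
      = ∑ i ∈ Finset.range h, Real.cos (2 * Real.pi * i * x) := by
  refine Finset.sum_congr rfl fun i _ => ?_
  rw [fourier_coe_apply]
  have : (2 * Real.pi * Complex.I * ((i : ℤ) : ℂ) * x / ((1 : ℝ) : ℂ) : ℂ)
      = ((2 * Real.pi * i * x : ℝ) : ℂ) * Complex.I := by
    push_cast; ring
  rw [this, Complex.exp_ofReal_mul_I_re]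

/-- A family of smooth functions on the circle parametrized by the Hilbert cube. -/
noncomputable def cubeSeries (c : ℕ → Set.Icc (0 : ℝ) 1) (x : AddCircle (1 : ℝ)) : ℝ :=
  ∑' h : ℕ, (c h : ℝ) * Real.exp (-h) * cosKernel h x

lemma norm_cubeSeries_term_le (c : ℕ → Set.Icc (0 : ℝ) 1) (x : AddCircle (1 : ℝ)) (h : ℕ) :
    ‖(c h : ℝ) * Real.exp (-h) * cosKernel h x‖ ≤ (h : ℝ) ^ 1 * Real.exp (-1 * h) := by
  have h1 := abs_cosKernel_le h x
  have h2 : |(c h : ℝ)| ≤ 1 := abs_le.2 ⟨by linarith [(c h).2.1], (c h).2.2⟩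
  rw [norm_mul, norm_mul, Real.norm_eq_abs, Real.norm_eq_abs, Real.norm_eq_abs, Real.abs_exp,
    pow_one, neg_one_mul, mul_comm (h : ℝ)]
  calc _ ≤ 1 * Real.exp (-h) * h := by gcongr
    _ = _ := by ring

lemma summable_cubeSeries (c : ℕ → Set.Icc (0 : ℝ) 1) (x : AddCircle (1 : ℝ)) :
    Summable fun h : ℕ => (c h : ℝ) * Real.exp (-h) * cosKernel h x :=
  Summable.of_norm_bounded (Real.summable_pow_mul_exp_neg_nat_mul 1 one_pos)
    (norm_cubeSeries_term_le c x)

lemma continuous_cubeSeries :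
    Continuous fun p : (ℕ → Set.Icc (0 : ℝ) 1) × AddCircle (1 : ℝ) => cubeSeries p.1 p.2 := by
  refine continuous_tsum (fun h => ?_) (Real.summable_pow_mul_exp_neg_nat_mul 1 one_pos)
    fun h p => norm_cubeSeries_term_le p.1 p.2 h
  have := continuous_cosKernel h
  fun_prop

lemma cubeSeries_update (c : ℕ → Set.Icc (0 : ℝ) 1) (h : ℕ) (t : Set.Icc (0 : ℝ) 1)
    (x : AddCircle (1 : ℝ)) :
    cubeSeries (Function.update c h t) x
      = cubeSeries c x + ((t : ℝ) - c h) * Real.exp (-h) * cosKernel h x := by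
  rw [← sub_eq_iff_eq_add', cubeSeries, cubeSeries,
    ← (summable_cubeSeries _ x).tsum_sub (summable_cubeSeries c x), tsum_eq_single h]
  · simp only [Function.update_self]; ring
  · intro h' hh'
    simp [Function.update_of_ne hh']

lemma contDiff_cubeSeries (c : ℕ → Set.Icc (0 : ℝ) 1) :
    ContDiff ℝ (⊤ : ℕ∞) fun x : ℝ => cubeSeries c (x : AddCircle (1 : ℝ)) := by
  unfold cubeSeries
  simp_rw [cosKernel_coe]
  have hsm : ∀ (i : ℕ), ContDiff ℝ (⊤ : ℕ∞) fun x : ℝ => Real.cos (2 * Real.pi * i * x) :=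
    fun i => Real.contDiff_cos.comp (contDiff_const.mul contDiff_id)
  refine contDiff_tsum
    (v := fun k (h : ℕ) => (2 * Real.pi) ^ k * ((h : ℝ) ^ (k + 1) * Real.exp (-1 * h)))
    (fun h => contDiff_const.mul (ContDiff.sum fun i _ => hsm i))
    (fun k _ => (Real.summable_pow_mul_exp_neg_nat_mul (k + 1) one_pos).mul_left _) ?_
  intro k h x _
  rw [norm_iteratedFDeriv_eq_norm_iteratedDeriv, iteratedDeriv_const_mul_field,
    iteratedDeriv_fun_sum fun i _ => ((hsm i).of_le (by exact_mod_cast le_top)).contDiffAt]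
  have hb : ∀ i ∈ Finset.range h, ‖iteratedDeriv k (fun x : ℝ => Real.cos (2 * Real.pi * i * x)) x‖
      ≤ (2 * Real.pi * h) ^ k := by
    intro i hi
    rw [iteratedDeriv_comp_const_mul Real.contDiff_cos, norm_mul, norm_pow, Real.norm_eq_abs,
      Real.norm_eq_abs, abs_of_nonneg (by positivity)]
    have hih : (i : ℝ) ≤ h := by exact_mod_cast (Finset.mem_range.1 hi).le
    calc _ ≤ (2 * Real.pi * h) ^ k * 1 := by
          gcongr
          exact Real.abs_iteratedDeriv_cos_le_one k _
      _ = _ := mul_one _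
  have h2 : |(c h : ℝ)| ≤ 1 := abs_le.2 ⟨by linarith [(c h).2.1], (c h).2.2⟩
  rw [norm_mul, norm_mul, Real.norm_eq_abs, Real.norm_eq_abs (Real.exp _), Real.abs_exp]
  calc _ ≤ 1 * Real.exp (-h) * (h * (2 * Real.pi * h) ^ k) := by
        gcongr
        refine (norm_sum_le _ _).trans ((Finset.sum_le_sum hb).trans ?_)
        simp
    _ = _ := by rw [mul_pow, neg_one_mul]; ring

end SmoothSeries

section IntegerMatrices

variable {n : ℕ} {L : Matrix (Fin n) (Fin n) ℤ}

lemma exists_pow_sub_one_isNilpotent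
    (hqu : ∀ z : ℂ, (L.map (Int.cast : ℤ → ℂ)).charpoly.IsRoot z → ∃ m : ℕ, 0 < m ∧ z ^ m = 1) :
    ∃ m : ℕ, 0 < m ∧ IsNilpotent (L ^ m - 1) := by
  set M := L.map (Int.cast : ℤ → ℂ) with hM
  have hroot : ∀ z ∈ M.charpoly.roots, ∃ m : ℕ, 0 < m ∧ z ^ m = 1 := fun z hz =>
    hqu z (Polynomial.isRoot_of_mem_roots hz)
  choose! k hk0 hk1 using hroot
  classical
  set m := ∏ z ∈ M.charpoly.roots.toFinset, k z with hm
  have hm0 : 0 < m := Finset.prod_pos fun z hz => hk0 z (Multiset.mem_toFinset.1 hz)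
  have hpow : ∀ z ∈ M.charpoly.roots, z ^ m = 1 := by
    intro z hz
    obtain ⟨d, hd⟩ := Finset.dvd_prod_of_mem k (Multiset.mem_toFinset.2 hz)
    rw [hm, hd, pow_mul, hk1 z hz, one_pow]
  have hdvd : M.charpoly ∣ (Polynomial.X ^ m - 1) ^ Multiset.card M.charpoly.roots := by
    have h1 := (IsAlgClosed.splits M.charpoly).eq_prod_roots_of_monic M.charpoly_monic
    have h2 : ∀ s : Multiset ℂ, (∀ z ∈ s, z ^ m = 1) →
        (s.map fun a => Polynomial.X - Polynomial.C a).prod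
          ∣ (Polynomial.X ^ m - 1) ^ Multiset.card s := by
      intro s
      induction s using Multiset.induction_on with
      | empty => simp
      | cons a s ih =>
        intro hs
        rw [Multiset.map_cons, Multiset.prod_cons, Multiset.card_cons, pow_succ']
        refine mul_dvd_mul ?_ (ih fun z hz => hs z (Multiset.mem_cons_of_mem hz))
        rw [Polynomial.dvd_iff_isRoot]
        simp [hs a (Multiset.mem_cons_self a s)]
    have h3 := h2 _ hpow
    rwa [← h1] at h3
  refine ⟨m, hm0, Multiset.card M.charpoly.roots, ?_⟩
  have h1 : (M ^ m - 1) ^ Multiset.card M.charpoly.roots = 0 := by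
    obtain ⟨r, hr⟩ := hdvd
    have := congrArg (Polynomial.aeval M) hr
    rw [map_mul, Matrix.aeval_self_charpoly, zero_mul] at this
    simpa using this
  have hinj : Function.Injective ((Int.castRingHom ℂ).mapMatrix (m := Fin n)) :=
    Matrix.map_injective Int.cast_injective
  apply hinj
  rw [map_pow, map_sub, map_pow, map_one, map_zero]
  exact h1

lemma exists_primitive_fixed_covector
    (h1 : (L.map (Int.cast : ℤ → ℂ)).charpoly.IsRoot 1) :
    ∃ v e : Fin n → ℤ, v ᵥ* L = v ∧ v ⬝ᵥ e = 1 := by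
  have hdet : (1 - L).det = 0 := by
    rw [Polynomial.IsRoot, Matrix.eval_charpoly, map_one] at h1
    have : (Int.castRingHom ℂ) (1 - L).det = 0 := by
      rw [RingHom.map_det, map_sub, map_one]; exact h1
    simpa using this
  obtain ⟨u, hu0, hu⟩ := Matrix.exists_vecMul_eq_zero_iff.2 hdet
  rw [vecMul_sub, vecMul_one, sub_eq_zero] at hu
  set I : Ideal ℤ := Ideal.span (Set.range u) with hI
  obtain ⟨d, hd⟩ := (IsPrincipalIdealRing.principal I).principal
  have hdvd : ∀ i, ∃ r, u i = d * r := by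
    intro i
    have : u i ∈ I := Ideal.subset_span ⟨i, rfl⟩
    rw [hd] at this
    exact Ideal.mem_span_singleton.1 this
  choose v hv using hdvd
  have huv : u = d • v := by ext i; simp [hv i]
  have hd0 : d ≠ 0 := by
    rintro rfl
    exact hu0 (by simpa using huv)
  have hdI : d ∈ I := by rw [hd]; exact Submodule.mem_span_singleton_self d
  obtain ⟨e, he⟩ := (Ideal.mem_span_range_iff_exists_fun).1 hdI
  refine ⟨v, e, ?_, ?_⟩
  · rw [huv, Matrix.smul_vecMul] at hu
    exact (smul_right_injective _ hd0 hu).symm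
  · apply mul_left_cancel₀ hd0
    rw [mul_one]
    conv_rhs => rw [← he]
    simp only [dotProduct, Finset.mul_sum, hv]
    exact Finset.sum_congr rfl fun i _ => by ring

lemma exists_rationally_independent (n : ℕ) :
    ∃ w : Fin n → ℝ, ∀ b : Fin n → ℤ, b ≠ 0 → (fun i => (b i : ℝ)) ⬝ᵥ w ≠ 0 := by
  have hτ := transcendental_liouvilleNumber (m := 2) le_rfl
  set τ := liouvilleNumber ((2 : ℕ) : ℝ)
  refine ⟨fun i => τ ^ (i : ℕ), fun b hb h0 => hb ?_⟩
  have hp := transcendental_iff.1 hτ (∑ i : Fin n, Polynomial.C (b i) * Polynomial.X ^ (i : ℕ))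
    (by simpa [dotProduct] using h0)
  ext i
  have := congrArg (fun p => Polynomial.coeff p (i : ℕ)) hp
  simpa [Polynomial.coeff_X_pow, Fin.val_inj, Finset.sum_ite_eq] using this

lemma exists_generic_direction {v e : Fin n → ℤ} (he : v ⬝ᵥ e = 1) :
    ∃ w : Fin n → ℝ, (fun i => (v i : ℝ)) ⬝ᵥ w = 0 ∧
      ∀ b : Fin n → ℤ, b ∉ ℤ ∙ v → (fun i => (b i : ℝ)) ⬝ᵥ w ≠ 0 := by
  obtain ⟨w, hw⟩ := exists_rationally_independent n
  have hcast : ∀ b : Fin n → ℤ, (fun i => (b i : ℝ)) ⬝ᵥ (fun i => (e i : ℝ)) = ((b ⬝ᵥ e : ℤ) : ℝ) := by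
    intro b; simp [dotProduct]
  refine ⟨w - ((fun i => (v i : ℝ)) ⬝ᵥ w) • fun i => (e i : ℝ), ?_, fun b hb h0 => ?_⟩
  · rw [dotProduct_sub, dotProduct_smul, hcast, he]; simp
  · rw [dotProduct_sub, dotProduct_smul, hcast] at h0
    refine hw (b - (b ⬝ᵥ e) • v) (fun h => hb ?_) ?_
    · rw [sub_eq_zero.1 h]
      exact Submodule.smul_mem _ _ (Submodule.mem_span_singleton_self v)
    · have : (fun i => ((b - (b ⬝ᵥ e) • v) i : ℝ))
          = (fun i => (b i : ℝ)) - ((b ⬝ᵥ e : ℤ) : ℝ) • fun i => (v i : ℝ) := by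
        ext i; simp
      rw [this, sub_dotProduct, smul_dotProduct]
      simp only [smul_eq_mul] at h0 ⊢
      linarith

end IntegerMatrices

section SkewMaps

variable {n : ℕ} {L : Matrix (Fin n) (Fin n) ℤ} {v : Fin n → ℤ} {w e : Fin n → ℝ}
  {p : ℝ × (ℕ → Set.Icc (0 : ℝ) 1)}

/-- The translation by which the skew map with parameter `p` acts over the point `s` of the circle. -/
noncomputable def stepTranslation (w e : Fin n → ℝ) (p : ℝ × (ℕ → Set.Icc (0 : ℝ) 1))
    (s : AddCircle (1 : ℝ)) : Torus n :=
  torusProj n (cubeSeries p.2 s • w + p.1 • e)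

/-- The linear map `L` followed by a translation that depends on the character `v`. -/
noncomputable def skewMap (L : Matrix (Fin n) (Fin n) ℤ) (v : Fin n → ℤ) (w e : Fin n → ℝ)
    (p : ℝ × (ℕ → Set.Icc (0 : ℝ) 1)) (z : Torus n) : Torus n :=
  torusAct L z + stepTranslation w e p (torusPair v z)

lemma continuous_stepTranslation :
    Continuous fun x : (ℝ × (ℕ → Set.Icc (0 : ℝ) 1)) × AddCircle (1 : ℝ) =>
      stepTranslation w e x.1 x.2 := by
  have h : Continuous fun x : (ℝ × (ℕ → Set.Icc (0 : ℝ) 1)) × AddCircle (1 : ℝ) =>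
      cubeSeries x.1.2 x.2 :=
    continuous_cubeSeries.comp ((continuous_snd.comp continuous_fst).prodMk continuous_snd)
  exact continuous_torusProj.comp ((h.smul continuous_const).add
    ((continuous_fst.comp continuous_fst).smul continuous_const))

lemma continuous_skewMap :
    Continuous fun x : (ℝ × (ℕ → Set.Icc (0 : ℝ) 1)) × Torus n => skewMap L v w e x.1 x.2 :=
  ((continuous_torusAct L).comp continuous_snd).add
    (continuous_stepTranslation.comp
      (continuous_fst.prodMk ((continuous_torusPair v).comp continuous_snd)))

lemma continuous_skewMap_iterate (k : ℕ) :
    Continuous fun x : (ℝ × (ℕ → Set.Icc (0 : ℝ) 1)) × Torus n =>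
      (skewMap L v w e x.1)^[k] x.2 := by
  induction k with
  | zero => exact continuous_snd
  | succ k ih =>
    have h := (continuous_skewMap (L := L) (v := v) (w := w) (e := e)).comp
      (continuous_fst.prodMk ih)
    simpa only [Function.iterate_succ_apply', Function.comp_def] using h

lemma torusPair_stepTranslation (hw : (fun i => (v i : ℝ)) ⬝ᵥ w = 0)
    (he : (fun i => (v i : ℝ)) ⬝ᵥ e = 1) (s : AddCircle (1 : ℝ)) :
    torusPair v (stepTranslation w e p s) = (p.1 : AddCircle (1 : ℝ)) := by
  simp [stepTranslation, torusPair_torusProj, dotProduct_add, dotProduct_smul, hw, he]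

lemma torusPair_skewMap (hv : v ᵥ* L = v) (hw : (fun i => (v i : ℝ)) ⬝ᵥ w = 0)
    (he : (fun i => (v i : ℝ)) ⬝ᵥ e = 1) (z : Torus n) :
    torusPair v (skewMap L v w e p z) = torusPair v z + (p.1 : AddCircle (1 : ℝ)) := by
  rw [skewMap, torusPair_add, torusPair_torusAct, hv, torusPair_stepTranslation hw he]

lemma torusPair_skewMap_iterate (hv : v ᵥ* L = v) (hw : (fun i => (v i : ℝ)) ⬝ᵥ w = 0)
    (he : (fun i => (v i : ℝ)) ⬝ᵥ e = 1) (k : ℕ) (z : Torus n) :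
    torusPair v ((skewMap L v w e p)^[k] z)
      = torusPair v z + k • (p.1 : AddCircle (1 : ℝ)) := by
  induction k with
  | zero => simp
  | succ k ih =>
    rw [Function.iterate_succ_apply', torusPair_skewMap hv hw he, ih, succ_nsmul, add_assoc]

/-- The skew map as a homeomorphism of the torus. -/
noncomputable def skewHomeo (hL : IsUnit L.det) (hv : v ᵥ* L = v)
    (hw : (fun i => (v i : ℝ)) ⬝ᵥ w = 0) (he : (fun i => (v i : ℝ)) ⬝ᵥ e = 1)
    (p : ℝ × (ℕ → Set.Icc (0 : ℝ) 1)) : Torus n ≃ₜ Torus n where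
  toFun := skewMap L v w e p
  invFun z := torusAct L⁻¹ (z - stepTranslation w e p (torusPair v z - (p.1 : AddCircle (1 : ℝ))))
  left_inv z := by
    beta_reduce
    rw [torusPair_skewMap hv hw he, add_sub_cancel_right, skewMap, add_sub_cancel_right,
      ← torusAct_mul, Matrix.nonsing_inv_mul _ hL, torusAct_one]
  right_inv z := by
    have hv' : v ᵥ* L⁻¹ = v := by
      conv_lhs => rw [← hv, vecMul_vecMul, Matrix.mul_nonsing_inv _ hL, vecMul_one]
    rw [skewMap, torusPair_torusAct, hv', torusPair_sub, torusPair_stepTranslation hw he,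
      ← torusAct_mul, Matrix.mul_nonsing_inv _ hL, torusAct_one, sub_add_cancel]
  continuous_toFun := continuous_skewMap.comp (continuous_const.prodMk continuous_id)
  continuous_invFun := by
    refine (continuous_torusAct _).comp (continuous_id.sub ?_)
    exact continuous_stepTranslation.comp
      (continuous_const.prodMk ((continuous_torusPair v).sub continuous_const))

/-- The accumulated translation part, lifted to `ℝ^n`, of the iterates of the skew map on the
kernel of the character `v`. -/
noncomputable def fiberDrift (L : Matrix (Fin n) (Fin n) ℤ) (w e : Fin n → ℝ)
    (p : ℝ × (ℕ → Set.Icc (0 : ℝ) 1)) : ℕ → Fin n → ℝ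
  | 0 => 0
  | j + 1 => L.map (Int.cast : ℤ → ℝ) *ᵥ fiberDrift L w e p j
      + (cubeSeries p.2 (j • (p.1 : AddCircle (1 : ℝ))) • w + p.1 • e)

lemma fiberDrift_succ (p : ℝ × (ℕ → Set.Icc (0 : ℝ) 1)) (j : ℕ) :
    fiberDrift L w e p (j + 1) = L.map (Int.cast : ℤ → ℝ) *ᵥ fiberDrift L w e p j
      + (cubeSeries p.2 (j • (p.1 : AddCircle (1 : ℝ))) • w + p.1 • e) :=
  rfl

lemma skewMap_iterate_eq (hv : v ᵥ* L = v) (hw : (fun i => (v i : ℝ)) ⬝ᵥ w = 0)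
    (he : (fun i => (v i : ℝ)) ⬝ᵥ e = 1) {z : Torus n} (hz : torusPair v z = 0) (j : ℕ) :
    (skewMap L v w e p)^[j] z = torusAct (L ^ j) z + torusProj n (fiberDrift L w e p j) := by
  induction j with
  | zero =>
    ext i; simp [fiberDrift, torusAct_one, torusProj]
  | succ j ih =>
    rw [Function.iterate_succ_apply', skewMap, torusPair_skewMap_iterate hv hw he, hz, zero_add, ih,
      torusAct_add, ← torusAct_mul, ← pow_succ', torusAct_torusProj, fiberDrift, torusProj_add,
      stepTranslation, add_assoc]

/-- Changing the coefficient `c h` only affects the first step, because the kernel of order `h`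
vanishes at the nonzero multiples of a rotation whose order divides `h`. -/
lemma fiberDrift_update {α : ℝ} {c : ℕ → Set.Icc (0 : ℝ) 1} {h : ℕ}
    (hh : addOrderOf (α : AddCircle (1 : ℝ)) ∣ h) (t : Set.Icc (0 : ℝ) 1) {j : ℕ}
    (hj : j < addOrderOf (α : AddCircle (1 : ℝ))) :
    fiberDrift L w e (α, Function.update c h t) (j + 1) = fiberDrift L w e (α, c) (j + 1)
      + (((t : ℝ) - c h) * Real.exp (-h) * h) • ((L ^ j).map (Int.cast : ℤ → ℝ) *ᵥ w) := by
  induction j with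
  | zero =>
    simp [fiberDrift, cubeSeries_update, cosKernel_zero, add_smul]
    abel
  | succ j ih =>
    have hx : cosKernel h ((j + 1) • (α : AddCircle (1 : ℝ))) = 0 := by
      refine cosKernel_eq_zero (nsmul_ne_zero_of_lt_addOrderOf (Nat.succ_ne_zero j) hj) ?_
      obtain ⟨d, rfl⟩ := hh
      rw [smul_comm, mul_comm, mul_nsmul', addOrderOf_nsmul_eq_zero, smul_zero, smul_zero]
    rw [fiberDrift_succ _ (j + 1), fiberDrift_succ _ (j + 1), ih ((Nat.lt_succ_self j).trans hj)]
    simp only [cubeSeries_update, hx, mul_zero, add_zero, mulVec_add, mulVec_smul, mulVec_mulVec,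
      pow_succ' L (j), Matrix.map_mul_intCast]
    abel

end SkewMaps

section FiberMinimality

variable {n : ℕ} {L : Matrix (Fin n) (Fin n) ℤ} {v e : Fin n → ℤ} {w e' : Fin n → ℝ}

lemma exists_update_torusPair_fiberDrift_ne (hL : IsUnit L.det) (hv : v ᵥ* L = v)
    (hwb : ∀ b : Fin n → ℤ, b ∉ ℤ ∙ v → (fun i => (b i : ℝ)) ⬝ᵥ w ≠ 0) {α : ℝ}
    (hq : 0 < addOrderOf (α : AddCircle (1 : ℝ))) (c : ℕ → Set.Icc (0 : ℝ) 1) {h : ℕ} (h0 : 0 < h)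
    (hh : addOrderOf (α : AddCircle (1 : ℝ)) ∣ h) :
    ∃ t : Set.Icc (0 : ℝ) 1, ∀ b : Fin n → ℤ, b ∉ ℤ ∙ v →
      torusPair b (torusProj n (fiberDrift L w e' (α, Function.update c h t)
        (addOrderOf (α : AddCircle (1 : ℝ))))) ≠ 0 := by
  obtain ⟨r, hr⟩ : ∃ r, addOrderOf (α : AddCircle (1 : ℝ)) = r + 1 := ⟨_, (Nat.sub_add_cancel hq).symm⟩
  set A : (Fin n → ℤ) → ℝ := fun b => (fun i => (b i : ℝ)) ⬝ᵥ fiberDrift L w e' (α, c) (r + 1)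
  set B : (Fin n → ℤ) → ℝ := fun b => Real.exp (-h) * h *
    ((fun i => (b i : ℝ)) ⬝ᵥ ((L ^ r).map (Int.cast : ℤ → ℝ) *ᵥ w))
  have hB : ∀ b : Fin n → ℤ, b ∉ ℤ ∙ v → B b ≠ 0 := by
    intro b hb
    have hcast : (fun i => (b i : ℝ)) ᵥ* (L ^ r).map (Int.cast : ℤ → ℝ)
        = fun i => ((b ᵥ* L ^ r) i : ℝ) := by
      ext i; simp [vecMul, dotProduct]
    refine mul_ne_zero (by positivity) ?_
    rw [dotProduct_mulVec, hcast]
    refine hwb _ fun hmem => hb ?_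
    obtain ⟨a, ha⟩ := Submodule.mem_span_singleton.1 hmem
    have hinj := Matrix.vecMul_injective_of_isUnit
      (((Matrix.isUnit_iff_isUnit_det L).2 hL).pow r)
    refine Submodule.mem_span_singleton.2 ⟨a, hinj ?_⟩
    change (a • v) ᵥ* L ^ r = b ᵥ* L ^ r
    rw [smul_vecMul, vecMul_pow_of_fixed hv, ha]
  obtain ⟨t, ht, htbad⟩ : ∃ t ∈ Set.Icc (0 : ℝ) 1,
      t ∉ Set.range fun x : (Fin n → ℤ) × ℤ => (c h : ℝ) + (x.2 - A x.1) / B x.1 := by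
    by_contra! hcon
    have := (Set.countable_range _).mono hcon
    exact absurd (Cardinal.Real.Icc_countable_iff.1 this) (by norm_num)
  refine ⟨⟨t, ht⟩, fun b hb hzero => htbad ?_⟩
  rw [hr, fiberDrift_update hh _ (by omega), torusPair_torusProj,
    AddCircle.coe_eq_zero_iff] at hzero
  obtain ⟨k, hk⟩ := hzero
  refine ⟨(b, k), ?_⟩
  have hk' : (k : ℝ) = A b + (t - c h) * B b := by
    rw [dotProduct_add, dotProduct_smul] at hk
    simp only [zsmul_eq_mul, mul_one, smul_eq_mul] at hk
    rw [hk]; simp only [A, B]; ring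
  have := hB b hb
  simp only [hk']
  field_simp
  ring

lemma exists_skewMap_iterate_mem (hv : v ᵥ* L = v) (hw : (fun i => (v i : ℝ)) ⬝ᵥ w = 0)
    (he : v ⬝ᵥ e = 1) (he' : (fun i => (v i : ℝ)) ⬝ᵥ e' = 1) {p : ℝ × (ℕ → Set.Icc (0 : ℝ) 1)}
    {q : ℕ} (hq : q • (p.1 : AddCircle (1 : ℝ)) = 0) (hLq : IsNilpotent (L ^ q - 1))
    (hβ : ∀ b : Fin n → ℤ, b ∉ ℤ ∙ v → torusPair b (torusProj n (fiberDrift L w e' p q)) ≠ 0)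
    {z a : Torus n} (hz : torusPair v z = 0) (ha : torusPair v a = 0)
    {W : Set (Torus n)} (hW : IsOpen W) (haW : a ∈ W) :
    ∃ k, (skewMap L v w e' p)^[k] z ∈ W := by
  set x : ℕ → Torus n := fun k => (skewMap L v w e' p)^[q * k] z
  have hxv : ∀ k, torusPair v (x k) = 0 := fun k => by
    simp only [x]
    rw [torusPair_skewMap_iterate hv hw he', hz, mul_comm, mul_nsmul', hq, smul_zero, add_zero]
  have hx : ∀ k, x (k + 1) = torusAct (L ^ q) (x k) + torusProj n (fiberDrift L w e' p q) := by
    intro k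
    rw [← skewMap_iterate_eq hv hw he' (hxv k), ← Function.iterate_add_apply]
    simp only [x, mul_add, mul_one, add_comm]
  obtain ⟨k, hk⟩ := exists_mem_of_tendsto_cesaro (fun b hb => tendsto_cesaro_mFourier
    (vecMul_pow_of_fixed hv q) he hLq hβ hx hxv hb) hxv ha hW haW
  exact ⟨q * k, hk⟩

lemma exists_reduced_fraction_near {M : ℕ} (hM : 0 < M) (a : ℝ) {ε : ℝ} (hε : 0 < ε) :
    ∃ (p : ℤ) (q : ℕ), 0 < q ∧ M ∣ q ∧ p.natAbs.gcd q = 1 ∧ |(p : ℝ) / q - a| < ε := by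
  have hN : (2 : ℝ) ≤ (2 * M : ℕ) := by
    have : (1 : ℝ) ≤ M := by exact_mod_cast hM
    push_cast; linarith
  set N := 2 * M
  obtain ⟨k, hk⟩ := exists_nat_gt (2 / ε)
  have hNk : (2 / ε) < (N : ℝ) ^ k := by
    have h2 : (k : ℝ) ≤ 2 ^ k := by exact_mod_cast (Nat.lt_two_pow_self (n := k)).le
    exact hk.trans_le (h2.trans (by gcongr))
  have hN0 : (0 : ℝ) < N := by linarith
  set r := ⌊a * (N : ℝ) ^ k⌋
  refine ⟨1 + N * r, N ^ (k + 1), by positivity, (Dvd.intro_left 2 rfl).trans (dvd_pow_self N (by simp)),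
    ?_, ?_⟩
  · have hcop : IsCoprime (1 + N * r) ((N : ℤ) ^ (k + 1)) :=
      IsCoprime.pow_right ⟨1, -r, by ring⟩
    simpa [Int.isCoprime_iff_gcd_eq_one, Int.gcd, Int.natAbs_pow] using hcop
  · have hy : (0 : ℝ) < (N : ℝ) ^ k := by positivity
    have hle := Int.floor_le (a * (N : ℝ) ^ k)
    have hlt := Int.lt_floor_add_one (a * (N : ℝ) ^ k)
    have hval : ((1 + N * r : ℤ) : ℝ) / ((N ^ (k + 1) : ℕ) : ℝ) - a
        = (1 / N + (r - a * (N : ℝ) ^ k)) / (N : ℝ) ^ k := by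
      push_cast; field_simp; ring
    have hN1 : 1 / (N : ℝ) ≤ 1 / 2 := by gcongr
    have hN2 : 0 < 1 / (N : ℝ) := by positivity
    rw [hval, abs_div, abs_of_pos hy, div_lt_iff₀ hy]
    rw [div_lt_iff₀ hε, mul_comm] at hNk
    refine lt_of_le_of_lt (abs_le.2 ⟨?_, ?_⟩) hNk <;> linarith

end FiberMinimality

section Genericity

variable {n : ℕ} {L : Matrix (Fin n) (Fin n) ℤ} {v e : Fin n → ℤ} {w e' : Fin n → ℝ}

lemma exists_nsmul_eq_of_addOrderOf_nsmul_eq_zero {x y : AddCircle (1 : ℝ)}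
    (hx : 0 < addOrderOf x) (hy : addOrderOf x • y = 0) : ∃ j : ℕ, j • x = y := by
  obtain ⟨m, -, hm, hmx⟩ := (AddCircle.addOrderOf_eq_pos_iff hx).1 rfl
  obtain ⟨l, -, hly⟩ := (AddCircle.nsmul_eq_zero_iff hx).1 hy
  set q := addOrderOf x with hq
  have hfin : IsOfFinAddOrder x := addOrderOf_pos_iff.1 hx
  obtain ⟨a, b, hab⟩ := Nat.isCoprime_iff_coprime.2 hm
  refine (AddSubmonoid.mem_multiples_iff _ _).1 (hfin.mem_multiples_iff_mem_zmultiples.2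
    (AddSubgroup.mem_zmultiples_iff.2 ⟨l * a, ?_⟩))
  rw [← hmx, ← hly, ← AddCircle.coe_zsmul, ← sub_eq_zero, ← AddCircle.coe_sub,
    AddCircle.coe_eq_zero_iff]
  refine ⟨-(l * b), ?_⟩
  have hab' : (a : ℝ) * m + b * q = 1 := by exact_mod_cast hab
  have hq0 : (q : ℝ) ≠ 0 := by positivity
  simp only [zsmul_eq_mul]
  push_cast
  field_simp
  linear_combination (-(l : ℝ)) * hab'

lemma exists_mem_torusPair_isOfFinAddOrder (v : Fin n → ℤ) {U : Set (Torus n)} (hU : IsOpen U)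
    (hne : U.Nonempty) : ∃ z ∈ U, IsOfFinAddOrder (torusPair v z) := by
  have hd : DenseRange (torusProj n ∘ Pi.map fun _ (r : ℚ) => (r : ℝ)) :=
    torusProj_surjective.denseRange.comp (DenseRange.piMap fun _ => Rat.denseRange_cast)
      continuous_torusProj
  obtain ⟨r, hr⟩ := hd.exists_mem_open hU hne
  refine ⟨_, hr, ?_⟩
  change torusPair v _ ∈ AddCommGroup.torsion (AddCircle (1 : ℝ))
  refine sum_mem fun i _ => zsmul_mem (addOrderOf_pos_iff.1 ?_) _
  have : addOrderOf (((r i : ℝ) * 1 : ℝ) : AddCircle (1 : ℝ)) = (r i).den :=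
    AddCircle.addOrderOf_coe_rat
  rw [mul_one] at this
  exact this ▸ (r i).den_pos

lemma exists_mem_open_fiberDrift_generic (hL : IsUnit L.det) (hv : v ᵥ* L = v)
    (hwb : ∀ b : Fin n → ℤ, b ∉ ℤ ∙ v → (fun i => (b i : ℝ)) ⬝ᵥ w ≠ 0)
    {O : Set (ℝ × (ℕ → Set.Icc (0 : ℝ) 1))} (hO : IsOpen O) (hne : O.Nonempty) {M : ℕ}
    (hM : 0 < M) :
    ∃ p ∈ O, 0 < addOrderOf (p.1 : AddCircle (1 : ℝ)) ∧
      M ∣ addOrderOf (p.1 : AddCircle (1 : ℝ)) ∧ ∀ b : Fin n → ℤ, b ∉ ℤ ∙ v →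
        torusPair b (torusProj n
          (fiberDrift L w e' p (addOrderOf (p.1 : AddCircle (1 : ℝ))))) ≠ 0 := by
  obtain ⟨⟨α₀, c⟩, hαc⟩ := hne
  obtain ⟨A, C, hA, hC, hαA, hcC, hAC⟩ := isOpen_prod_iff.1 hO α₀ c hαc
  obtain ⟨ε, hε, hball⟩ := Metric.isOpen_iff.1 hA α₀ hαA
  obtain ⟨I, u, hIu, hIC⟩ := isOpen_pi_iff.1 hC c hcC
  obtain ⟨a, q, hq, hMq, hgcd, ha⟩ := exists_reduced_fraction_near hM α₀ hε
  have hord : addOrderOf (((a : ℝ) / q : ℝ) : AddCircle (1 : ℝ)) = q := by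
    simpa using AddCircle.addOrderOf_div_of_gcd_eq_one' (p := (1 : ℝ)) hq hgcd
  have hh : q * (I.sup id + 1) ∉ I := fun hmem => by
    have h1 : q * (I.sup id + 1) ≤ I.sup id := Finset.le_sup (f := id) hmem
    nlinarith
  obtain ⟨t, ht⟩ := exists_update_torusPair_fiberDrift_ne (e' := e') hL hv hwb
    (hord.symm ▸ hq) c (h := q * (I.sup id + 1)) (by positivity) (by rw [hord]; exact dvd_mul_right _ _)
  refine ⟨((a : ℝ) / q, Function.update c (q * (I.sup id + 1)) t), hAC ⟨hball ha, hIC fun i hi => ?_⟩,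
    by rw [hord]; exact hq, by rw [hord]; exact hMq, ht⟩
  have hne : i ≠ q * (I.sup id + 1) := fun h => hh (h ▸ hi)
  simpa only [Function.update_of_ne hne] using (hIu i hi).2

lemma isOpen_setOf_exists_skewMap_iterate_mem {U : Set (Torus n)} (hU : IsOpen U) :
    IsOpen {x : (ℝ × (ℕ → Set.Icc (0 : ℝ) 1)) × Torus n |
      ∃ k, (skewMap L v w e' x.1)^[k] x.2 ∈ U} := by
  simp only [Set.ofPred_exists]
  exact isOpen_iUnion fun k => hU.preimage (continuous_skewMap_iterate k)

lemma isOpen_setOf_forall_exists_skewMap_iterate_mem {U : Set (Torus n)} (hU : IsOpen U) :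
    IsOpen {p : ℝ × (ℕ → Set.Icc (0 : ℝ) 1) | ∀ z, ∃ k, (skewMap L v w e' p)^[k] z ∈ U} := by
  have h := isClosedMap_fst_of_compactSpace _
    (isOpen_setOf_exists_skewMap_iterate_mem (L := L) (v := v) (w := w) (e' := e') hU).isClosed_compl
  convert h.isOpen_compl using 1
  ext p
  simp

/-- For generic parameters every forward orbit of the skew map visits a given open set: at a nearby
parameter with rational rotation number all orbits in one fibre of `v` visit it, and a small
perturbation of the rotation number to an irrational one propagates this to all fibres. -/
lemma dense_setOf_forall_exists_skewMap_iterate_mem (hL : IsUnit L.det) {m : ℕ} (hm : 0 < m)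
    (hLm : IsNilpotent (L ^ m - 1)) (hv : v ᵥ* L = v) (hw : (fun i => (v i : ℝ)) ⬝ᵥ w = 0)
    (hwb : ∀ b : Fin n → ℤ, b ∉ ℤ ∙ v → (fun i => (b i : ℝ)) ⬝ᵥ w ≠ 0)
    (he : v ⬝ᵥ e = 1) (he' : (fun i => (v i : ℝ)) ⬝ᵥ e' = 1) {U : Set (Torus n)} (hU : IsOpen U)
    (hne : U.Nonempty) :
    Dense {p : ℝ × (ℕ → Set.Icc (0 : ℝ) 1) | ∀ z, ∃ k, (skewMap L v w e' p)^[k] z ∈ U} := by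
  refine dense_iff_inter_open.2 fun O hO hOne => ?_
  obtain ⟨z₁, hz₁U, hz₁⟩ := exists_mem_torusPair_isOfFinAddOrder v hU hne
  obtain ⟨p, hpO, hq, hdvd, hβ⟩ := exists_mem_open_fiberDrift_generic (e' := e') hL hv hwb hO hOne
    (Nat.mul_pos hm (addOrderOf_pos_iff.2 hz₁))
  set q := addOrderOf (p.1 : AddCircle (1 : ℝ)) with hqdef
  have hLq : IsNilpotent (L ^ q - 1) := by
    obtain ⟨d, hd⟩ := (Dvd.intro _ rfl).trans hdvd
    rw [hd, pow_mul, ← mul_geom_sum]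
    refine Commute.isNilpotent_mul_right ?_ hLm
    exact Commute.sum_right _ _ _ fun i _ =>
      (Commute.self_pow (L ^ m) i).sub_left (Commute.one_left _)
  obtain ⟨j, hj⟩ := exists_nsmul_eq_of_addOrderOf_nsmul_eq_zero hq
    (addOrderOf_dvd_iff_nsmul_eq_zero.1 ((Dvd.intro_left m rfl).trans hdvd))
  obtain ⟨a, ha⟩ := ((skewHomeo hL hv hw he' p).surjective.iterate j) z₁
  change (skewMap L v w e' p)^[j] a = z₁ at ha
  have hva : torusPair v a = 0 := by
    have := torusPair_skewMap_iterate (p := p) hv hw he' j a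
    rwa [ha, hj, right_eq_add] at this
  have hWo : IsOpen ((skewMap L v w e' p)^[j] ⁻¹' U) :=
    hU.preimage ((skewHomeo hL hv hw he' p).continuous.iterate j)
  have hfiber : ({p} : Set _) ×ˢ (torusPair v ⁻¹' {0}) ⊆
      {x : (ℝ × (ℕ → Set.Icc (0 : ℝ) 1)) × Torus n |
        ∃ k, (skewMap L v w e' x.1)^[k] x.2 ∈ U} := by
    rintro ⟨p', z⟩ ⟨rfl, hz⟩
    obtain ⟨k, hk⟩ := exists_skewMap_iterate_mem hv hw he he' (addOrderOf_nsmul_eq_zero _) hLq hβ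
      hz hva hWo (a := a) (by simpa [ha] using hz₁U)
    exact ⟨j + k, by rwa [Function.iterate_add_apply]⟩
  have hclosed : IsClosed (torusPair v ⁻¹' {(0 : AddCircle (1 : ℝ))}) :=
    isClosed_singleton.preimage (continuous_torusPair v)
  obtain ⟨P, V, hP, hV, hpP, hHV, hPV⟩ := generalized_tube_lemma isCompact_singleton
    hclosed.isCompact (isOpen_setOf_exists_skewMap_iterate_mem hU) hfiber
  obtain ⟨α, hα, hαPO⟩ := dense_irrational.exists_mem_open
    ((hP.inter hO).preimage (f := fun α : ℝ => (α, p.2)) (by fun_prop))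
    ⟨p.1, hpP rfl, hpO⟩
  refine ⟨(α, p.2), hαPO.2, fun z => ?_⟩
  have hnear : ∀ᶠ y in 𝓝 (0 : AddCircle (1 : ℝ)), ∀ x ∈ torusPair v ⁻¹' {y}, x ∈ V :=
    (continuous_torusPair v).isClosedMap.eventually_nhds_fiber 0 fun x hx =>
      hV.mem_nhds (hHV hx)
  obtain ⟨Y, hY, hYo, h0Y⟩ := eventually_nhds_iff.1 hnear
  have hdense : DenseRange fun k : ℕ => k • (α : AddCircle (1 : ℝ)) :=
    denseRange_zsmul_iff_nsmul.1 (AddCircle.denseRange_zsmul_coe_iff.2 (by simpa using hα))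
  obtain ⟨k, hk⟩ := hdense.exists_mem_open
    (hYo.preimage (continuous_const_add (torusPair v z))) ⟨-torusPair v z, by simpa using h0Y⟩
  have hkV : (skewMap L v w e' (α, p.2))^[k] z ∈ V :=
    hY _ hk _ (torusPair_skewMap_iterate hv hw he' k z)
  obtain ⟨i, hi⟩ := hPV (Set.mk_mem_prod hαPO.1 hkV)
  exact ⟨i + k, by rwa [Function.iterate_add_apply]⟩

lemma exists_isMinimal_skewHomeo (hL : IsUnit L.det) {m : ℕ} (hm : 0 < m)
    (hLm : IsNilpotent (L ^ m - 1)) (hv : v ᵥ* L = v) (hw : (fun i => (v i : ℝ)) ⬝ᵥ w = 0)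
    (hwb : ∀ b : Fin n → ℤ, b ∉ ℤ ∙ v → (fun i => (b i : ℝ)) ⬝ᵥ w ≠ 0)
    (he : v ⬝ᵥ e = 1) (he' : (fun i => (v i : ℝ)) ⬝ᵥ e' = 1) :
    ∃ p, IsMinimal (skewHomeo hL hv hw he' p) := by
  have hB := TopologicalSpace.isBasis_countableBasis (Torus n)
  obtain ⟨p, hp⟩ := (dense_iInter_of_isOpen
    (f := fun U : TopologicalSpace.countableBasis (Torus n) =>
      {p : ℝ × (ℕ → Set.Icc (0 : ℝ) 1) | ∀ z, ∃ k, (skewMap L v w e' p)^[k] z ∈ U.1})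
    (fun U => isOpen_setOf_forall_exists_skewMap_iterate_mem (hB.isOpen U.2))
    (fun U => dense_setOf_forall_exists_skewMap_iterate_mem hL hm hLm hv hw hwb he he'
      (hB.isOpen U.2) (TopologicalSpace.nonempty_of_mem_countableBasis U.2))).nonempty
  refine ⟨p, fun z => hB.dense_iff.2 fun U hU _ => ?_⟩
  obtain ⟨k, hk⟩ := Set.mem_iInter.1 hp ⟨U, hU⟩ z
  refine ⟨_, hk, k, ?_⟩
  simp only [zpow_natCast, ← Equiv.Perm.iterate_eq_pow]
  rfl

end Genericity

section SmoothLifts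

variable {n : ℕ} {v : Fin n → ℤ}

/-- The lift to `ℝ^n` of the translation part of the skew map, with the base point shifted by `s`. -/
noncomputable def translationLift (v : Fin n → ℤ) (w e : Fin n → ℝ)
    (p : ℝ × (ℕ → Set.Icc (0 : ℝ) 1)) (s : ℝ) (x : Fin n → ℝ) : Fin n → ℝ :=
  cubeSeries p.2 ((((fun i => (v i : ℝ)) ⬝ᵥ x - s : ℝ)) : AddCircle (1 : ℝ)) • w + p.1 • e

lemma contDiff_translationLift (w e : Fin n → ℝ) (p : ℝ × (ℕ → Set.Icc (0 : ℝ) 1)) (s : ℝ) :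
    ContDiff ℝ (⊤ : ℕ∞) (translationLift v w e p s) := by
  have h : ContDiff ℝ (⊤ : ℕ∞) fun x : Fin n → ℝ => (fun i => (v i : ℝ)) ⬝ᵥ x - s := by
    unfold dotProduct; fun_prop
  exact (((contDiff_cubeSeries p.2).comp h).smul contDiff_const).add contDiff_const

lemma translationLift_add_intCast (w e : Fin n → ℝ) (p : ℝ × (ℕ → Set.Icc (0 : ℝ) 1)) (s : ℝ)
    (x : Fin n → ℝ) (l : Fin n → ℤ) :
    translationLift v w e p s (x + fun i => (l i : ℝ)) = translationLift v w e p s x := by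
  have h : (fun i => (v i : ℝ)) ⬝ᵥ (x + fun i => (l i : ℝ)) - s
      = (fun i => (v i : ℝ)) ⬝ᵥ x - s + ((v ⬝ᵥ l : ℤ) : ℝ) * 1 := by
    rw [dotProduct_add]; simp [dotProduct]; ring
  rw [translationLift, h, AddCircle.coe_add, ← zsmul_eq_mul, AddCircle.coe_zsmul,
    AddCircle.coe_period, smul_zero, add_zero, translationLift]

lemma torusProj_translationLift (w e : Fin n → ℝ) (p : ℝ × (ℕ → Set.Icc (0 : ℝ) 1)) (s : ℝ)
    (x : Fin n → ℝ) :
    torusProj n (translationLift v w e p s x)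
      = stepTranslation w e p (torusPair v (torusProj n x) - (s : AddCircle (1 : ℝ))) := by
  rw [translationLift, stepTranslation, torusPair_torusProj, AddCircle.coe_sub]

end SmoothLifts

/-- For `1 ≤ n ≤ 4`, every quasi-unipotent `L ∈ GL(n,ℤ)` having `1`
as an eigenvalue is the linear part of a minimal `C^∞` diffeomorphism of `T^n`
(a homeomorphism such that both it and its inverse lift to smooth maps of `ℝ^n` of
the form "linear part + smooth `ℤ^n`-periodic map"). -/
theorem stmt3 (n : ℕ) (hn1 : 1 ≤ n) (hn4 : n ≤ 4)
    (L : Matrix (Fin n) (Fin n) ℤ) (hL : IsUnit L.det)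
    (hqu : ∀ z : ℂ, (L.map (Int.cast : ℤ → ℂ)).charpoly.IsRoot z →
      ∃ m : ℕ, 0 < m ∧ z ^ m = 1)
    (h1 : (L.map (Int.cast : ℤ → ℂ)).charpoly.IsRoot 1) :
    ∃ φ : Torus n ≃ₜ Torus n, IsMinimal φ ∧
      (∃ F : (Fin n → ℝ) → (Fin n → ℝ), ContDiff ℝ (⊤ : ℕ∞) F ∧
        (∀ (x : Fin n → ℝ) (ℓ : Fin n → ℤ), F (x + fun i => (ℓ i : ℝ)) = F x) ∧
        ∀ x : Fin n → ℝ,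
          torusProj n ((L.map (Int.cast : ℤ → ℝ)).mulVec x + F x) = φ (torusProj n x)) ∧
      (∃ G : (Fin n → ℝ) → (Fin n → ℝ), ContDiff ℝ (⊤ : ℕ∞) G ∧
        (∀ (x : Fin n → ℝ) (ℓ : Fin n → ℤ), G (x + fun i => (ℓ i : ℝ)) = G x) ∧
        ∀ x : Fin n → ℝ,
          torusProj n ((L⁻¹.map (Int.cast : ℤ → ℝ)).mulVec x + G x)
            = φ.symm (torusProj n x)) := by
  obtain ⟨m, hm, hLm⟩ := exists_pow_sub_one_isNilpotent hqu
  obtain ⟨v, e, hv, he⟩ := exists_primitive_fixed_covector h1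
  obtain ⟨w, hw, hwb⟩ := exists_generic_direction he
  have he' : (fun i => (v i : ℝ)) ⬝ᵥ (fun i => (e i : ℝ)) = 1 := by
    rw [← Int.cast_one, ← he]; simp [dotProduct]
  obtain ⟨p, hp⟩ := exists_isMinimal_skewHomeo hL hm hLm hv hw hwb he he'
  set F := translationLift v w (fun i => (e i : ℝ)) p
  refine ⟨skewHomeo hL hv hw he' p, hp, ⟨F 0, contDiff_translationLift _ _ _ _,
    translationLift_add_intCast _ _ _ _, fun x => ?_⟩,
    ⟨fun x => -(L⁻¹.map (Int.cast : ℤ → ℝ) *ᵥ F p.1 x), ?_, fun x l => ?_, fun x => ?_⟩⟩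
  · rw [torusProj_add, ← torusAct_torusProj, torusProj_translationLift, AddCircle.coe_zero, sub_zero]
    rfl
  · exact ((L⁻¹.map (Int.cast : ℤ → ℝ)).mulVecLin.toContinuousLinearMap.contDiff.comp
      (contDiff_translationLift _ _ _ _)).neg
  · simp only [F, translationLift_add_intCast]
  · rw [← sub_eq_add_neg, ← mulVec_sub, ← torusAct_torusProj, sub_eq_add_neg, torusProj_add,
      torusProj_neg, torusProj_translationLift, ← sub_eq_add_neg]
    rfl
end

section
/- For every integer s there exist a Liouville number α and a C^∞ ℤ-periodic function F : ℝ → ℝ such that the diffeomorphism φ of the torus T² = ℝ²/ℤ² defined by the lift (x,y) ↦ (x + α, sx − y + F(x)) is minimal. In particular the linear part of φ is the matrix [[1,0],[s,−1]]. -/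
/-- The `2`-torus `ℝ²/ℤ²`, realized as a product of two unit circles. -/
abbrev Torus2 := AddCircle (1 : ℝ) × AddCircle (1 : ℝ)

/-- The canonical projection `ℝ² → T²`. -/
noncomputable def torus2Proj (x : ℝ × ℝ) : Torus2 :=
  ((x.1 : AddCircle (1 : ℝ)), (x.2 : AddCircle (1 : ℝ)))

section CosSeries

open Real Finset
open scoped Nat

/-- The `i`-th mode `2 ^ (-i! * ⌊i / 3⌋) * cos (π * 2 ^ i! * x)` of `cosSeries`. -/
noncomputable def cosTerm (i : ℕ) (x : ℝ) : ℝ :=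
  (((2 : ℝ) ^ i !) ^ (i / 3))⁻¹ * cos (π * 2 ^ i ! * x)

/-- A smooth `1`-periodic function with lacunary spectrum, adapted to the Liouville constant. -/
noncomputable def cosSeries (x : ℝ) : ℝ := ∑' i, cosTerm i x

theorem summable_cosTerm_coeff_mul_pow (k : ℕ) :
    Summable fun i : ℕ => (((2 : ℝ) ^ i !) ^ (i / 3))⁻¹ * (π * 2 ^ i !) ^ k := by
  have hg : Summable fun i : ℕ => π ^ k * (1 / 2 : ℝ) ^ i :=
    (summable_geometric_of_lt_one (by norm_num) (by norm_num)).mul_left _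
  refine hg.of_norm_bounded_eventually_nat ?_
  filter_upwards [Filter.eventually_ge_atTop (3 * (k + 1))] with i hi
  have h2 : (2 : ℝ) ^ i ≤ 2 ^ i ! := pow_le_pow_right₀ (by norm_num) (Nat.self_le_factorial i)
  have h1 : (1 : ℝ) ≤ 2 ^ i ! := one_le_pow₀ (by norm_num)
  have h3 : ((2 : ℝ) ^ i !) ^ (k + 1) ≤ (2 ^ i !) ^ (i / 3) :=
    pow_le_pow_right₀ h1 (by omega)
  rw [Real.norm_of_nonneg (by positivity), mul_pow, one_div, inv_pow, inv_mul_eq_div,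
    ← div_eq_mul_inv, div_le_div_iff₀ (by positivity) (by positivity)]
  calc π ^ k * (2 ^ i !) ^ k * 2 ^ i ≤ π ^ k * (2 ^ i !) ^ k * 2 ^ i ! := by gcongr
    _ = π ^ k * (2 ^ i !) ^ (k + 1) := by ring
    _ ≤ π ^ k * (2 ^ i !) ^ (i / 3) := by gcongr

theorem summable_cosTerm (x : ℝ) : Summable fun i => cosTerm i x := by
  refine (summable_cosTerm_coeff_mul_pow 0).of_norm_bounded fun i => ?_
  rw [cosTerm, norm_mul, Real.norm_of_nonneg (by positivity), pow_zero]
  gcongr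
  exact abs_cos_le_one _

theorem contDiff_cosSeries : ContDiff ℝ (⊤ : ℕ∞) cosSeries := by
  have hcos (n : WithTop ℕ∞) (i : ℕ) : ContDiff ℝ n fun x => cos (π * 2 ^ i ! * x) := by fun_prop
  refine contDiff_tsum (N := (⊤ : ℕ∞)) (f := cosTerm)
    (fun i => contDiff_const.mul (hcos _ i))
    (fun k _ => summable_cosTerm_coeff_mul_pow k) fun k i x _ => ?_
  have hd : iteratedDeriv k (cosTerm i) x = (((2 : ℝ) ^ i !) ^ (i / 3))⁻¹ *
      ((π * 2 ^ i !) ^ k * iteratedDeriv k cos (π * 2 ^ i ! * x)) := by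
    rw [← congrFun (iteratedDeriv_comp_const_mul contDiff_cos (π * 2 ^ i !)) x]
    exact iteratedDeriv_const_mul _ (hcos _ i).contDiffAt
  rw [norm_iteratedFDeriv_eq_norm_iteratedDeriv, hd, norm_mul, norm_mul,
    Real.norm_of_nonneg (by positivity), Real.norm_of_nonneg (by positivity)]
  have := abs_iteratedDeriv_cos_le_one k (π * 2 ^ i ! * x)
  gcongr
  exact mul_le_of_le_one_right (by positivity) this

theorem cosSeries_periodic : Function.Periodic cosSeries 1 := by
  intro x
  refine tsum_congr fun i => ?_
  obtain ⟨n, hn⟩ : Even (2 ^ i !) := (even_two).pow_of_ne_zero (Nat.factorial_ne_zero i)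
  have hn' : (2 : ℝ) ^ i ! = n + n := by exact_mod_cast hn
  rw [cosTerm, cosTerm, hn', ← cos_add_nat_mul_two_pi (π * (n + n) * x) n]
  ring_nf

theorem exists_abs_cosSeries_sub_le :
    ∃ L : ℝ, 0 ≤ L ∧ ∀ x y, |cosSeries x - cosSeries y| ≤ L * |x - y| := by
  have hs := summable_cosTerm_coeff_mul_pow 1
  refine ⟨∑' i : ℕ, (((2 : ℝ) ^ i !) ^ (i / 3))⁻¹ * (π * 2 ^ i !) ^ 1,
    tsum_nonneg fun i => by positivity, fun x y => ?_⟩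
  rw [cosSeries, cosSeries, ← (summable_cosTerm x).tsum_sub (summable_cosTerm y), ← tsum_mul_right]
  refine tsum_of_norm_bounded (f := fun i => cosTerm i x - cosTerm i y) (hs.mul_right _).hasSum
    fun i => ?_
  rw [cosTerm, cosTerm, ← mul_sub, norm_mul, Real.norm_of_nonneg (by positivity),
    mul_assoc _ _ |x - y|]
  have hc : 0 ≤ (((2 : ℝ) ^ i !) ^ (i / 3))⁻¹ := by positivity
  refine mul_le_mul_of_nonneg_left ((abs_cos_sub_cos_le _ _).trans_eq ?_) hc
  rw [← mul_sub, abs_mul, abs_of_nonneg (by positivity), pow_one]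

theorem sum_range_add_of_periodic {g : ℕ → ℝ} {N : ℕ} (hg : ∀ j, g (j + N) = g j) (t : ℕ) :
    ∑ j ∈ range N, g (j + t) = ∑ j ∈ range N, g j := by
  induction t with
  | zero => simp
  | succ t ih =>
    have h := (sum_range_succ (fun j => g (j + t)) N).symm.trans
      (sum_range_succ' (fun j => g (j + t)) N)
    have hN : g (N + t) = g (0 + t) := by rw [add_comm N, hg, zero_add]
    rw [← ih]
    simp only [hN] at h
    rw [add_right_cancel h]
    exact sum_congr rfl fun j _ => by congr 1; ring

theorem sum_alternating_cosTerm_eq_zero {i m p t n : ℕ}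
    (ht : (2 : ℝ) ^ i ! * (t * (p / 2 ^ m !)) = n) (hodd : Odd (t + n)) (x : ℝ) :
    ∑ j ∈ range (2 ^ m !), (-1) ^ j * cosTerm i (x + j * (p / 2 ^ m !)) = 0 := by
  set g : ℕ → ℝ := fun j => (-1) ^ j * cosTerm i (x + j * (p / 2 ^ m !)) with hg
  have hshift {t n : ℕ} (ht : (2 : ℝ) ^ i ! * (t * (p / 2 ^ m !)) = n) (j : ℕ) :
      g (j + t) = (-1) ^ (t + n) * g j := by
    have harg : π * 2 ^ i ! * (x + (j + t : ℕ) * (p / 2 ^ m !)) =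
        π * 2 ^ i ! * (x + j * (p / 2 ^ m !)) + n * π := by
      rw [← ht]; push_cast; ring
    simp only [hg, cosTerm]
    rw [harg, cos_add_nat_mul_pi]
    ring
  have hper (j : ℕ) : g (j + 2 ^ m !) = g j := by
    have h := hshift (t := 2 ^ m !) (n := 2 ^ i ! * p) (by push_cast; field_simp) j
    have he : Even (2 ^ m ! + 2 ^ i ! * p) :=
      (even_two.pow_of_ne_zero (Nat.factorial_ne_zero m)).add
        ((even_two.pow_of_ne_zero (Nat.factorial_ne_zero i)).mul_right p)
    rwa [he.neg_one_pow, one_mul] at h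
  have h := sum_range_add_of_periodic hper t
  simp only [hshift ht, hodd.neg_one_pow, neg_one_mul, sum_neg_distrib] at h
  linarith

theorem sum_alternating_cosSeries {m p : ℕ} (hm : 2 ≤ m) (hp : Odd p) (x : ℝ) :
    ∑ j ∈ range (2 ^ m !), (-1) ^ j * cosSeries (x + j * (p / 2 ^ m !)) =
      2 ^ m ! * (((2 : ℝ) ^ m !) ^ (m / 3))⁻¹ * cos (π * 2 ^ m ! * x) := by
  simp only [cosSeries, ← tsum_mul_left]
  rw [← Summable.tsum_finsetSum fun j _ => (summable_cosTerm _).mul_left _, tsum_eq_single m]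
  · have hterm (j : ℕ) : (-1) ^ j * cosTerm m (x + j * (p / 2 ^ m !)) = cosTerm m x := by
      have harg : π * 2 ^ m ! * (x + j * (p / 2 ^ m !)) = π * 2 ^ m ! * x + (j * p : ℕ) * π := by
        push_cast; field_simp
      rw [cosTerm, harg, cos_add_nat_mul_pi, pow_mul', hp.neg_one_pow, cosTerm, mul_left_comm,
        ← mul_assoc ((-1) ^ j), ← mul_pow]
      simp
    rw [sum_congr rfl fun j _ => hterm j, sum_const, card_range, nsmul_eq_mul, cosTerm]
    push_cast
    ring
  · intro i hi
    rcases lt_or_gt_of_ne hi with h | h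
    · have hlt : i ! < m ! := (Nat.factorial_le (by omega)).trans_lt
        ((Nat.factorial_lt (by omega)).2 (by omega : m - 1 < m))
      refine sum_alternating_cosTerm_eq_zero (t := 2 ^ ((m !) - (i !))) (n := p) ?_
        ((even_two.pow_of_ne_zero (by omega)).add_odd hp) x
      push_cast
      rw [← mul_assoc, ← pow_add, Nat.add_sub_of_le hlt.le]
      field_simp
    · have hlt : m ! < i ! := (Nat.factorial_lt (by omega)).2 h
      refine sum_alternating_cosTerm_eq_zero (t := 1) (n := 2 ^ ((i !) - (m !)) * p) ?_
        (odd_one.add_even ((even_two.pow_of_ne_zero (by omega)).mul_right p)) x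
      push_cast
      rw [pow_sub₀ _ two_ne_zero hlt.le]
      field_simp

theorem exists_odd_partialSum_eq {m : ℕ} (hm : 2 ≤ m) :
    ∃ p : ℕ, Odd p ∧ LiouvilleNumber.partialSum 2 m = p / 2 ^ m ! := by
  obtain ⟨k, rfl⟩ : ∃ k, m = k + 1 := ⟨m - 1, by omega⟩
  obtain ⟨p, hp⟩ := LiouvilleNumber.partialSum_eq_rat (m := 2) two_pos k
  have hlt : k ! < (k + 1)! := (Nat.factorial_lt (by omega)).2 (by omega)
  refine ⟨p * 2 ^ ((k + 1)! - (k !)) + 1,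
    ((even_two.pow_of_ne_zero (by omega)).mul_left p).add_one, ?_⟩
  push_cast at hp ⊢
  rw [LiouvilleNumber.partialSum_succ, hp, add_div, pow_sub₀ _ two_ne_zero hlt.le]
  field_simp

theorem exists_approx_cosSeries {ε : ℝ} (hε : 0 < ε) :
    ∃ (Q P : ℕ) (c : ℝ), Even Q ∧ 0 < Q ∧ 0 < c ∧ 1 / (Q : ℝ) < ε ∧ Q * c < ε ∧
      |liouvilleNumber 2 - P / Q| ≤ ε * c ^ 2 ∧
      ∀ x, ∑ j ∈ range Q, (-1) ^ j * cosSeries (x + j * (P / Q)) = Q * c * cos (π * Q * x) := by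
  obtain ⟨k, hk⟩ := exists_nat_gt (1 / ε)
  obtain ⟨m, hm6, hmk⟩ : ∃ m, 6 ≤ m ∧ k ≤ m := ⟨max 6 k, le_max_left _ _, le_max_right _ _⟩
  obtain ⟨p, hp, hsum⟩ := exists_odd_partialSum_eq (m := m) (by omega)
  set Q : ℝ := 2 ^ m ! with hQ
  have hQ1 : 1 ≤ Q := one_le_pow₀ (by norm_num)
  have hQm : (m : ℝ) ≤ Q := by
    have : m ≤ 2 ^ m ! := (Nat.self_le_factorial m).trans Nat.lt_two_pow_self.le
    rw [hQ]
    exact_mod_cast this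
  have hQε : 1 / Q < ε := by
    rw [div_lt_comm₀ (by positivity) hε]
    have : (k : ℝ) ≤ m := by exact_mod_cast hmk
    linarith
  have hrem := LiouvilleNumber.partialSum_add_remainder (m := 2) (by norm_num) m
  have hrem0 := LiouvilleNumber.remainder_pos (m := 2) (by norm_num) m
  have hrem1 := LiouvilleNumber.remainder_lt m (m := 2) le_rfl
  refine ⟨2 ^ m !, p, (Q ^ (m / 3))⁻¹, even_two.pow_of_ne_zero (Nat.factorial_ne_zero m),
    by positivity, by positivity, ?_⟩
  push_cast
  rw [← hQ] at hrem1 ⊢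
  refine ⟨hQε, ?_, ?_, fun x => by simpa only [hQ] using sum_alternating_cosSeries (by omega) hp x⟩
  · refine lt_of_le_of_lt ?_ hQε
    rw [← div_eq_mul_inv, div_le_div_iff₀ (by positivity) (by positivity), one_mul, ← pow_two]
    exact pow_le_pow_right₀ hQ1 (by omega)
  · rw [← hrem, hsum, add_sub_cancel_left, abs_of_pos hrem0]
    calc _ ≤ 1 / Q ^ m := hrem1.le
      _ ≤ 1 / Q ^ (1 + m / 3 * 2) :=
        one_div_le_one_div_of_le (by positivity) (pow_le_pow_right₀ hQ1 (by omega))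
      _ = 1 / Q * (Q ^ (m / 3))⁻¹ ^ 2 := by rw [pow_add, pow_mul]; field_simp
      _ ≤ _ := by gcongr

end CosSeries

section Dynamics

open Real Finset

theorem exists_nat_mul_near {v : ℝ} (hv : v ≠ 0) (t : ℝ) :
    ∃ (r : ℕ) (k : ℤ), r * |v| ≤ 1 ∧ |r * v - t - k| ≤ |v| := by
  have hpos (w u : ℝ) (hw : 0 < w) : ∃ (r : ℕ) (k : ℤ), r * w ≤ 1 ∧ |r * w - u - k| ≤ w := by
    have h1 := Nat.floor_le (div_nonneg (Int.fract_nonneg u) hw.le)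
    have h2 := Nat.lt_floor_add_one (Int.fract u / w)
    rw [le_div_iff₀ hw] at h1
    rw [div_lt_iff₀ hw] at h2
    have h3 := Int.fract_lt_one u
    refine ⟨⌊Int.fract u / w⌋₊, -⌊u⌋, by linarith, ?_⟩
    push_cast
    rw [abs_le]
    have h4 := Int.self_sub_floor u
    constructor <;> linarith
  rcases hv.lt_or_gt with h | h
  · obtain ⟨r, k, h1, h2⟩ := hpos (-v) (-t) (by linarith)
    refine ⟨r, -k, by rwa [abs_of_neg h], ?_⟩
    rw [abs_of_neg h]
    refine le_trans (le_of_eq ?_) h2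
    rw [← abs_neg]
    push_cast
    ring_nf
  · rw [abs_of_pos h]
    exact hpos v t h

theorem addCircle_norm_coe_le (x : ℝ) : ‖(x : AddCircle (1 : ℝ))‖ ≤ |x| := by
  rw [AddCircle.norm_eq]
  simpa using round_le x 0

theorem exists_zsmul_add_near {α : ℝ} (hα : Irrational α) (a : AddCircle (1 : ℝ)) (y : ℝ)
    {η : ℝ} (hη : 0 < η) :
    ∃ (k : ℤ) (x : ℝ), (x : AddCircle (1 : ℝ)) = a + k • (α : AddCircle (1 : ℝ)) ∧ |x - y| < η := by
  have hd : DenseRange (· • (α : AddCircle (1 : ℝ)) : ℤ → AddCircle (1 : ℝ)) :=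
    AddCircle.denseRange_zsmul_coe_iff.2 (by simpa using hα)
  obtain ⟨k, hk⟩ := hd.exists_dist_lt ((y : AddCircle (1 : ℝ)) - a) hη
  obtain ⟨u, rfl⟩ := QuotientAddGroup.mk_surjective a
  have hk' : ‖((u + k * α - y : ℝ) : AddCircle (1 : ℝ))‖ < η := by
    rw [dist_comm, dist_eq_norm] at hk
    have heq : ((u + k * α - y : ℝ) : AddCircle (1 : ℝ)) =
        k • (α : AddCircle (1 : ℝ)) - (y - u) := by
      rw [AddCircle.coe_sub, AddCircle.coe_add, ← zsmul_eq_mul, AddCircle.coe_zsmul]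
      abel
    rw [heq]
    exact hk
  rw [AddCircle.norm_eq] at hk'
  refine ⟨k, u + k * α - round (u + k * α - y), ?_, ?_⟩
  · have h0 : ((round (u + k * α - y) : ℝ) : AddCircle (1 : ℝ)) = 0 :=
      (AddCircle.coe_eq_zero_iff 1).2 ⟨round (u + k * α - y), by simp⟩
    rw [AddCircle.coe_sub, h0, sub_zero, AddCircle.coe_add, ← zsmul_eq_mul, AddCircle.coe_zsmul]
  · refine lt_of_le_of_lt (le_of_eq ?_) hk'
    simp
    ring_nf

/-- The fibred homeomorphism `(a, b) ↦ (a + α, s • a - b + G a)` of the torus. -/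
noncomputable def skewFlip (α : AddCircle (1 : ℝ)) (s : ℤ)
    (G : C(AddCircle (1 : ℝ), AddCircle (1 : ℝ))) : Torus2 ≃ₜ Torus2 where
  toFun z := (z.1 + α, s • z.1 - z.2 + G z.1)
  invFun z := (z.1 - α, s • (z.1 - α) - z.2 + G (z.1 - α))
  left_inv z := by
    ext
    · simp
    · simp; abel
  right_inv z := by
    ext
    · simp
    · simp; abel
  continuous_toFun := by fun_prop
  continuous_invFun := by fun_prop

theorem exists_homeomorph_of_periodic (α : ℝ) (s : ℤ) {F : ℝ → ℝ} (hF : Continuous F)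
    (hper : Function.Periodic F 1) :
    ∃ φ : Torus2 ≃ₜ Torus2, ∀ x y : ℝ,
      torus2Proj (x + α, (s : ℝ) * x - y + F x) = φ (torus2Proj (x, y)) := by
  refine ⟨skewFlip α s ⟨fun a => (hper.lift a : AddCircle (1 : ℝ)),
    (AddCircle.continuous_mk' 1).comp (hF.quotient_lift _)⟩, fun x y => ?_⟩
  change (((x + α : ℝ) : AddCircle (1 : ℝ)), ((s * x - y + F x : ℝ) : AddCircle (1 : ℝ))) =
    ((x : AddCircle (1 : ℝ)) + α, s • (x : AddCircle (1 : ℝ)) - y + F x)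
  rw [← zsmul_eq_mul, AddCircle.coe_add, AddCircle.coe_add, AddCircle.coe_sub, AddCircle.coe_zsmul]

theorem fst_zpow_apply {α : ℝ} {s : ℤ} {F : ℝ → ℝ} {φ : Torus2 ≃ₜ Torus2}
    (hφ : ∀ x y : ℝ, torus2Proj (x + α, (s : ℝ) * x - y + F x) = φ (torus2Proj (x, y)))
    (k : ℤ) (z : Torus2) : ((φ.toEquiv ^ k) z).1 = z.1 + k • (α : AddCircle (1 : ℝ)) := by
  have hstep (z : Torus2) : (φ z).1 = z.1 + α := by
    obtain ⟨⟨x⟩, ⟨y⟩⟩ := z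
    exact congrArg Prod.fst (hφ x y).symm
  induction k generalizing z with
  | zero => simp
  | succ k ih =>
    rw [zpow_add_one, Equiv.Perm.mul_apply, ih, add_zsmul, one_zsmul]
    change (φ z).1 + _ = _
    rw [hstep]
    abel
  | pred k ih =>
    rw [zpow_sub_one, Equiv.Perm.mul_apply, ih, sub_zsmul, one_zsmul]
    have h := hstep (φ.symm z)
    rw [φ.apply_symm_apply] at h
    change (φ.symm z).1 + _ = _
    rw [h]
    abel

theorem pow_two_mul_apply {α : ℝ} {s : ℤ} {F : ℝ → ℝ} {φ : Torus2 ≃ₜ Torus2}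
    (hφ : ∀ x y : ℝ, torus2Proj (x + α, (s : ℝ) * x - y + F x) = φ (torus2Proj (x, y)))
    (n : ℕ) (x y : ℝ) :
    (φ.toEquiv ^ (2 * n)) (torus2Proj (x, y)) =
      torus2Proj (x + 2 * n * α,
        y + n * (s * α) - ∑ j ∈ range (2 * n), (-1) ^ j * F (x + j * α)) := by
  induction n with
  | zero => simp
  | succ n ih =>
    rw [mul_add, mul_one, pow_add, pow_mul_comm, Equiv.Perm.mul_apply, ih, pow_two,
      Equiv.Perm.mul_apply]
    change φ (φ _) = _
    rw [← hφ, ← hφ, sum_range_succ, sum_range_succ]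
    congr 2
    · push_cast; ring
    · have h1 : x + 2 * n * α + α = x + (2 * n + 1 : ℕ) * α := by push_cast; ring
      have h2 : x + 2 * n * α = x + (2 * n : ℕ) * α := by push_cast; ring
      rw [h1, h2, pow_succ, pow_mul]
      push_cast
      ring

theorem sum_alternating_blocks {F : ℝ → ℝ} (hper : Function.Periodic F 1) {Q P : ℕ}
    (hQ : Even Q) (hQ0 : 0 < Q) {x A : ℝ}
    (hA : ∑ j ∈ range Q, (-1) ^ j * F (x + j * (P / Q)) = A) (r : ℕ) :
    ∑ j ∈ range (Q * r), (-1) ^ j * F (x + j * (P / Q)) = r * A := by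
  induction r with
  | zero => simp
  | succ r ih =>
    have hQ' : (Q : ℝ) ≠ 0 := by positivity
    have hterm (j : ℕ) : (-1) ^ (Q * r + j) * F (x + (Q * r + j : ℕ) * (P / Q)) =
        (-1) ^ j * F (x + j * (P / Q)) := by
      have harg : x + (Q * r + j : ℕ) * (P / Q : ℝ) = x + j * (P / Q) + (r * P : ℕ) * 1 := by
        push_cast; field_simp; ring
      rw [harg, hper.nat_mul, pow_add, (hQ.mul_right r).neg_one_pow, one_mul]
    rw [mul_add, mul_one, sum_range_add, ih, sum_congr rfl fun j _ => hterm j, hA]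
    push_cast
    ring

theorem abs_sum_alternating_sub_le {F : ℝ → ℝ} {L : ℝ} (hL0 : 0 ≤ L)
    (hL : ∀ x y, |F x - F y| ≤ L * |x - y|) (x α β : ℝ) (N : ℕ) :
    |∑ j ∈ range N, (-1) ^ j * F (x + j * α) - ∑ j ∈ range N, (-1) ^ j * F (x + j * β)| ≤
      L * N ^ 2 * |α - β| := by
  rw [← sum_sub_distrib]
  refine (abs_sum_le_sum_abs _ _).trans ((sum_le_card_nsmul _ _ (L * N * |α - β|) ?_).trans_eq ?_)
  · intro j hj
    have hj' : (j : ℝ) ≤ N := by exact_mod_cast (mem_range.1 hj).le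
    rw [← mul_sub, abs_mul, abs_neg_one_pow, one_mul]
    refine (hL _ _).trans ?_
    rw [show x + j * α - (x + j * β) = j * (α - β) by ring, abs_mul, Nat.abs_cast, ← mul_assoc]
    gcongr
  · rw [card_range, nsmul_eq_mul]; ring

theorem isMinimal_of_approx {α : ℝ} {s : ℤ} {F : ℝ → ℝ} {φ : Torus2 ≃ₜ Torus2} {L : ℝ}
    (hα : Irrational α) (hper : Function.Periodic F 1) (hL0 : 0 ≤ L)
    (hL : ∀ x y, |F x - F y| ≤ L * |x - y|)
    (happrox : ∀ ε > 0, ∃ (Q P : ℕ) (c : ℝ), Even Q ∧ 0 < Q ∧ 0 < c ∧ 1 / (Q : ℝ) < ε ∧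
      Q * c < ε ∧ |α - P / Q| ≤ ε * c ^ 2 ∧
      ∀ x, ∑ j ∈ range Q, (-1) ^ j * F (x + j * (P / Q)) = Q * c * cos (π * Q * x))
    (hφ : ∀ x y : ℝ, torus2Proj (x + α, (s : ℝ) * x - y + F x) = φ (torus2Proj (x, y))) :
    IsMinimal φ := by
  intro z
  rw [Metric.dense_iff]
  rintro ⟨⟨x'⟩, ⟨y'⟩⟩ η hη
  set ε : ℝ := min 1 (η / (4 * L + |(s : ℝ)| + 6))
  have hs0 := abs_nonneg (s : ℝ)
  have hε0 : 0 < ε := lt_min one_pos (by positivity)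
  have hε1 : ε ≤ 1 := min_le_left _ _
  have hεη : ε * (4 * L + |(s : ℝ)| + 6) ≤ η :=
    (le_div_iff₀ (by positivity)).1 (min_le_right _ _)
  obtain ⟨Q, P, c, hQ, hQ0, hc0, hQε, hQc, hδ, hsum⟩ := happrox ε hε0
  have hQ1 : (1 : ℝ) ≤ Q := by exact_mod_cast hQ0
  have hcQ : c ≤ Q * c := le_mul_of_one_le_left hc0.le hQ1
  set δ : ℝ := α - P / Q with hδ'
  set l : ℤ := ⌊(Q : ℝ) * x' / 2⌋
  obtain ⟨k, x, hx, hxη⟩ := exists_zsmul_add_near hα z.1 (2 * l / Q)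
    (show 0 < (π * Q)⁻¹ by positivity)
  have hxx' : |x - x'| ≤ 3 * ε := by
    have h1 : |2 * l / Q - x'| ≤ 2 * (1 / Q) := by
      have h3 := Int.floor_le ((Q : ℝ) * x' / 2)
      have h4 := Int.lt_floor_add_one ((Q : ℝ) * x' / 2)
      rw [show 2 * l / Q - x' = (2 * l - Q * x') * (1 / Q : ℝ) by field_simp, abs_mul,
        abs_of_nonneg (by positivity : (0 : ℝ) ≤ 1 / Q)]
      refine mul_le_mul_of_nonneg_right ?_ (by positivity)
      rw [abs_le]
      constructor <;> linarith
    have h2 : (π * Q)⁻¹ ≤ 1 / Q := by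
      rw [one_div]
      exact inv_anti₀ (by positivity) (le_mul_of_one_le_left (by positivity)
        (by linarith [pi_gt_three]))
    have h3 := abs_sub_le x (2 * l / Q) x'
    linarith
  have hcos : 1 / 2 ≤ cos (π * Q * x) := by
    have h1 : cos (π * Q * x) = cos (π * Q * (x - 2 * l / Q)) := by
      rw [← cos_sub_int_mul_two_pi (π * Q * x) l]
      congr 1
      field_simp
    have h2 : |π * Q * (x - 2 * l / Q)| ≤ 1 := by
      rw [abs_mul, abs_of_nonneg (by positivity : 0 ≤ π * Q)]
      exact (mul_le_mul_of_nonneg_left hxη.le (by positivity)).trans_eq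
        (mul_inv_cancel₀ (by positivity))
    have h3 := one_sub_sq_div_two_le_cos (x := π * Q * (x - 2 * l / Q))
    have h4 := (sq_le_one_iff_abs_le_one _).2 h2
    linarith
  have hcos1 := cos_le_one (π * Q * x)
  obtain ⟨y, hy⟩ := QuotientAddGroup.mk_surjective ((φ.toEquiv ^ k) z).2
  have hz : (φ.toEquiv ^ k) z = torus2Proj (x, y) :=
    Prod.ext ((fst_zpow_apply hφ k z).trans hx.symm) hy.symm
  set v : ℝ := -(2 * (Q * c * cos (π * Q * x))) with hv
  have hQc0 : 0 < Q * c := by positivity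
  have hvpos : 0 < 2 * (Q * c * cos (π * Q * x)) := by positivity
  have hvabs : |v| = 2 * (Q * c * cos (π * Q * x)) := by rw [hv, abs_neg, abs_of_pos hvpos]
  have hvlow : Q * c ≤ |v| := by rw [hvabs]; nlinarith
  have hvhigh : |v| ≤ 2 * ε := by rw [hvabs]; nlinarith
  obtain ⟨r, w, hr, hrw⟩ := exists_nat_mul_near (v := v) (neg_ne_zero.2 hvpos.ne') (y' - y)
  have hrQ : r * Q * c ≤ 1 := by
    refine le_trans ?_ hr
    rw [mul_assoc]
    gcongr
  have hrQδ : r * Q * |δ| ≤ ε := by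
    calc r * Q * |δ| ≤ r * Q * (ε * c ^ 2) := by gcongr
      _ = r * Q * c * (ε * c) := by ring
      _ ≤ 1 * (ε * 1) := by gcongr; linarith
      _ = ε := by ring
  have hrQδ2 : (r * Q) ^ 2 * |δ| ≤ ε := by
    calc (r * Q) ^ 2 * |δ| ≤ (r * Q) ^ 2 * (ε * c ^ 2) := by gcongr
      _ = (r * Q * c) ^ 2 * ε := by ring
      _ ≤ 1 ^ 2 * ε := by gcongr
      _ = ε := by ring
  have hblocks := sum_alternating_blocks hper hQ hQ0 (hsum x) (2 * r)
  have hcmp := abs_sum_alternating_sub_le hL0 hL x α (P / Q) (Q * (2 * r))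
  rw [hblocks, ← hδ'] at hcmp
  have horbit := pow_two_mul_apply hφ (Q * r) x y
  rw [show 2 * (Q * r) = Q * (2 * r) by ring] at horbit
  set S : ℝ := ∑ j ∈ range (Q * (2 * r)), (-1) ^ j * F (x + j * α)
  have hαQ : Q * α = P + Q * δ := by rw [hδ']; field_simp; ring
  refine ⟨_, ?_, ⟨(Q * (2 * r) : ℕ) + k, rfl⟩⟩
  have hsplit : (φ.toEquiv ^ (((Q * (2 * r) : ℕ) : ℤ) + k)) z = torus2Proj
      (x + 2 * (Q * r : ℕ) * α, y + (Q * r : ℕ) * (s * α) - S) := by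
    rw [zpow_add, Equiv.Perm.mul_apply, hz, zpow_natCast, horbit]
  have hdist {a b : ℝ} (n : ℤ) (h : |a - b - n| < η) :
      dist (a : AddCircle (1 : ℝ)) (b : AddCircle (1 : ℝ)) < η := by
    have h0 : ((n : ℝ) : AddCircle (1 : ℝ)) = 0 :=
      (AddCircle.coe_eq_zero_iff 1).2 ⟨n, by simp⟩
    rw [dist_eq_norm, ← sub_zero ((a : AddCircle (1 : ℝ)) - b), ← h0, ← AddCircle.coe_sub,
      ← AddCircle.coe_sub]
    exact (addCircle_norm_coe_le _).trans_lt h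
  beta_reduce
  rw [hsplit, Metric.mem_ball, Prod.dist_eq, max_lt_iff]
  have hLε : 0 ≤ L * ε := by positivity
  have hsε : 0 ≤ |(s : ℝ)| * ε := by positivity
  constructor
  · refine hdist (2 * r * P) ?_
    have heq : x + 2 * (Q * r : ℕ) * α - x' - (2 * r * P : ℤ) = (x - x') + 2 * (r * Q * δ) := by
      push_cast
      linear_combination 2 * r * hαQ
    rw [heq]
    refine (abs_add_le _ _).trans_lt ?_
    rw [abs_mul, abs_mul, abs_of_nonneg (by positivity : (0 : ℝ) ≤ r * Q), abs_two]
    linarith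
  · refine hdist (s * r * P + w) ?_
    have heq : y + (Q * r : ℕ) * (s * α) - S - y' - (s * r * P + w : ℤ) =
        (r * v - (y' - y) - w) + s * (r * Q * δ) -
          (S - (2 * r : ℕ) * (Q * c * cos (π * Q * x))) := by
      push_cast
      rw [hv]
      linear_combination s * r * hαQ
    have h1 : |s * (r * Q * δ)| ≤ |(s : ℝ)| * ε := by
      rw [abs_mul, abs_mul, abs_of_nonneg (by positivity : (0 : ℝ) ≤ r * Q)]
      gcongr
    have h2 : L * (Q * (2 * r) : ℕ) ^ 2 * |δ| ≤ L * (4 * ε) := by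
      push_cast
      calc _ = L * (4 * ((r * Q) ^ 2 * |δ|)) := by ring
        _ ≤ _ := by gcongr
    rw [heq]
    refine (abs_sub _ _).trans_lt ?_
    have h3 := abs_add_le (r * v - (y' - y) - w) (s * (r * Q * δ))
    linarith

end Dynamics

/-- For every integer `s` there are a Liouville number `α` and a
`C^∞` `ℤ`-periodic `F : ℝ → ℝ` such that the diffeomorphism of `T²` with lift
`(x,y) ↦ (x + α, s·x − y + F x)` is minimal (its linear part is `[[1,0],[s,−1]]`). -/
theorem stmt4 (s : ℤ) :
    ∃ (α : ℝ), Liouville α ∧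
    ∃ F : ℝ → ℝ, ContDiff ℝ (⊤ : ℕ∞) F ∧ (∀ (x : ℝ) (ℓ : ℤ), F (x + ℓ) = F x) ∧
    ∃ φ : Torus2 ≃ₜ Torus2, IsMinimal φ ∧
      ∀ x y : ℝ,
        torus2Proj (x + α, (s : ℝ) * x - y + F x) = φ (torus2Proj (x, y)) := by
  obtain ⟨L, hL0, hL⟩ := exists_abs_cosSeries_sub_le
  have hα : Liouville (liouvilleNumber 2) := by
    exact_mod_cast liouville_liouvilleNumber (m := 2) le_rfl
  obtain ⟨φ, hφ⟩ := exists_homeomorph_of_periodic (liouvilleNumber 2) s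
    contDiff_cosSeries.continuous cosSeries_periodic
  exact ⟨liouvilleNumber 2, hα, cosSeries, contDiff_cosSeries,
    fun x l => by simpa using cosSeries_periodic.int_mul l x, φ,
    isMinimal_of_approx hα.irrational cosSeries_periodic hL0 hL
      (fun _ hε => exists_approx_cosSeries hε) hφ, hφ⟩
end

section
/- Let X be a nonempty compact topological space, φ : X → X a minimal homeomorphism, Y a Hausdorff topological space, h : X → Y a continuous surjection, and b : Y → Y a continuous map with h ∘ φ = b ∘ h. If b has a periodic point (i.e. b^m(y) = y for some y ∈ Y and some integer m ≥ 1), then Y is finite. -/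
/-- Under a minimal homeomorphism of a compact space, a nonempty closed forward invariant set
is the whole space. -/
theorem IsMinimal.eq_univ_of_mapsTo {X : Type*} [TopologicalSpace X] [CompactSpace X]
    {φ : X ≃ₜ X} (hφ : IsMinimal φ) {Z : Set X} (hZ : IsClosed Z) (hne : Z.Nonempty)
    (hinv : Set.MapsTo φ Z Z) : Z = Set.univ := by
  have hclosed (n : ℕ) : IsClosed (φ.symm^[n] ⁻¹' Z) :=
    hZ.preimage (φ.symm.continuous.iterate n)
  obtain ⟨x, hx⟩ : (⋂ n : ℕ, φ.symm^[n] ⁻¹' Z).Nonempty := by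
    refine IsCompact.nonempty_iInter_of_sequence_nonempty_isCompact_isClosed _
      (fun n x hx => ?_) (fun n => ?_) (hclosed 0).isCompact hclosed
    · rw [Set.mem_preimage, Function.iterate_succ_apply'] at hx
      simpa using hinv hx
    · obtain ⟨z, hz⟩ := hne
      refine ⟨φ^[n] z, ?_⟩
      rwa [Set.mem_preimage, (Function.LeftInverse.iterate φ.symm_apply_apply n) z]
  rw [Set.mem_iInter] at hx
  have horbit : (Set.range fun k : ℤ => (φ.toEquiv ^ k) x) ⊆ Z := by
    rintro _ ⟨k, rfl⟩
    obtain ⟨n, rfl | rfl⟩ := k.eq_nat_or_neg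
    · have h := hinv.iterate n (hx 0)
      simpa [← Equiv.Perm.iterate_eq_pow] using h
    · have h := hx n
      beta_reduce
      rw [zpow_neg, zpow_natCast, ← inv_pow, ← Equiv.Perm.iterate_eq_pow]
      exact h
  exact hZ.closure_eq ▸ ((hφ x).mono horbit).closure_eq

/-- If `X` is nonempty compact, `φ : X → X` a minimal homeomorphism,
`h : X → Y` a continuous surjection onto a Hausdorff space intertwining `φ` with a
continuous `b : Y → Y` (`h ∘ φ = b ∘ h`), and `b` has a periodic point, then `Y` is
finite. -/
theorem stmt14 {X Y : Type*} [TopologicalSpace X] [CompactSpace X] [Nonempty X]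
    [TopologicalSpace Y] [T2Space Y]
    (φ : X ≃ₜ X) (hmin : IsMinimal φ)
    (h : X → Y) (hc : Continuous h) (hsurj : Function.Surjective h)
    (b : Y → Y) (hb : Continuous b) (hcomm : h ∘ φ = b ∘ h)
    (hper : ∃ (y : Y) (m : ℕ), 1 ≤ m ∧ b^[m] y = y) :
    Finite Y := by
  obtain ⟨y, m, hm, hy⟩ := hper
  set F : Set Y := (fun i => b^[i] y) '' Set.Iio m
  have hF : F.Finite := (Set.finite_Iio m).image _
  have hbF : Set.MapsTo b F F := by
    rintro _ ⟨i, -, rfl⟩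
    refine ⟨(i + 1) % m, Nat.mod_lt _ hm, ?_⟩
    rw [← Function.iterate_succ_apply' b i y]
    exact Function.IsPeriodicPt.iterate_mod_apply hy (i + 1)
  have hZ : h ⁻¹' F = Set.univ := by
    refine hmin.eq_univ_of_mapsTo (hF.isClosed.preimage hc) ?_ fun x hx => ?_
    · obtain ⟨x, hx⟩ := hsurj y
      exact ⟨x, 0, hm, hx.symm⟩
    · rw [Set.mem_preimage, ← Function.comp_apply (f := h), hcomm]
      exact hbF hx
  refine Set.finite_univ_iff.mp (hF.subset fun z _ => ?_)
  obtain ⟨x, rfl⟩ := hsurj z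
  exact hZ.symm.subset (Set.mem_univ x)
end

section
/- Let m be an integer with m > 2, let B ∈ GL(2,ℤ) have the complex number e^{2πi/m} as an eigenvalue, and let V ∈ ℂ² be an eigenvector of B for the eigenvalue e^{2πi/m}. Then ⟨ℓ, V⟩ ≠ 0 for every nonzero integer vector ℓ ∈ ℤ², where ⟨ℓ, V⟩ = ℓ₁V₁ + ℓ₂V₂. -/
open Real

lemma exp_two_pi_mul_I_div_im_pos {m : ℕ} (hm : 2 < m) :
    0 < (Complex.exp (2 * π * Complex.I / m)).im := by
  have hm' : (2 : ℝ) < m := by exact_mod_cast hm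
  have h : (2 * π * Complex.I / m : ℂ) = ((2 * π / m : ℝ) : ℂ) * Complex.I := by
    push_cast
    ring
  rw [h, Complex.exp_ofReal_mul_I_im]
  apply sin_pos_of_pos_of_lt_pi
  · positivity
  · rw [div_lt_iff₀ (by linarith)]
    nlinarith [pi_pos]

lemma eq_zero_of_intCast_mul_eq_of_im_ne_zero {p q : ℤ} {c z : ℂ} (hq : q ≠ 0)
    (hc : c.im ≠ 0) (h : (p : ℂ) * z = c * q * z) : z = 0 := by
  by_contra hz
  have him := congrArg Complex.im (mul_right_cancel₀ hz h)
  simp [hc, hq] at him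

lemma linearForm_ne_zero_of_mulVec_eq_smul {B : Matrix (Fin 2) (Fin 2) ℤ} {V : Fin 2 → ℂ}
    {c : ℂ} (hc : c.im ≠ 0) (hV : V ≠ 0)
    (heig : (B.map (Int.cast : ℤ → ℂ)).mulVec V = c • V) {l : Fin 2 → ℤ} (hl : l ≠ 0) :
    (l 0 : ℂ) * V 0 + (l 1 : ℂ) * V 1 ≠ 0 := by
  intro h
  have h0 := congrFun heig 0
  have h1 := congrFun heig 1
  simp only [Matrix.mulVec, dotProduct, Fin.sum_univ_two, Matrix.map_apply, Pi.smul_apply,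
    smul_eq_mul] at h0 h1
  apply hV
  by_cases hl0 : l 0 = 0
  · have hl1 : l 1 ≠ 0 := fun hl1 => hl (by ext i; fin_cases i <;> simp [hl0, hl1])
    have hV1 : V 1 = 0 := by simpa [hl0, hl1] using h
    have hV0 : V 0 = 0 := by
      apply eq_zero_of_intCast_mul_eq_of_im_ne_zero (p := B 0 0) one_ne_zero hc
      simpa [hV1] using h0
    ext i; fin_cases i <;> simp [hV0, hV1]
  · have hV1 : V 1 = 0 := by
      apply eq_zero_of_intCast_mul_eq_of_im_ne_zero
        (p := B 1 1 * l 0 - B 1 0 * l 1) hl0 hc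
      push_cast
      linear_combination (l 0 : ℂ) * h1 - (B 1 0 : ℂ) * h
    have hV0 : V 0 = 0 := by simpa [hl0, hV1] using h
    ext i; fin_cases i <;> simp [hV0, hV1]

/-- If `m > 2`, `B ∈ GL(2,ℤ)` has eigenvalue `e^{2πi/m}` with
eigenvector `V ∈ ℂ²`, then `⟨ℓ, V⟩ = ℓ₁V₁ + ℓ₂V₂ ≠ 0` for every nonzero `ℓ ∈ ℤ²`. -/
theorem stmt16 (m : ℕ) (hm : 2 < m)
    (B : Matrix (Fin 2) (Fin 2) ℤ) (hB : IsUnit B.det)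
    (V : Fin 2 → ℂ) (hV : V ≠ 0)
    (heig : (B.map (Int.cast : ℤ → ℂ)).mulVec V
      = Complex.exp (2 * π * Complex.I / m) • V) :
    ∀ ℓ : Fin 2 → ℤ, ℓ ≠ 0 → (ℓ 0 : ℂ) * V 0 + (ℓ 1 : ℂ) * V 1 ≠ 0 :=
  fun _ hl => linearForm_ne_zero_of_mulVec_eq_smul
    (exp_two_pi_mul_I_div_im_pos hm).ne' hV heig hl
end
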